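/- Let C > 0, β > 0, d > 0, α > 1 and d₃ > 0. Let Ω ⊂ ℝ² be a normalized convex domain and f ∈ 𝒮(Ω,C) satisfy PDE (1.2) with parameter β; let u be the Legendre transform function of f relative to 0 with d + u > 0 on Ω. Assume that Φ/(ρ^α(d+u)^α) < d₃ and 1/(ρ(d+u)) < d₃ hold on Ω. Then there exists a constant d₅ > 0, depending only on α, β, d₃, C and d, such that on Ω: exp{−32(2+d₃)C/(C−f)}·(∑_i f_ii)/(ρ^α(d+u)^{α+2}) ≤ d₅, where ∑_i f_ii = ∑_{i=1}^{2} ∂²f/∂x_i² is the Euclidean trace of the Hessian of f. -/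

import Mathlib

open Real Filter Topology Matrix

noncomputable section

/-- The `i`-th partial derivative of `f`. -/
def pd {n : ℕ} (i : Fin n) (f : (Fin n → ℝ) → ℝ) : (Fin n → ℝ) → ℝ :=
  fun x => fderiv ℝ f x (Pi.single i 1)

/-- The Hessian matrix `(∂²f/∂x_i∂x_j)` of `f` at `x`. -/
def hess {n : ℕ} (f : (Fin n → ℝ) → ℝ) (x : Fin n → ℝ) : Matrix (Fin n) (Fin n) ℝ :=
  Matrix.of fun i j => pd i (pd j f) x

/-- The gradient vector of `f` at `x`. -/
def gradv {n : ℕ} (f : (Fin n → ℝ) → ℝ) (x : Fin n → ℝ) : Fin n → ℝ :=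
  fun i => pd i f x

/-- `ρ := (det (f_ij))^(-1/(n+2))`. -/
def rho {n : ℕ} (f : (Fin n → ℝ) → ℝ) (x : Fin n → ℝ) : ℝ :=
  (hess f x).det ^ (-(1 : ℝ) / ((n : ℝ) + 2))

/-- The squared norm `‖grad h‖² = ∑ f^{ij} h_i h_j` with respect to the Calabi metric of `f`. -/
def gradSq {n : ℕ} (f h : (Fin n → ℝ) → ℝ) (x : Fin n → ℝ) : ℝ :=
  ∑ i, ∑ j, (hess f x)⁻¹ i j * pd i h x * pd j h x

/-- The Laplacian `Δh = (1/√det)(∑ ∂_i(√det · f^{ij} ∂_j h))` with respect to the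
Calabi metric of `f`. -/
def calabiLap {n : ℕ} (f h : (Fin n → ℝ) → ℝ) (x : Fin n → ℝ) : ℝ :=
  (Real.sqrt (hess f x).det)⁻¹ *
    ∑ i, ∑ j, pd i (fun y => Real.sqrt (hess f y).det * (hess f y)⁻¹ i j * pd j h y) x

/-- `Φ := ‖grad ρ‖²/ρ²`. -/
def Phi {n : ℕ} (f : (Fin n → ℝ) → ℝ) (x : Fin n → ℝ) : ℝ :=
  gradSq f (rho f) x / (rho f x) ^ 2

/-- PDE (1.2): `Δρ = -β ‖grad ρ‖²/ρ` on `Ω`. -/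
def PDE2 {n : ℕ} (f : (Fin n → ℝ) → ℝ) (β : ℝ) (Ω : Set (Fin n → ℝ)) : Prop :=
  ∀ x ∈ Ω, calabiLap f (rho f) x = -β * gradSq f (rho f) x / rho f x

/-- The cofactor matrix of a square matrix. -/
def cof {n : ℕ} (H : Matrix (Fin n) (Fin n) ℝ) : Matrix (Fin n) (Fin n) ℝ :=
  (Matrix.adjugate H)ᵀ

/-- PDE (1.1): `∑ F^{ij} w_ij = 0` with `w = (det (f_ij))^a` on `Ω`, where `(F^{ij})`
is the cofactor matrix of the Hessian of `f`. -/
def PDE1 {n : ℕ} (f : (Fin n → ℝ) → ℝ) (a : ℝ) (Ω : Set (Fin n → ℝ)) : Prop :=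
  ∀ x ∈ Ω, ∑ i, ∑ j,
    cof (hess f x) i j * pd i (pd j fun y => (hess f y).det ^ a) x = 0

/-- `f` is a quadratic polynomial on `ℝ²`. -/
def IsQuadratic (f : (Fin 2 → ℝ) → ℝ) : Prop :=
  ∃ (Q : Matrix (Fin 2) (Fin 2) ℝ) (b : Fin 2 → ℝ) (c : ℝ),
    ∀ x, f x = (∑ i, ∑ j, Q i j * x i * x j) + (∑ i, b i * x i) + c

/-- Euclidean open ball of radius `r` centered at `0` in `ℝ²`. -/
def ebal (r : ℝ) : Set (Fin 2 → ℝ) := {x | (x 0) ^ 2 + (x 1) ^ 2 < r ^ 2}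

/-- Euclidean norm on `ℝ²`. -/
def enorm2 (x : Fin 2 → ℝ) : ℝ := Real.sqrt ((x 0) ^ 2 + (x 1) ^ 2)

/-- A normalized convex domain: `B_{2^{-3/2}}(0) ⊆ Ω ⊆ B_1(0)`. -/
def NormalizedDomain (Ω : Set (Fin 2 → ℝ)) : Prop :=
  IsOpen Ω ∧ Convex ℝ Ω ∧ ebal ((2 : ℝ) ^ (-(3 : ℝ) / 2)) ⊆ Ω ∧ Ω ⊆ ebal 1

/-- The class `𝒮(Ω,C)`: smooth strictly convex functions on `Ω` with `inf f = 0` and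
`f = C` on `∂Ω`. -/
def SClass (Ω : Set (Fin 2 → ℝ)) (C : ℝ) (f : (Fin 2 → ℝ) → ℝ) : Prop :=
  ContDiffOn ℝ (⊤ : ℕ∞) f Ω ∧ (∀ x ∈ Ω, (hess f x).PosDef) ∧
    sInf (f '' Ω) = 0 ∧ ContinuousOn f (closure Ω) ∧ ∀ x ∈ frontier Ω, f x = C

/-- `u` is the Legendre transform function of `f` relative to `0`:
`u(∇f(x)) = ⟨x, ∇f(x)⟩ - f(x)`. -/
def LegendreOf (Ω : Set (Fin 2 → ℝ)) (f u : (Fin 2 → ℝ) → ℝ) : Prop :=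
  ∀ x ∈ Ω, u (gradv f x) = (∑ i, x i * gradv f x i) - f x

end

/-- The function `h` of one variable has first derivative `h₁` and second derivative `h₂` at `0`. -/
def Jet2 (h : ℝ → ℝ) (h₁ h₂ : ℝ) : Prop :=
  ∃ h' : ℝ → ℝ, (∀ᶠ t in 𝓝 0, HasDerivAt h (h' t) t) ∧ h' 0 = h₁ ∧ HasDerivAt h' h₂ 0

namespace Jet2

variable {h k : ℝ → ℝ} {h₁ h₂ k₁ k₂ : ℝ}

theorem hasDerivAt (H : Jet2 h h₁ h₂) : HasDerivAt h h₁ 0 := by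
  obtain ⟨h', H1, H2, _⟩ := H
  exact H2 ▸ H1.self_of_nhds

theorem congr' (H : Jet2 h h₁ h₂) (hk : k =ᶠ[𝓝 0] h) : Jet2 k h₁ h₂ := by
  obtain ⟨h', H1, H2, H3⟩ := H
  refine ⟨h', ?_, H2, H3⟩
  filter_upwards [H1, hk.eventuallyEq_nhds] with t ht hkt
  exact ht.congr_of_eventuallyEq hkt

theorem congr_val (H : Jet2 h h₁ h₂) (e₁ : h₁ = k₁) (e₂ : h₂ = k₂) : Jet2 h k₁ k₂ := by
  subst e₁ e₂; exact H

theorem unique (H : Jet2 h h₁ h₂) (K : Jet2 h k₁ k₂) : h₁ = k₁ ∧ h₂ = k₂ := by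
  refine ⟨H.hasDerivAt.unique K.hasDerivAt, ?_⟩
  obtain ⟨h', H1, H2, H3⟩ := H
  obtain ⟨k', K1, K2, K3⟩ := K
  have : h' =ᶠ[𝓝 0] k' := by
    filter_upwards [H1, K1] with t ht kt using ht.unique kt
  exact H3.unique (K3.congr_of_eventuallyEq this)

theorem unique_of_eventuallyEq (H : Jet2 h h₁ h₂) (K : Jet2 k k₁ k₂) (e : h =ᶠ[𝓝 0] k) :
    h₁ = k₁ ∧ h₂ = k₂ :=
  H.unique (K.congr' e)

theorem const (c : ℝ) : Jet2 (fun _ => c) 0 0 :=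
  ⟨fun _ => 0, Eventually.of_forall fun t => hasDerivAt_const t c, rfl, hasDerivAt_const 0 0⟩

theorem add (H : Jet2 h h₁ h₂) (K : Jet2 k k₁ k₂) :
    Jet2 (fun t => h t + k t) (h₁ + k₁) (h₂ + k₂) := by
  obtain ⟨h', H1, H2, H3⟩ := H
  obtain ⟨k', K1, K2, K3⟩ := K
  refine ⟨fun t => h' t + k' t, ?_, by simp [H2, K2], H3.fun_add K3⟩
  filter_upwards [H1, K1] with t ht kt using ht.fun_add kt

theorem mul (H : Jet2 h h₁ h₂) (K : Jet2 k k₁ k₂) :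
    Jet2 (fun t => h t * k t) (h₁ * k 0 + h 0 * k₁) (h₂ * k 0 + 2 * (h₁ * k₁) + h 0 * k₂) := by
  have h0 := H.hasDerivAt
  have k0 := K.hasDerivAt
  obtain ⟨h', H1, H2, H3⟩ := H
  obtain ⟨k', K1, K2, K3⟩ := K
  refine ⟨fun t => h' t * k t + h t * k' t, ?_, by simp [H2, K2], ?_⟩
  · filter_upwards [H1, K1] with t ht kt using ht.fun_mul kt
  · refine ((H3.fun_mul k0).fun_add (h0.fun_mul K3)).congr_deriv ?_
    rw [H2, K2]; ring

theorem const_mul (c : ℝ) (H : Jet2 h h₁ h₂) : Jet2 (fun t => c * h t) (c * h₁) (c * h₂) :=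
  ((const c).mul H).congr_val (by ring) (by ring)

theorem neg (H : Jet2 h h₁ h₂) : Jet2 (fun t => -h t) (-h₁) (-h₂) := by
  simpa using H.const_mul (-1)

theorem sub (H : Jet2 h h₁ h₂) (K : Jet2 k k₁ k₂) :
    Jet2 (fun t => h t - k t) (h₁ - k₁) (h₂ - k₂) := by
  simpa [sub_eq_add_neg] using H.add K.neg

theorem sq (H : Jet2 h h₁ h₂) :
    Jet2 (fun t => h t ^ 2) (2 * h 0 * h₁) (2 * h₁ ^ 2 + 2 * h 0 * h₂) := by
  have := (H.mul H).congr_val (k₁ := 2 * h 0 * h₁) (k₂ := 2 * h₁ ^ 2 + 2 * h 0 * h₂)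
    (by ring) (by ring)
  simpa [pow_two] using this

theorem exp (H : Jet2 h h₁ h₂) :
    Jet2 (fun t => Real.exp (h t)) (Real.exp (h 0) * h₁) (Real.exp (h 0) * (h₂ + h₁ ^ 2)) := by
  have h0 := H.hasDerivAt
  obtain ⟨h', H1, H2, H3⟩ := H
  refine ⟨fun t => Real.exp (h t) * h' t, ?_, by simp [H2], ?_⟩
  · filter_upwards [H1] with t ht using ht.exp
  · refine (h0.exp.fun_mul H3).congr_deriv ?_
    rw [H2]; ring

theorem inv (H : Jet2 h h₁ h₂) (hh : h 0 ≠ 0) :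
    Jet2 (fun t => (h t)⁻¹) (-h₁ / h 0 ^ 2) (-h₂ / h 0 ^ 2 + 2 * h₁ ^ 2 / h 0 ^ 3) := by
  have h0 := H.hasDerivAt
  obtain ⟨h', H1, H2, H3⟩ := H
  refine ⟨fun t => -h' t / h t ^ 2, ?_, by simp [H2], ?_⟩
  · filter_upwards [H1, h0.continuousAt.eventually_ne hh] with t ht hn
    exact ht.fun_inv hn
  · refine ((H3.fun_neg).fun_div (h0.fun_pow 2) (pow_ne_zero 2 hh)).congr_deriv ?_
    rw [H2]; field_simp; ring

theorem log (H : Jet2 h h₁ h₂) (hh : h 0 ≠ 0) :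
    Jet2 (fun t => Real.log (h t)) (h₁ / h 0) (h₂ / h 0 - h₁ ^ 2 / h 0 ^ 2) := by
  have h0 := H.hasDerivAt
  obtain ⟨h', H1, H2, H3⟩ := H
  refine ⟨fun t => h' t / h t, ?_, by simp [H2], ?_⟩
  · filter_upwards [H1, h0.continuousAt.eventually_ne hh] with t ht hn
    exact ht.log hn
  · refine (H3.fun_div h0 hh).congr_deriv ?_
    rw [H2]; field_simp

theorem of_isLocalMax (H : Jet2 h h₁ h₂) (hm : IsLocalMax h 0) : h₁ = 0 ∧ h₂ ≤ 0 := by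
  have e1 : h₁ = 0 := hm.hasDerivAt_eq_zero H.hasDerivAt
  refine ⟨e1, ?_⟩
  by_contra! hpos
  have h0 := H.hasDerivAt
  have HH := H
  obtain ⟨h', H1, H2, H3⟩ := H
  have hd : deriv h =ᶠ[𝓝 0] h' := by
    filter_upwards [H1] with t ht using ht.deriv
  have hmin : IsLocalMin h 0 := by
    refine isLocalMin_of_deriv_deriv_pos ?_ ?_ h0.continuousAt
    · rw [hd.deriv_eq, H3.deriv]; exact hpos
    · rw [h0.deriv, e1]
  have hc : h =ᶠ[𝓝 0] fun _ => h 0 := by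
    filter_upwards [hm, hmin] with t a b using le_antisymm a b
  have := (HH.unique_of_eventuallyEq (const (h 0)) hc).2
  exact hpos.ne' this

end Jet2

/-- The derivative of `h` in the constant direction `e`. -/
noncomputable def dirDeriv (e : Fin 2 → ℝ) (h : (Fin 2 → ℝ) → ℝ) : (Fin 2 → ℝ) → ℝ :=
  fun x => fderiv ℝ h x e

section DirDeriv

variable {U : Set (Fin 2 → ℝ)} {h k : (Fin 2 → ℝ) → ℝ} {x : Fin 2 → ℝ}

theorem ContDiffOn.dirDeriv (hU : IsOpen U) (hh : ContDiffOn ℝ (⊤ : ℕ∞) h U) (e : Fin 2 → ℝ) :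
    ContDiffOn ℝ (⊤ : ℕ∞) (dirDeriv e h) U :=
  (hh.fderiv_of_isOpen hU (by simp)).clm_apply contDiffOn_const

theorem dirDeriv_comm (hU : IsOpen U) (hh : ContDiffOn ℝ (⊤ : ℕ∞) h U) (hx : x ∈ U)
    (e e' : Fin 2 → ℝ) : dirDeriv e (dirDeriv e' h) x = dirDeriv e' (dirDeriv e h) x := by
  have hc : ContDiffAt ℝ (⊤ : ℕ∞) h x := hh.contDiffAt (hU.mem_nhds hx)
  have hs : IsSymmSndFDerivAt ℝ h x := hc.isSymmSndFDerivAt (by simp; exact WithTop.coe_le_coe.2 le_top)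
  have hd : DifferentiableAt ℝ (fderiv ℝ h) x :=
    (((hh.fderiv_of_isOpen (m := (⊤ : ℕ∞)) hU (by simp)).contDiffAt
      (hU.mem_nhds hx)).differentiableAt (by simp))
  have key : ∀ a b : Fin 2 → ℝ,
      fderiv ℝ (fun y => fderiv ℝ h y a) x b = fderiv ℝ (fderiv ℝ h) x b a := by
    intro a b
    rw [fderiv_clm_apply hd (differentiableAt_const a)]
    simp
  have e1 := key e' e
  have e2 := key e e'
  rw [hs.eq] at e1
  exact e1.trans e2.symm

theorem dirDeriv_congr (hU : IsOpen U) (hx : x ∈ U) (hk : ∀ y ∈ U, h y = k y) (e : Fin 2 → ℝ) :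
    dirDeriv e h x = dirDeriv e k x := by
  have : h =ᶠ[𝓝 x] k := by
    filter_upwards [hU.mem_nhds hx] with y hy using hk y hy
  simp only [dirDeriv, this.fderiv_eq]

theorem eventually_line_mem (hU : IsOpen U) (hx : x ∈ U) (e : Fin 2 → ℝ) :
    ∀ᶠ t in 𝓝 (0 : ℝ), x + t • e ∈ U := by
  have hc : ContinuousAt (fun t : ℝ => x + t • e) 0 := by fun_prop
  exact hc.eventually_mem (by simpa using hU.mem_nhds hx)

theorem jet2_line (hU : IsOpen U) (hh : ContDiffOn ℝ (⊤ : ℕ∞) h U) (hx : x ∈ U)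
    (e : Fin 2 → ℝ) :
    Jet2 (fun t => h (x + t • e)) (dirDeriv e h x) (dirDeriv e (dirDeriv e h) x) := by
  have key : ∀ {k : (Fin 2 → ℝ) → ℝ}, ContDiffOn ℝ (⊤ : ℕ∞) k U → ∀ t : ℝ, x + t • e ∈ U →
      HasDerivAt (fun t => k (x + t • e)) (dirDeriv e k (x + t • e)) t := by
    intro k hk t ht
    have h1 : HasFDerivAt k (fderiv ℝ k (x + t • e)) (x + t • e) :=
      ((hk.contDiffAt (hU.mem_nhds ht)).differentiableAt (by simp)).hasFDerivAt
    have h2 : HasDerivAt (fun t : ℝ => x + t • e) e t := by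
      simpa using ((hasDerivAt_id t).smul_const e).const_add x
    exact h1.comp_hasDerivAt t h2
  refine ⟨fun t => dirDeriv e h (x + t • e), ?_, by simp, ?_⟩
  · filter_upwards [eventually_line_mem hU hx e] with t ht using key hh t ht
  · simpa using key (hh.dirDeriv hU e) 0 (by simpa using hx)

theorem dirDeriv_add_dir (a b : ℝ) (e e' : Fin 2 → ℝ) :
    dirDeriv (a • e + b • e') h x = a * dirDeriv e h x + b * dirDeriv e' h x := by
  simp [dirDeriv]

end DirDeriv

/-- `log ρ`, written through the logarithm of the Hessian determinant. -/
noncomputable def logRho (f : (Fin 2 → ℝ) → ℝ) (x : Fin 2 → ℝ) : ℝ :=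
  -(1 / 4) * Real.log (hess f x).det

section Coordinates

variable {Ω : Set (Fin 2 → ℝ)} {f : (Fin 2 → ℝ) → ℝ} {x : Fin 2 → ℝ}

theorem ContDiffOn.pd (hΩ : IsOpen Ω) {h : (Fin 2 → ℝ) → ℝ} (hh : ContDiffOn ℝ (⊤ : ℕ∞) h Ω)
    (i : Fin 2) : ContDiffOn ℝ (⊤ : ℕ∞) (pd i h) Ω :=
  hh.dirDeriv hΩ _

theorem pd_comm (hΩ : IsOpen Ω) {h : (Fin 2 → ℝ) → ℝ} (hh : ContDiffOn ℝ (⊤ : ℕ∞) h Ω)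
    (hx : x ∈ Ω) (i j : Fin 2) : pd i (pd j h) x = pd j (pd i h) x :=
  dirDeriv_comm hΩ hh hx _ _

theorem pd_congr (hΩ : IsOpen Ω) {h k : (Fin 2 → ℝ) → ℝ} (hx : x ∈ Ω)
    (hk : ∀ y ∈ Ω, h y = k y) (i : Fin 2) : pd i h x = pd i k x :=
  dirDeriv_congr hΩ hx hk _

theorem pd_mul (hΩ : IsOpen Ω) {h k : (Fin 2 → ℝ) → ℝ} (hh : ContDiffOn ℝ (⊤ : ℕ∞) h Ω)
    (hk : ContDiffOn ℝ (⊤ : ℕ∞) k Ω) (hx : x ∈ Ω) (i : Fin 2) :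
    pd i (fun y => h y * k y) x = pd i h x * k x + h x * pd i k x := by
  have := ((jet2_line hΩ (hh.mul hk) hx (Pi.single i 1)).unique
    ((jet2_line hΩ hh hx (Pi.single i 1)).mul (jet2_line hΩ hk hx (Pi.single i 1)))).1
  rw [zero_smul, add_zero] at this
  exact this

theorem pd_exp (hΩ : IsOpen Ω) {h : (Fin 2 → ℝ) → ℝ} (hh : ContDiffOn ℝ (⊤ : ℕ∞) h Ω)
    (c : ℝ) (hx : x ∈ Ω) (i : Fin 2) :
    pd i (fun y => Real.exp (c * h y)) x = c * Real.exp (c * h x) * pd i h x := by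
  have := ((jet2_line hΩ ((contDiffOn_const.mul hh).exp) hx (Pi.single i 1)).unique
    (((jet2_line hΩ hh hx (Pi.single i 1)).const_mul c).exp)).1
  rw [zero_smul, add_zero] at this
  refine Eq.trans this ?_
  simp only [pd, dirDeriv]; ring

theorem det_hess (hΩ : IsOpen Ω) (hf : ContDiffOn ℝ (⊤ : ℕ∞) f Ω) (hx : x ∈ Ω) :
    (hess f x).det = pd 0 (pd 0 f) x * pd 1 (pd 1 f) x - pd 0 (pd 1 f) x ^ 2 := by
  rw [Matrix.det_fin_two]
  simp only [hess, Matrix.of_apply]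
  rw [pd_comm hΩ hf hx 1 0]; ring

theorem det_hess_pos (hp : (hess f x).PosDef) : 0 < (hess f x).det := hp.det_pos

theorem contDiffOn_det_hess (hΩ : IsOpen Ω) (hf : ContDiffOn ℝ (⊤ : ℕ∞) f Ω) :
    ContDiffOn ℝ (⊤ : ℕ∞) (fun x => (hess f x).det) Ω := by
  refine ContDiffOn.congr (f := fun x => pd 0 (pd 0 f) x * pd 1 (pd 1 f) x - pd 0 (pd 1 f) x ^ 2)
    ?_ fun x hx => det_hess hΩ hf hx
  exact (((hf.pd hΩ 0).pd hΩ 0).mul ((hf.pd hΩ 1).pd hΩ 1)).sub (((hf.pd hΩ 1).pd hΩ 0).pow 2)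

theorem contDiffOn_logRho (hΩ : IsOpen Ω) (hf : ContDiffOn ℝ (⊤ : ℕ∞) f Ω)
    (hp : ∀ x ∈ Ω, (hess f x).PosDef) : ContDiffOn ℝ (⊤ : ℕ∞) (logRho f) Ω :=
  contDiffOn_const.mul ((contDiffOn_det_hess hΩ hf).log fun x hx => (hp x hx).det_pos.ne')

theorem det_hess_eq_exp (hp : (hess f x).PosDef) :
    (hess f x).det = Real.exp (-4 * logRho f x) := by
  rw [logRho]
  ring_nf
  rw [Real.exp_log hp.det_pos]

theorem rho_eq_exp (hp : (hess f x).PosDef) : rho f x = Real.exp (logRho f x) := by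
  rw [rho, Real.rpow_def_of_pos hp.det_pos, logRho]
  congr 1
  push_cast
  ring

theorem pd_rho (hΩ : IsOpen Ω) (hf : ContDiffOn ℝ (⊤ : ℕ∞) f Ω)
    (hp : ∀ x ∈ Ω, (hess f x).PosDef) (hx : x ∈ Ω) (i : Fin 2) :
    pd i (rho f) x = rho f x * pd i (logRho f) x := by
  rw [pd_congr hΩ hx (k := fun y => Real.exp (1 * logRho f y))
    (fun y hy => by rw [rho_eq_exp (hp y hy), one_mul]) i,
    pd_exp hΩ (contDiffOn_logRho hΩ hf hp) 1 hx, rho_eq_exp (hp x hx)]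
  simp

/-- The quadratic form of the cofactor matrix of the Hessian of `f`. -/
noncomputable def cofForm (f : (Fin 2 → ℝ) → ℝ) (x : Fin 2 → ℝ) (a b c : ℝ) : ℝ :=
  pd 1 (pd 1 f) x * a - 2 * pd 0 (pd 1 f) x * b + pd 0 (pd 0 f) x * c

theorem inv_hess (hΩ : IsOpen Ω) (hf : ContDiffOn ℝ (⊤ : ℕ∞) f Ω) (hx : x ∈ Ω) :
    (hess f x)⁻¹ = (hess f x).det⁻¹ • !![pd 1 (pd 1 f) x, -pd 0 (pd 1 f) x;
      -pd 0 (pd 1 f) x, pd 0 (pd 0 f) x] := by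
  rw [Matrix.inv_def, Matrix.adjugate_fin_two, Ring.inverse_eq_inv']
  simp only [hess, Matrix.of_apply]
  rw [pd_comm hΩ hf hx 1 0]

theorem gradSq_rho (hΩ : IsOpen Ω) (hf : ContDiffOn ℝ (⊤ : ℕ∞) f Ω)
    (hp : ∀ x ∈ Ω, (hess f x).PosDef) (hx : x ∈ Ω) :
    gradSq f (rho f) x = rho f x ^ 2 * ((hess f x).det⁻¹ * cofForm f x (pd 0 (logRho f) x ^ 2)
      (pd 0 (logRho f) x * pd 1 (logRho f) x) (pd 1 (logRho f) x ^ 2)) := by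
  simp only [gradSq, inv_hess hΩ hf hx, Fin.sum_univ_two, pd_rho hΩ hf hp hx, cofForm]
  simp
  ring

theorem Phi_eq (hΩ : IsOpen Ω) (hf : ContDiffOn ℝ (⊤ : ℕ∞) f Ω)
    (hp : ∀ x ∈ Ω, (hess f x).PosDef) (hx : x ∈ Ω) :
    Phi f x = (hess f x).det⁻¹ * cofForm f x (pd 0 (logRho f) x ^ 2)
      (pd 0 (logRho f) x * pd 1 (logRho f) x) (pd 1 (logRho f) x ^ 2) := by
  have : rho f x ≠ 0 := by rw [rho_eq_exp (hp x hx)]; exact (Real.exp_pos _).ne'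
  rw [Phi, gradSq_rho hΩ hf hp hx]
  field_simp

theorem PDE2.cofForm_eq {β : ℝ} (h : PDE2 f β Ω) (hΩ : IsOpen Ω)
    (hf : ContDiffOn ℝ (⊤ : ℕ∞) f Ω) (hp : ∀ x ∈ Ω, (hess f x).PosDef) (hx : x ∈ Ω) :
    cofForm f x (pd 0 (pd 0 (logRho f)) x) (pd 0 (pd 1 (logRho f)) x) (pd 1 (pd 1 (logRho f)) x) =
      -(β + 3) * cofForm f x (pd 0 (logRho f) x ^ 2)
      (pd 0 (logRho f) x * pd 1 (logRho f) x) (pd 1 (logRho f) x ^ 2) := by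
  have hl := contDiffOn_logRho hΩ hf hp
  have h2 : ∀ i j, ContDiffOn ℝ (⊤ : ℕ∞) (pd i (pd j f)) Ω := fun i j => (hf.pd hΩ j).pd hΩ i
  have hx0 := h x hx
  have coef : ∀ (c : ℝ) (G : (Fin 2 → ℝ) → ℝ), ContDiffOn ℝ (⊤ : ℕ∞) G Ω → ∀ i j k,
      (∀ y ∈ Ω, (hess f y)⁻¹ i j = (hess f y).det⁻¹ * (c * G y)) →
      pd k (fun y => Real.sqrt (hess f y).det * (hess f y)⁻¹ i j * pd j (rho f) y) x =
        c * Real.exp (3 * logRho f x) * (pd k G x * pd j (logRho f) x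
          + 3 * G x * pd k (logRho f) x * pd j (logRho f) x + G x * pd k (pd j (logRho f)) x) := by
    intro c G hG i j k hGe
    have e1 : ∀ y ∈ Ω, Real.sqrt (hess f y).det * (hess f y)⁻¹ i j * pd j (rho f) y =
        (c * Real.exp (3 * logRho f y)) * (G y * pd j (logRho f) y) := by
      intro y hy
      rw [hGe y hy, pd_rho hΩ hf hp hy, rho_eq_exp (hp y hy), det_hess_eq_exp (hp y hy)]
      have s1 : Real.sqrt (Real.exp (-4 * logRho f y)) = Real.exp (-2 * logRho f y) := by
        rw [Real.sqrt_eq_iff_mul_self_eq (Real.exp_pos _).le (Real.exp_pos _).le, ← Real.exp_add]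
        ring_nf
      have s2 : Real.exp (-2 * logRho f y) * Real.exp (4 * logRho f y) * Real.exp (logRho f y) =
          Real.exp (3 * logRho f y) := by
        rw [← Real.exp_add, ← Real.exp_add]; ring_nf
      rw [s1, ← Real.exp_neg, ← s2]
      ring_nf
    have hexp : ContDiffOn ℝ (⊤ : ℕ∞) (fun y => Real.exp (3 * logRho f y)) Ω :=
      (contDiffOn_const.mul hl).exp
    rw [pd_congr hΩ hx e1, pd_mul hΩ (contDiffOn_const.mul hexp) (hG.mul (hl.pd hΩ j)) hx,
      pd_mul hΩ contDiffOn_const hexp hx, pd_mul hΩ hG (hl.pd hΩ j) hx, pd_exp hΩ hl 3 hx]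
    have : pd k (fun _ => c) x = 0 := by simp [pd]
    rw [this]; ring
  have c00 := coef 1 _ (h2 1 1) 0 0 0 fun y hy => by rw [inv_hess hΩ hf hy]; simp
  have c01 := coef (-1) _ (h2 0 1) 0 1 0 fun y hy => by rw [inv_hess hΩ hf hy]; simp
  have c10 := coef (-1) _ (h2 0 1) 1 0 1 fun y hy => by rw [inv_hess hΩ hf hy]; simp
  have c11 := coef 1 _ (h2 0 0) 1 1 1 fun y hy => by rw [inv_hess hΩ hf hy]; simp
  have d0 : pd 1 (pd 0 (pd 1 f)) x = pd 0 (pd 1 (pd 1 f)) x := pd_comm hΩ (hf.pd hΩ 1) hx 1 0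
  have d1 : pd 0 (pd 0 (pd 1 f)) x = pd 1 (pd 0 (pd 0 f)) x := by
    rw [pd_comm hΩ (hf.pd hΩ 0) hx 1 0]
    exact pd_congr hΩ hx (fun y hy => pd_comm hΩ hf hy 0 1) 0
  have d2 := pd_comm hΩ hl hx 1 0
  rw [calabiLap, gradSq_rho hΩ hf hp hx, rho_eq_exp (hp x hx)] at hx0
  simp only [Fin.sum_univ_two] at hx0
  rw [c00, c01, c10, c11, det_hess_eq_exp (hp x hx), d0, d1, d2] at hx0
  have s1 : Real.sqrt (Real.exp (-4 * logRho f x)) = Real.exp (-2 * logRho f x) := by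
    rw [Real.sqrt_eq_iff_mul_self_eq (Real.exp_pos _).le (Real.exp_pos _).le, ← Real.exp_add]
    ring_nf
  rw [s1, ← Real.exp_neg, ← Real.exp_neg] at hx0
  set E := Real.exp (logRho f x) with hE
  have hEpos : 0 < E := Real.exp_pos _
  have p2 : Real.exp (-(-2 * logRho f x)) = E ^ 2 := by
    rw [hE, ← Real.exp_nat_mul]; push_cast; ring_nf
  have p3 : Real.exp (3 * logRho f x) = E ^ 3 := by
    rw [hE, ← Real.exp_nat_mul]; push_cast; ring_nf
  have p4 : Real.exp (-(-4 * logRho f x)) = E ^ 4 := by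
    rw [hE, ← Real.exp_nat_mul]; push_cast; ring_nf
  rw [p2, p3, p4] at hx0
  field_simp at hx0
  simp only [cofForm] at *
  linarith [hx0]

end Coordinates

section Algebra

theorem third_order_aux {p a c w : ℝ} (hp0 : 0 ≤ p) (hp1 : p ≤ 1) (h : a + c = -4 * w) :
    (a ^ 2 + 3 * c ^ 2) / 16 - 500 * w ^ 2 ≤
      (1 - p) * a ^ 2 + (1 + p) * c ^ 2 - 3 / 2 * ((1 - p) * a + p * c) ^ 2 := by
  obtain rfl : c = -4 * w - a := by linarith
  have hpp : p * (1 - p) ≥ 0 := mul_nonneg hp0 (by linarith)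
  set B : ℝ := 8 * (1 + p) + 12 * p * (1 - 2 * p) - 3 / 2 with hB
  have hB2 : B ^ 2 ≤ 484 := by
    have h1 : B ≤ 22 := by rw [hB]; nlinarith
    have h2 : -22 ≤ B := by rw [hB]; nlinarith
    nlinarith
  nlinarith [sq_nonneg (a / 2 + B * w), mul_nonneg (sub_nonneg.2 hB2) (sq_nonneg w),
    mul_nonneg hpp (sq_nonneg a), mul_nonneg hpp (sq_nonneg w), mul_nonneg hp0 (sq_nonneg w),
    sq_nonneg w, sq_nonneg a]

/-- Third order gain in the Laplacian of the logarithm of the Euclidean trace. -/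
theorem third_order_gain {μ₁ μ₂ a b c e w₁ w₂ : ℝ} (h₁ : 0 ≤ μ₁) (h₂ : 0 ≤ μ₂)
    (hμ : μ₁ + μ₂ = 1) (hac : a + c = -4 * w₁) (hbe : b + e = -4 * w₂) :
    (a ^ 2 + 3 * b ^ 2 + 3 * c ^ 2 + e ^ 2) / 16 - 500 * (w₁ ^ 2 + w₂ ^ 2) ≤
      μ₁ * (a ^ 2 + 2 * b ^ 2 + c ^ 2) + μ₂ * (b ^ 2 + 2 * c ^ 2 + e ^ 2) -
        3 / 2 * ((μ₁ * a + μ₂ * c) ^ 2 + (μ₁ * b + μ₂ * e) ^ 2) := by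
  have k1 := third_order_aux h₂ (by linarith) hac
  have k2 := third_order_aux (a := e) (c := b) h₁ (by linarith) (by linarith : e + b = -4 * w₂)
  obtain rfl : μ₁ = 1 - μ₂ := by linarith
  nlinarith [k1, k2]

theorem sq_add_mul_le (x₁ x₂ w₁ w₂ : ℝ) :
    (w₁ * x₁ + w₂ * x₂) ^ 2 ≤ (w₁ ^ 2 + w₂ ^ 2) * (x₁ ^ 2 + x₂ ^ 2) := by
  nlinarith [sq_nonneg (w₁ * x₂ - w₂ * x₁)]

theorem sq_quad_le (x y z w₁ w₂ : ℝ) :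
    (x * w₁ ^ 2 + 2 * y * w₁ * w₂ + z * w₂ ^ 2) ^ 2 ≤
      (x ^ 2 + 2 * y ^ 2 + z ^ 2) * (w₁ ^ 2 + w₂ ^ 2) ^ 2 := by
  have e : (x ^ 2 + 2 * y ^ 2 + z ^ 2) * (w₁ ^ 2 + w₂ ^ 2) ^ 2 -
      (x * w₁ ^ 2 + 2 * y * w₁ * w₂ + z * w₂ ^ 2) ^ 2 =
      2 * (x * w₁ * w₂ - y * w₁ ^ 2) ^ 2 + (x * w₂ ^ 2 - z * w₁ ^ 2) ^ 2 +
        2 * (y * w₂ ^ 2 - z * w₁ * w₂) ^ 2 := by ring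
  nlinarith [sq_nonneg (x * w₁ * w₂ - y * w₁ ^ 2), sq_nonneg (x * w₂ ^ 2 - z * w₁ ^ 2),
    sq_nonneg (y * w₂ ^ 2 - z * w₁ * w₂)]

/-- If `x² ≤ A * B` then `2 * |x|` is bounded by `A + B`, in the form of a lower bound. -/
theorem neg_add_le_of_sq_le {x A B : ℝ} (hA : 0 ≤ A) (hB : 0 ≤ B) (h : x ^ 2 ≤ A * B) :
    -(A + B) ≤ 2 * x := by
  have : |2 * x| ≤ |A + B| := by
    apply sq_le_sq.1
    nlinarith [sq_nonneg (A - B)]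
  rw [abs_of_nonneg (add_nonneg hA hB)] at this
  exact (abs_le.1 this).1

theorem lap_Phi_lower (β a b c e w₁ w₂ h₁₁ h₁₂ h₂₂ : ℝ) :
    (h₁₁ ^ 2 + 2 * h₁₂ ^ 2 + h₂₂ ^ 2) / 2 - 8 * (β + 2) ^ 2 * (w₁ ^ 2 + w₂ ^ 2) ^ 2 +
      (β + 3) * (2 * (w₁ * (a * w₁ ^ 2 + 2 * b * w₁ * w₂ + c * w₂ ^ 2) +
          w₂ * (b * w₁ ^ 2 + 2 * c * w₁ * w₂ + e * w₂ ^ 2))) ≤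
      2 * (h₁₁ ^ 2 + 2 * h₁₂ ^ 2 + h₂₂ ^ 2) -
        2 * ((a * w₁ + b * w₂) * h₁₁ + 2 * (b * w₁ + c * w₂) * h₁₂ +
        (c * w₁ + e * w₂) * h₂₂) + ((a * w₁ + b * w₂) ^ 2 + 2 * (b * w₁ + c * w₂) ^ 2 +
        (c * w₁ + e * w₂) ^ 2) - 4 * (β + 2) * (h₁₁ * w₁ ^ 2 + 2 * h₁₂ * w₁ * w₂ + h₂₂ * w₂ ^ 2) +
        2 * (β + 3) * (w₁ * (a * w₁ ^ 2 + 2 * b * w₁ * w₂ + c * w₂ ^ 2) +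
          w₂ * (b * w₁ ^ 2 + 2 * c * w₁ * w₂ + e * w₂ ^ 2)) := by
  have s1 : 0 ≤ (h₁₁ - (a * w₁ + b * w₂)) ^ 2 + 2 * (h₁₂ - (b * w₁ + c * w₂)) ^ 2 +
    (h₂₂ - (c * w₁ + e * w₂)) ^ 2 := by positivity
  have s2 : 0 ≤ (h₁₁ / 2 - 2 * (β + 2) * w₁ ^ 2) ^ 2 +
    2 * (h₁₂ / 2 - 2 * (β + 2) * (w₁ * w₂)) ^ 2 + (h₂₂ / 2 - 2 * (β + 2) * w₂ ^ 2) ^ 2 := by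
    positivity
  linarith

set_option maxHeartbeats 2000000 in
/-- Estimate for the exponent `K * Φ * σ`, where `σ = (ρ * (d + u)) ^ (-α)`. -/
theorem tau_one_estimate {β α δ K σ i a b c e w₁ w₂ h₁₁ h₁₂ h₂₂ z₁ z₂ Φ Q A Z Φ₁ Φ₂ LΦ Lv : ℝ}
    (hβ : 0 < β) (hα : 0 < α) (hK : 0 ≤ K) (hσ : 0 < σ) (hi : 0 ≤ i)
    (hΦ : Φ = w₁ ^ 2 + w₂ ^ 2) (hQ : Q = h₁₁ ^ 2 + 2 * h₁₂ ^ 2 + h₂₂ ^ 2)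
    (hA : A = a ^ 2 + 3 * b ^ 2 + 3 * c ^ 2 + e ^ 2) (hZ : Z = z₁ ^ 2 + z₂ ^ 2)
    (hδ : Φ * σ ≤ δ)
    (hΦ₁ : Φ₁ = 2 * (w₁ * h₁₁ + w₂ * h₁₂) - (a * w₁ ^ 2 + 2 * b * w₁ * w₂ + c * w₂ ^ 2))
    (hΦ₂ : Φ₂ = 2 * (w₁ * h₁₂ + w₂ * h₂₂) - (b * w₁ ^ 2 + 2 * c * w₁ * w₂ + e * w₂ ^ 2))
    (hLΦ : LΦ = 2 * Q - 2 * ((a * w₁ + b * w₂) * h₁₁ + 2 * (b * w₁ + c * w₂) * h₁₂ +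
        (c * w₁ + e * w₂) * h₂₂) + ((a * w₁ + b * w₂) ^ 2 + 2 * (b * w₁ + c * w₂) ^ 2 +
        (c * w₁ + e * w₂) ^ 2) - 4 * (β + 2) * (h₁₁ * w₁ ^ 2 + 2 * h₁₂ * w₁ * w₂ + h₂₂ * w₂ ^ 2) +
        2 * (β + 3) * (w₁ * (a * w₁ ^ 2 + 2 * b * w₁ * w₂ + c * w₂ ^ 2) +
          w₂ * (b * w₁ ^ 2 + 2 * c * w₁ * w₂ + e * w₂ ^ 2)))
    (hLv : Lv = 2 * i - 4 * (z₁ * w₁ + z₂ * w₂)) :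
    K * (3 / 8 * (σ * Q) - δ * (β + 3 + α) * A - (64 * α ^ 2 * δ + 2 * α * δ) * Z -
        (8 * (β + 2) ^ 2 * δ + (β + 3) * δ + 64 * α ^ 2 * δ + 6 * α * δ) * Φ - 2 * α * δ * i) ≤
      K * (LΦ * σ + 2 * (Φ₁ * (-(α * σ * (w₁ + z₁))) + Φ₂ * (-(α * σ * (w₂ + z₂)))) +
        Φ * (σ * (α ^ 2 * ((w₁ + z₁) ^ 2 + (w₂ + z₂) ^ 2) -
          α * (-(β + 3) * Φ + Lv - Z)))) := by
  refine mul_le_mul_of_nonneg_left ?_ hK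
  have Φ0 : 0 ≤ Φ := by rw [hΦ]; positivity
  have Q0 : 0 ≤ Q := by rw [hQ]; positivity
  have A0 : 0 ≤ A := by rw [hA]; positivity
  have Z0 : 0 ≤ Z := by rw [hZ]; positivity
  have hδ0 : 0 ≤ δ := le_trans (by positivity) hδ
  set q₁ := a * w₁ ^ 2 + 2 * b * w₁ * w₂ + c * w₂ ^ 2 with hq₁
  set q₂ := b * w₁ ^ 2 + 2 * c * w₁ * w₂ + e * w₂ ^ 2 with hq₂
  set r₁ := w₁ * h₁₁ + w₂ * h₁₂ with hr₁
  set r₂ := w₁ * h₁₂ + w₂ * h₂₂ with hr₂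
  set l := (w₁ + z₁) ^ 2 + (w₂ + z₂) ^ 2 with hl
  have l0 : 0 ≤ l := by rw [hl]; positivity
  have l2 : l ≤ 2 * (Φ + Z) := by
    rw [hl, hΦ, hZ]; nlinarith [sq_nonneg (w₁ - z₁), sq_nonneg (w₂ - z₂)]
  have hq : q₁ ^ 2 + q₂ ^ 2 ≤ A * Φ ^ 2 := by
    have := sq_quad_le a b c w₁ w₂
    have := sq_quad_le b c e w₁ w₂
    rw [hA, hΦ]; linarith
  have hr : r₁ ^ 2 + r₂ ^ 2 ≤ Q * Φ := by
    have := sq_add_mul_le h₁₁ h₁₂ w₁ w₂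
    have := sq_add_mul_le h₁₂ h₂₂ w₁ w₂
    rw [hQ, hΦ]; linarith
  have cubic : -(Φ * (A + Φ)) ≤ 2 * (w₁ * q₁ + w₂ * q₂) := by
    have := sq_add_mul_le q₁ q₂ w₁ w₂
    have h2 : (w₁ * q₁ + w₂ * q₂) ^ 2 ≤ (Φ * A) * (Φ * Φ) := by
      rw [← hΦ] at this
      linarith [mul_le_mul_of_nonneg_left hq Φ0]
    linarith [neg_add_le_of_sq_le (by positivity) (by positivity) h2]
  have hLΦ' : Q / 2 - 8 * (β + 2) ^ 2 * Φ ^ 2 - (β + 3) * (Φ * (A + Φ)) ≤ LΦ := by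
    have s1 := lap_Phi_lower β a b c e w₁ w₂ h₁₁ h₁₂ h₂₂
    rw [← hQ, ← hΦ, ← hq₁, ← hq₂, ← hLΦ] at s1
    have s3 := mul_le_mul_of_nonneg_left cubic (by linarith : 0 ≤ β + 3)
    linarith
  have t1 : -(Q / 8 + 32 * α ^ 2 * (Φ * l)) ≤ -(4 * α * (r₁ * (w₁ + z₁) + r₂ * (w₂ + z₂))) := by
    have := sq_add_mul_le (w₁ + z₁) (w₂ + z₂) r₁ r₂
    have h2 : (-(2 * α * (r₁ * (w₁ + z₁) + r₂ * (w₂ + z₂)))) ^ 2 ≤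
        (Q / 8) * (32 * α ^ 2 * (Φ * l)) := by
      have h3 : (r₁ * (w₁ + z₁) + r₂ * (w₂ + z₂)) ^ 2 ≤ Q * Φ * l :=
        this.trans (mul_le_mul_of_nonneg_right hr l0)
      linarith [mul_le_mul_of_nonneg_left h3 (sq_nonneg α)]
    linarith [neg_add_le_of_sq_le (by positivity) (by positivity) h2]
  have t2 : -(Φ * (A + l)) ≤ 2 * (q₁ * (w₁ + z₁) + q₂ * (w₂ + z₂)) := by
    have := sq_add_mul_le (w₁ + z₁) (w₂ + z₂) q₁ q₂
    have h2 : (q₁ * (w₁ + z₁) + q₂ * (w₂ + z₂)) ^ 2 ≤ (Φ * A) * (Φ * l) := by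
      have h3 : (q₁ * (w₁ + z₁) + q₂ * (w₂ + z₂)) ^ 2 ≤ A * Φ ^ 2 * l :=
        this.trans (mul_le_mul_of_nonneg_right hq l0)
      linarith
    linarith [neg_add_le_of_sq_le (by positivity) (by positivity) h2]
  have t3 : -(Z + 4 * Φ) ≤ 4 * (z₁ * w₁ + z₂ * w₂) := by
    rw [hZ, hΦ]; nlinarith [sq_nonneg (z₁ + 2 * w₁), sq_nonneg (z₂ + 2 * w₂)]
  have T0 := mul_le_mul_of_nonneg_left hLΦ' hσ.le
  have T1 := mul_le_mul_of_nonneg_left t1 hσ.le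
  have T2 := mul_le_mul_of_nonneg_left t2 (mul_nonneg hα.le hσ.le)
  have T3 := mul_le_mul_of_nonneg_left t3 (mul_nonneg (mul_nonneg hα.le hσ.le) Φ0)
  have D : ∀ X, 0 ≤ X → Φ * σ * X ≤ δ * X := fun X hX => mul_le_mul_of_nonneg_right hδ hX
  have D1 := D ((8 * (β + 2) ^ 2 + (β + 3) + 4 * α) * Φ) (by positivity)
  have D2 := D ((β + 3 + α) * A) (by positivity)
  have D3 := D ((32 * α ^ 2 + α) * l) (by positivity)
  have D4 := D (2 * α * i) (by positivity)
  have L2 := mul_le_mul_of_nonneg_left l2 (by positivity : 0 ≤ (32 * α ^ 2 + α) * δ)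
  have N1 : 0 ≤ Φ * σ * (α ^ 2 * l) := by positivity
  have N2 : 0 ≤ Φ * σ * (α * (β + 3) * Φ) := by positivity
  rw [hΦ₁, hΦ₂, hLv]
  linarith

set_option maxHeartbeats 2000000 in
/-- Estimate for the gradient of the exponent `K * Φ * σ`. -/
theorem tau_one_grad {α δ K σ a b c e w₁ w₂ h₁₁ h₁₂ h₂₂ z₁ z₂ Φ Q A Z Φ₁ Φ₂ : ℝ}
    (hσ : 0 < σ)
    (hΦ : Φ = w₁ ^ 2 + w₂ ^ 2) (hQ : Q = h₁₁ ^ 2 + 2 * h₁₂ ^ 2 + h₂₂ ^ 2)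
    (hA : A = a ^ 2 + 3 * b ^ 2 + 3 * c ^ 2 + e ^ 2) (hZ : Z = z₁ ^ 2 + z₂ ^ 2)
    (hδ : Φ * σ ≤ δ)
    (hΦ₁ : Φ₁ = 2 * (w₁ * h₁₁ + w₂ * h₁₂) - (a * w₁ ^ 2 + 2 * b * w₁ * w₂ + c * w₂ ^ 2))
    (hΦ₂ : Φ₂ = 2 * (w₁ * h₁₂ + w₂ * h₂₂) - (b * w₁ ^ 2 + 2 * c * w₁ * w₂ + e * w₂ ^ 2)) :
    (K * (Φ₁ * σ + Φ * (-(α * σ * (w₁ + z₁))))) ^ 2 +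
      (K * (Φ₂ * σ + Φ * (-(α * σ * (w₂ + z₂))))) ^ 2 ≤
      K ^ 2 * (16 * δ * (σ * Q) + 4 * δ ^ 2 * A + 4 * α ^ 2 * δ ^ 2 * (Φ + Z)) := by
  have Φ0 : 0 ≤ Φ := by rw [hΦ]; positivity
  have Q0 : 0 ≤ Q := by rw [hQ]; positivity
  have A0 : 0 ≤ A := by rw [hA]; positivity
  have hδ0 : 0 ≤ δ := le_trans (by positivity) hδ
  set q₁ := a * w₁ ^ 2 + 2 * b * w₁ * w₂ + c * w₂ ^ 2 with hq₁
  set q₂ := b * w₁ ^ 2 + 2 * c * w₁ * w₂ + e * w₂ ^ 2 with hq₂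
  set r₁ := w₁ * h₁₁ + w₂ * h₁₂ with hr₁
  set r₂ := w₁ * h₁₂ + w₂ * h₂₂ with hr₂
  have l2 : (w₁ + z₁) ^ 2 + (w₂ + z₂) ^ 2 ≤ 2 * (Φ + Z) := by
    rw [hΦ, hZ]; nlinarith [sq_nonneg (w₁ - z₁), sq_nonneg (w₂ - z₂)]
  have hq : q₁ ^ 2 + q₂ ^ 2 ≤ A * Φ ^ 2 := by
    have := sq_quad_le a b c w₁ w₂
    have := sq_quad_le b c e w₁ w₂
    rw [hA, hΦ]; linarith
  have hr : r₁ ^ 2 + r₂ ^ 2 ≤ Q * Φ := by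
    have := sq_add_mul_le h₁₁ h₁₂ w₁ w₂
    have := sq_add_mul_le h₁₂ h₂₂ w₁ w₂
    rw [hQ, hΦ]; linarith
  have hgrad : Φ₁ ^ 2 + Φ₂ ^ 2 ≤ 8 * (Q * Φ) + 2 * (A * Φ ^ 2) := by
    rw [hΦ₁, hΦ₂]
    linarith [sq_nonneg (2 * r₁ + q₁), sq_nonneg (2 * r₂ + q₂)]
  have g1 : ∀ x y : ℝ, (K * (x * σ + Φ * (-(α * σ * y)))) ^ 2 ≤
      K ^ 2 * (2 * (σ ^ 2 * x ^ 2) + 2 * (α ^ 2 * (Φ * σ) ^ 2 * y ^ 2)) := by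
    intro x y
    have : 0 ≤ K ^ 2 * (x * σ + Φ * (α * σ * y)) ^ 2 := by positivity
    linarith
  have hs2 : (Φ * σ) ^ 2 ≤ δ ^ 2 := pow_le_pow_left₀ (by positivity) hδ 2
  have e1 : σ ^ 2 * (Φ₁ ^ 2 + Φ₂ ^ 2) ≤ 8 * (δ * (σ * Q)) + 2 * (δ ^ 2 * A) := by
    have a1 := mul_le_mul_of_nonneg_left hgrad (sq_nonneg σ)
    have a2 := mul_le_mul_of_nonneg_right hδ (by positivity : 0 ≤ σ * Q)
    have a3 := mul_le_mul_of_nonneg_right hs2 A0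
    linarith
  have e2 : α ^ 2 * (Φ * σ) ^ 2 * ((w₁ + z₁) ^ 2 + (w₂ + z₂) ^ 2) ≤
      α ^ 2 * δ ^ 2 * (2 * (Φ + Z)) := by
    apply mul_le_mul _ l2 (by positivity) (by positivity)
    exact mul_le_mul_of_nonneg_left hs2 (sq_nonneg α)
  have e3 := mul_le_mul_of_nonneg_left (add_le_add e1 e2) (sq_nonneg K)
  have := g1 Φ₁ (w₁ + z₁)
  have := g1 Φ₂ (w₂ + z₂)
  linarith

/-- Estimate for the exponent `M * N / v ^ 2` with `N` the squared Euclidean length of the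
gradient of `f`; here `i = 1 / v`. -/
theorem tau_two_estimate {M B i T N l₁ l₂ g₁ g₂ w₁ w₂ z₁ z₂ Φ Z Lv : ℝ}
    (hM : 0 ≤ M) (hi : 0 ≤ i) (hl₁ : 0 < l₁) (hl₂ : 0 < l₂) (hT : T = l₁ + l₂)
    (hN : N = l₁ * g₁ ^ 2 + l₂ * g₂ ^ 2) (hΦ : Φ = w₁ ^ 2 + w₂ ^ 2) (hZ : Z = z₁ ^ 2 + z₂ ^ 2)
    (hB : N * i ^ 2 ≤ B) (hLv : Lv = 2 * i - 4 * (z₁ * w₁ + z₂ * w₂)) :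
    M * (T * i ^ 2 - 36 * B * Z - 36 * B * Φ - 4 * B * i) ≤
      M * ((2 * T - 8 * (l₁ * g₁ * w₁ + l₂ * g₂ * w₂)) * i ^ 2 +
        2 * (2 * l₁ * g₁ * (-2 * i ^ 2 * z₁) + 2 * l₂ * g₂ * (-2 * i ^ 2 * z₂)) +
        N * (6 * i ^ 2 * Z - 2 * i ^ 2 * Lv)) := by
  refine mul_le_mul_of_nonneg_left ?_ hM
  have Φ0 : 0 ≤ Φ := by rw [hΦ]; positivity
  have Z0 : 0 ≤ Z := by rw [hZ]; positivity
  have T0 : 0 ≤ T := by rw [hT]; positivity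
  have N0 : 0 ≤ N := by rw [hN]; positivity
  have hB0 : 0 ≤ B := le_trans (by positivity) hB
  have cs : ∀ x y : ℝ, (l₁ * g₁ * x + l₂ * g₂ * y) ^ 2 ≤ T * N * (x ^ 2 + y ^ 2) := by
    intro x y
    have a1 := sq_add_mul_le x y (l₁ * g₁) (l₂ * g₂)
    have a2 : (l₁ * g₁) ^ 2 + (l₂ * g₂) ^ 2 ≤ T * N := by
      have p1 : 0 ≤ l₁ * l₂ * g₂ ^ 2 := by positivity
      have p2 : 0 ≤ l₁ * l₂ * g₁ ^ 2 := by positivity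
      rw [hT, hN]; nlinarith
    exact a1.trans (mul_le_mul_of_nonneg_right a2 (by positivity))
  have t1 : -(T / 2 + 32 * (N * Φ)) ≤ -8 * (l₁ * g₁ * w₁ + l₂ * g₂ * w₂) := by
    have h2 : (-4 * (l₁ * g₁ * w₁ + l₂ * g₂ * w₂)) ^ 2 ≤ (T / 2) * (32 * (N * Φ)) := by
      have := cs w₁ w₂
      rw [← hΦ] at this
      linarith
    linarith [neg_add_le_of_sq_le (by positivity) (by positivity) h2]
  have t2 : -(T / 2 + 32 * (N * Z)) ≤ -8 * (l₁ * g₁ * z₁ + l₂ * g₂ * z₂) := by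
    have h2 : (-4 * (l₁ * g₁ * z₁ + l₂ * g₂ * z₂)) ^ 2 ≤ (T / 2) * (32 * (N * Z)) := by
      have := cs z₁ z₂
      rw [← hZ] at this
      linarith
    linarith [neg_add_le_of_sq_le (by positivity) (by positivity) h2]
  have t3 : -(4 * (Z + Φ)) ≤ 8 * (z₁ * w₁ + z₂ * w₂) := by
    rw [hZ, hΦ]; nlinarith [sq_nonneg (z₁ + w₁), sq_nonneg (z₂ + w₂)]
  have i2 : 0 ≤ i ^ 2 := sq_nonneg i
  have T1 := mul_le_mul_of_nonneg_left t1 i2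
  have T2 := mul_le_mul_of_nonneg_left t2 i2
  have T3 := mul_le_mul_of_nonneg_left t3 (mul_nonneg N0 i2)
  have D : ∀ X, 0 ≤ X → N * i ^ 2 * X ≤ B * X := fun X hX => mul_le_mul_of_nonneg_right hB hX
  have D1 := D (36 * Z + 36 * Φ + 4 * i) (by positivity)
  have N1 : 0 ≤ N * i ^ 2 * Z := by positivity
  rw [hLv]
  linarith

/-- Estimate for the gradient of the exponent `M * N / v ^ 2`. -/
theorem tau_two_grad {M B i T N l₁ l₂ g₁ g₂ z₁ z₂ Z : ℝ}
    (hl₁ : 0 < l₁) (hl₂ : 0 < l₂) (hT : T = l₁ + l₂)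
    (hN : N = l₁ * g₁ ^ 2 + l₂ * g₂ ^ 2) (hZ : Z = z₁ ^ 2 + z₂ ^ 2) (hB : N * i ^ 2 ≤ B) :
    (M * (2 * l₁ * g₁ * i ^ 2 + N * (-2 * i ^ 2 * z₁))) ^ 2 +
      (M * (2 * l₂ * g₂ * i ^ 2 + N * (-2 * i ^ 2 * z₂))) ^ 2 ≤
      M ^ 2 * (8 * B * (T * i ^ 2) + 8 * B ^ 2 * Z) := by
  have T0 : 0 ≤ T := by rw [hT]; positivity
  have N0 : 0 ≤ N := by rw [hN]; positivity
  have Z0 : 0 ≤ Z := by rw [hZ]; positivity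
  have a2 : (l₁ * g₁) ^ 2 + (l₂ * g₂) ^ 2 ≤ T * N := by
    have p1 : 0 ≤ l₁ * l₂ * g₂ ^ 2 := by positivity
    have p2 : 0 ≤ l₁ * l₂ * g₁ ^ 2 := by positivity
    rw [hT, hN]; nlinarith
  have g1 : ∀ x z : ℝ, (M * (2 * x * i ^ 2 + N * (-2 * i ^ 2 * z))) ^ 2 ≤
      M ^ 2 * (8 * (i ^ 2 * i ^ 2 * x ^ 2) + 8 * ((N * i ^ 2) ^ 2 * z ^ 2)) := by
    intro x z
    have : 0 ≤ M ^ 2 * (2 * x * i ^ 2 + N * (2 * i ^ 2 * z)) ^ 2 := by positivity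
    nlinarith
  have b1 : i ^ 2 * i ^ 2 * ((l₁ * g₁) ^ 2 + (l₂ * g₂) ^ 2) ≤ B * (T * i ^ 2) := by
    have := mul_le_mul_of_nonneg_left a2 (by positivity : 0 ≤ i ^ 2 * i ^ 2)
    have := mul_le_mul_of_nonneg_right hB (by positivity : 0 ≤ T * i ^ 2)
    linarith
  have b2 : (N * i ^ 2) ^ 2 * Z ≤ B ^ 2 * Z :=
    mul_le_mul_of_nonneg_right (pow_le_pow_left₀ (by positivity) hB 2) Z0
  have e3 := mul_le_mul_of_nonneg_left (add_le_add b1 b2) (sq_nonneg M)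
  have := g1 (l₁ * g₁) z₁
  have := g1 (l₂ * g₂) z₂
  rw [hZ] at e3 ⊢
  linarith

end Algebra

theorem half_sq_sub_le (x₁ x₂ w p q : ℝ) :
    (x₁ + x₂) ^ 2 / 2 - 3 * (w ^ 2 + p ^ 2 + q ^ 2) ≤ (x₁ + x₂ + w - p - q) ^ 2 := by
  linarith [sq_nonneg (x₁ + x₂ + 2 * (w - p - q)), sq_nonneg (w + p), sq_nonneg (w + q),
    sq_nonneg (p - q)]

/-- Lower bound for the squared gradient of the logarithm of the trace at a critical point. -/
theorem grad_log_trace_lower {α d i k w₁ w₂ z₁ z₂ g₁ g₂ p₁ p₂ q₁ q₂ E₁ E₂ Φ G t₁ t₂ : ℝ}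
    (hα : 0 < α) (hk : 0 ≤ k) (hΦ : Φ = w₁ ^ 2 + w₂ ^ 2) (hG : G = g₁ ^ 2 + g₂ ^ 2)
    (hp : p₁ ^ 2 + p₂ ^ 2 ≤ E₁) (hq : q₁ ^ 2 + q₂ ^ 2 ≤ E₂)
    (hzg : -(d * i) ≤ z₁ * g₁ + z₂ * g₂)
    (h₁ : t₁ = k * g₁ + (α + 2) * z₁ + α * w₁ - p₁ - q₁)
    (h₂ : t₂ = k * g₂ + (α + 2) * z₂ + α * w₂ - p₂ - q₂) :
    k ^ 2 * G / 4 - k * ((α + 2) * (d * i)) / 2 - 3 / 2 * (α ^ 2 * Φ + E₁ + E₂) ≤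
      (t₁ ^ 2 + t₂ ^ 2) / 2 := by
  have a1 := half_sq_sub_le (k * g₁) ((α + 2) * z₁) (α * w₁) p₁ q₁
  have a2 := half_sq_sub_le (k * g₂) ((α + 2) * z₂) (α * w₂) p₂ q₂
  rw [← h₁] at a1
  rw [← h₂] at a2
  have a3 := mul_le_mul_of_nonneg_left hzg (by positivity : 0 ≤ k * (α + 2))
  have a4 : 0 ≤ ((α + 2) * z₁) ^ 2 + ((α + 2) * z₂) ^ 2 := by positivity
  rw [hΦ, hG]
  linarith

/-- Lower bound for the Laplacian of the logarithm of the trace. -/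
theorem lap_log_trace_lower {κ T l₁ l₂ a b c e w₁ w₂ h₁₁ h₁₂ h₂₂ Φ Q A : ℝ} (hκ : 0 < κ)
    (hl₁ : 0 < l₁) (hl₂ : 0 < l₂) (hT : T = l₁ + l₂) (hac : a + c = -4 * w₁)
    (hbe : b + e = -4 * w₂) (hΦ : Φ = w₁ ^ 2 + w₂ ^ 2)
    (hQ : Q = h₁₁ ^ 2 + 2 * h₁₂ ^ 2 + h₂₂ ^ 2)
    (hA : A = a ^ 2 + 3 * b ^ 2 + 3 * c ^ 2 + e ^ 2) :
    A / 16 - 500 * Φ + (((l₁ * a + l₂ * c) / T) ^ 2 + ((l₁ * b + l₂ * e) / T) ^ 2) / 2 -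
        (κ * Q / 8 + 32 / κ) ≤
      (l₁ * (-4 * h₁₁ + a ^ 2 + 2 * b ^ 2 + c ^ 2) +
          l₂ * (-4 * h₂₂ + b ^ 2 + 2 * c ^ 2 + e ^ 2)) / T -
        (((l₁ * a + l₂ * c) / T) ^ 2 + ((l₁ * b + l₂ * e) / T) ^ 2) := by
  have T0 : 0 < T := by rw [hT]; positivity
  obtain ⟨m₁, hm₁⟩ : ∃ m, m = l₁ / T := ⟨_, rfl⟩
  obtain ⟨m₂, hm₂⟩ : ∃ m, m = l₂ / T := ⟨_, rfl⟩
  have hm : m₁ + m₂ = 1 := by rw [hm₁, hm₂, ← add_div, ← hT, div_self T0.ne']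
  have n₁ : 0 ≤ m₁ := by rw [hm₁]; positivity
  have n₂ : 0 ≤ m₂ := by rw [hm₂]; positivity
  have e1 : (l₁ * a + l₂ * c) / T = m₁ * a + m₂ * c := by rw [hm₁, hm₂]; ring
  have e2 : (l₁ * b + l₂ * e) / T = m₁ * b + m₂ * e := by rw [hm₁, hm₂]; ring
  have e3 : (l₁ * (-4 * h₁₁ + a ^ 2 + 2 * b ^ 2 + c ^ 2) +
          l₂ * (-4 * h₂₂ + b ^ 2 + 2 * c ^ 2 + e ^ 2)) / T =
      m₁ * (-4 * h₁₁ + a ^ 2 + 2 * b ^ 2 + c ^ 2) +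
          m₂ * (-4 * h₂₂ + b ^ 2 + 2 * c ^ 2 + e ^ 2) := by rw [hm₁, hm₂]; ring
  rw [e1, e2, e3, hA, hΦ]
  have k1 := third_order_gain n₁ n₂ hm hac hbe
  have Q0 : 0 ≤ Q := by rw [hQ]; positivity
  have k2 : (-2 * (m₁ * h₁₁ + m₂ * h₂₂)) ^ 2 ≤ (κ * Q / 8) * (32 / κ) := by
    have : (κ * Q / 8) * (32 / κ) = 4 * Q := by field_simp; ring
    rw [this, hQ]
    have c1 := sq_add_mul_le h₁₁ h₂₂ m₁ m₂
    have c2 : m₁ ^ 2 + m₂ ^ 2 ≤ 1 := by nlinarith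
    have c3 := mul_le_mul_of_nonneg_right c2 (by positivity : 0 ≤ h₁₁ ^ 2 + h₂₂ ^ 2)
    linarith [sq_nonneg h₁₂]
  have k3 := neg_add_le_of_sq_le (by positivity) (by positivity) k2
  linarith

set_option maxHeartbeats 1000000 in
/-- Combination of the estimates at a maximum point. -/
theorem combine_estimates {α β s d i k m g₀ K M B δ σ T A Q Z Φ G R₁ R₂ S H E₁ E₂ Lv : ℝ}
    (hβ : 0 < β) (hα : 1 < α) (hs : s = α + β + 3) (hδ : 0 < δ) (hσ : 0 < σ) (hi : 0 < i)
    (hB : 0 < B) (hK : K = 1 / (1000 * δ * s ^ 2)) (hM : M = 1 / (100 * B))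
    (hg₀ : 0 < g₀) (hk : k = m * g₀ ^ 2) (hm : 0 < m) (hmg : 32 ≤ m * g₀)
    (hT : 0 ≤ T) (hA : 0 ≤ A) (hQ : 0 ≤ Q) (hZ : 0 ≤ Z) (hΦ : 0 ≤ Φ) (hG : 0 ≤ G)
    (hR₁ : K * (3 / 8 * (σ * Q) - δ * (β + 3 + α) * A - (64 * α ^ 2 * δ + 2 * α * δ) * Z -
        (8 * (β + 2) ^ 2 * δ + (β + 3) * δ + 64 * α ^ 2 * δ + 6 * α * δ) * Φ -
          2 * α * δ * i) ≤ R₁)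
    (hR₂ : M * (T * i ^ 2 - 36 * B * Z - 36 * B * Φ - 4 * B * i) ≤ R₂)
    (hS : A / 16 - 500 * Φ + H - (K * σ * Q / 8 + 32 / (K * σ)) ≤ S)
    (hH : k ^ 2 * G / 4 - k * ((α + 2) * (d * i)) / 2 - 3 / 2 * (α ^ 2 * Φ + E₁ + E₂) ≤ H)
    (hE₁ : E₁ = K ^ 2 * (16 * δ * (σ * Q) + 4 * δ ^ 2 * A + 4 * α ^ 2 * δ ^ 2 * (Φ + Z)))
    (hE₂ : E₂ = M ^ 2 * (8 * B * (T * i ^ 2) + 8 * B ^ 2 * Z))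
    (hLv : Lv ≤ 2 * i + Z / 2 + 8 * Φ)
    (hmax : -(m * (2 * g₀ ^ 2 + 2 * g₀ ^ 3 * G)) + R₁ + R₂ + S + α * (β + 3) * Φ -
      (α + 2) * (Lv - Z) ≤ 0) :
    M / 2 * (T * i ^ 2) ≤
      2 * k + k * ((α + 2) * (d * i)) / 2 + 32 / (K * σ) + 600 * s ^ 2 * Φ + 2 * s * i := by
  have s0 : 4 < s := by linarith
  have K0 : 0 < K := by rw [hK]; positivity
  have M0 : 0 < M := by rw [hM]; positivity
  have MB : M * B = 1 / 100 := by rw [hM]; field_simp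
  obtain ⟨q, hq⟩ : ∃ q, q = K * δ := ⟨_, rfl⟩
  have q0 : 0 < q := by rw [hq]; positivity
  have qs : q * s ^ 2 = 1 / 1000 := by rw [hq, hK]; field_simp
  have ss : s ≤ s ^ 2 := le_self_pow₀ (by linarith) two_ne_zero
  have qx : ∀ x, x ≤ s ^ 2 → q * x ≤ 1 / 1000 := fun x hx =>
    (mul_le_mul_of_nonneg_left hx q0.le).trans qs.le
  have qα : q * α ^ 2 ≤ 1 / 1000 := qx _ (pow_le_pow_left₀ (by linarith) (by linarith) 2)
  have qα1 : q * α ≤ 1 / 1000 := qx _ (by linarith)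
  have qβ : q * (β + 2) ^ 2 ≤ 1 / 1000 := qx _ (pow_le_pow_left₀ (by linarith) (by linarith) 2)
  have qβ1 : q * (β + 3) ≤ 1 / 1000 := qx _ (by linarith)
  have qq : q ≤ 1 / 1000 := by linarith [qx 1 (by linarith)]
  have qq2 : q ^ 2 ≤ 1 / 1000 := by
    linarith [pow_le_pow_left₀ q0.le qq 2]
  have q2α : q ^ 2 * α ^ 2 ≤ 1 / 1000 := by
    have := mul_le_mul qq qα (by positivity) (by norm_num)
    linarith
  have r1 : K * q * (σ * Q) ≤ K / 1000 * (σ * Q) := by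
    have : K * q ≤ K / 1000 := by linarith [mul_le_mul_of_nonneg_left qq K0.le]
    exact mul_le_mul_of_nonneg_right this (by positivity)
  have r1' : 0 ≤ K * (σ * Q) := by positivity
  have r2 := mul_le_mul_of_nonneg_right (add_le_add qβ1 qα1) hA
  have r2' := mul_le_mul_of_nonneg_right qq2 hA
  have r3 := mul_le_mul_of_nonneg_right qα hZ
  have r3' := mul_le_mul_of_nonneg_right qα1 hZ
  have r3'' := mul_le_mul_of_nonneg_right q2α hZ
  have r4 := mul_le_mul_of_nonneg_right qβ hΦ
  have r5 := mul_le_mul_of_nonneg_right qβ1 hΦ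
  have r6 := mul_le_mul_of_nonneg_right qα hΦ
  have r7 := mul_le_mul_of_nonneg_right qα1 hΦ
  have r8 := mul_le_mul_of_nonneg_right q2α hΦ
  have r9 := mul_le_mul_of_nonneg_right qα1 hi.le
  have r10 : M ^ 2 * B = M / 100 := by
    rw [sq, mul_assoc, MB]; ring
  have r11 : M ^ 2 * B ^ 2 = 1 / 10000 := by
    rw [← mul_pow, MB]; norm_num
  have r12 : 2 * (m * g₀ ^ 3 * G) ≤ k ^ 2 * G / 4 := by
    have : k ^ 2 * G / 4 = (m * g₀) * (m * g₀ ^ 3 * G) / 4 := by rw [hk]; ring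
    rw [this]
    have X0 : 0 ≤ m * g₀ ^ 3 * G := by positivity
    have := mul_le_mul_of_nonneg_right hmg X0
    linarith
  have r13 := mul_le_mul_of_nonneg_left hLv (by linarith : 0 ≤ α + 2)
  have r14 : 0 ≤ α * (β + 3) * Φ := by positivity
  have r15 : 0 ≤ M * (T * i ^ 2) := by positivity
  have r16 : (502 + 3 / 2 * α ^ 2 + 8 * (α + 2)) * Φ ≤ 600 * s ^ 2 * Φ := by
    apply mul_le_mul_of_nonneg_right _ hΦ
    linarith [pow_le_pow_left₀ (by linarith) (by linarith : α ≤ s) 2]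
  have r17 : (2 * α + 4) * i + i ≤ 2 * s * i := by
    have := mul_le_mul_of_nonneg_right (by linarith : 2 * α + 5 ≤ 2 * s) hi.le
    linarith
  have r18 : 0 ≤ (α - 1) * Z := mul_nonneg (by linarith) hZ
  have E1 : E₁ = 16 * (K * q * (σ * Q)) + 4 * (q ^ 2 * A) + 4 * (q ^ 2 * α ^ 2 * Φ) +
      4 * (q ^ 2 * α ^ 2 * Z) := by rw [hE₁, hq]; ring
  have E2 : E₂ = 8 * (M / 100) * (T * i ^ 2) + 8 * (1 / 10000) * Z := by
    rw [hE₂, ← r10, ← r11]; ring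
  have R1 : 3 / 8 * (K * (σ * Q)) - (q * (β + 3) + q * α) * A -
      (64 * (q * α ^ 2 * Z) + 2 * (q * α * Z)) - (8 * (q * (β + 2) ^ 2 * Φ) + q * (β + 3) * Φ +
      64 * (q * α ^ 2 * Φ) + 6 * (q * α * Φ)) - 2 * (q * α * i) ≤ R₁ := by
    rw [hq]; linarith
  have R2 : M * (T * i ^ 2) - 36 * (1 / 100) * Z - 36 * (1 / 100) * Φ - 4 * (1 / 100) * i ≤ R₂ := by
    rw [← MB]; linarith
  clear hR₁ hR₂ hE₁ hE₂ hK hM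
  subst hk
  linarith

section Frame

variable {Ω : Set (Fin 2 → ℝ)} {f h : (Fin 2 → ℝ) → ℝ} {x : Fin 2 → ℝ} {e₁ e₂ : Fin 2 → ℝ}
  {l₁ l₂ β : ℝ}

theorem dirDeriv_eq_pd (e : Fin 2 → ℝ) (h : (Fin 2 → ℝ) → ℝ) (x : Fin 2 → ℝ) :
    dirDeriv e h x = e 0 * pd 0 h x + e 1 * pd 1 h x := by
  have : e = e 0 • (Pi.single 0 1 : Fin 2 → ℝ) + e 1 • (Pi.single 1 1 : Fin 2 → ℝ) := by
    ext i; fin_cases i <;> simp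
  conv_lhs => rw [this]
  exact dirDeriv_add_dir _ _ _ _

theorem dirDeriv_dirDeriv_eq (hΩ : IsOpen Ω) (hh : ContDiffOn ℝ (⊤ : ℕ∞) h Ω) (hx : x ∈ Ω)
    (e e' : Fin 2 → ℝ) :
    dirDeriv e (dirDeriv e' h) x = e 0 * e' 0 * pd 0 (pd 0 h) x +
      (e 0 * e' 1 + e 1 * e' 0) * pd 0 (pd 1 h) x + e 1 * e' 1 * pd 1 (pd 1 h) x := by
  have k : ∀ i, pd i (dirDeriv e' h) x = e' 0 * pd 0 (pd i h) x + e' 1 * pd 1 (pd i h) x := by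
    intro i
    rw [show pd i (dirDeriv e' h) x = dirDeriv e' (pd i h) x from dirDeriv_comm hΩ hh hx _ _,
      dirDeriv_eq_pd]
  rw [dirDeriv_eq_pd, k, k, pd_comm hΩ hh hx 1 0]
  ring

theorem dirDeriv_comm₃ (hΩ : IsOpen Ω) (hh : ContDiffOn ℝ (⊤ : ℕ∞) h Ω) (hx : x ∈ Ω)
    (e e' : Fin 2 → ℝ) : dirDeriv e (dirDeriv e' (dirDeriv e' h)) x =
      dirDeriv e' (dirDeriv e' (dirDeriv e h)) x := by
  rw [dirDeriv_comm hΩ (hh.dirDeriv hΩ _) hx]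
  exact dirDeriv_congr hΩ hx (fun y hy => dirDeriv_comm hΩ hh hy _ _) _

/-- A basis orthogonal for the Euclidean metric and orthonormal for the Calabi metric at `x`. -/
structure IsFrame (f : (Fin 2 → ℝ) → ℝ) (x e₁ e₂ : Fin 2 → ℝ) (l₁ l₂ : ℝ) : Prop where
  pos₁ : 0 < l₁
  pos₂ : 0 < l₂
  orth : e₁ 0 * e₂ 0 + e₁ 1 * e₂ 1 = 0
  norm₁ : l₁ * (e₁ 0 ^ 2 + e₁ 1 ^ 2) = 1
  norm₂ : l₂ * (e₂ 0 ^ 2 + e₂ 1 ^ 2) = 1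
  res₀ : l₁ * e₁ 0 ^ 2 + l₂ * e₂ 0 ^ 2 = 1
  res₁ : l₁ * e₁ 1 ^ 2 + l₂ * e₂ 1 ^ 2 = 1
  res₀₁ : l₁ * (e₁ 0 * e₁ 1) + l₂ * (e₂ 0 * e₂ 1) = 0
  unit₁ : dirDeriv e₁ (dirDeriv e₁ f) x = 1
  unit₂ : dirDeriv e₂ (dirDeriv e₂ f) x = 1
  orth' : dirDeriv e₁ (dirDeriv e₂ f) x = 0

theorem det_frame (hΩ : IsOpen Ω) (hf : ContDiffOn ℝ (⊤ : ℕ∞) f Ω)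
    (hp : ∀ x ∈ Ω, (hess f x).PosDef) (e₁ e₂ : Fin 2 → ℝ) (hx : x ∈ Ω) :
    dirDeriv e₁ (dirDeriv e₁ f) x * dirDeriv e₂ (dirDeriv e₂ f) x -
      dirDeriv e₁ (dirDeriv e₂ f) x ^ 2 =
        (e₁ 0 * e₂ 1 - e₁ 1 * e₂ 0) ^ 2 * Real.exp (-4 * logRho f x) := by
  rw [← det_hess_eq_exp (hp x hx), det_hess hΩ hf hx]
  simp only [dirDeriv_dirDeriv_eq hΩ hf hx]
  ring

/-- The cofactor quadratic form of the Hessian, evaluated in a frame. -/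
theorem cofForm_frame (hΩ : IsOpen Ω) (hf : ContDiffOn ℝ (⊤ : ℕ∞) f Ω)
    (e₁ e₂ : Fin 2 → ℝ) (hx : x ∈ Ω) (a b c : ℝ) :
    dirDeriv e₂ (dirDeriv e₂ f) x * (e₁ 0 * e₁ 0 * a + (e₁ 0 * e₁ 1 + e₁ 1 * e₁ 0) * b +
        e₁ 1 * e₁ 1 * c) -
      2 * dirDeriv e₁ (dirDeriv e₂ f) x * (e₁ 0 * e₂ 0 * a + (e₁ 0 * e₂ 1 + e₁ 1 * e₂ 0) * b +
        e₁ 1 * e₂ 1 * c) +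
      dirDeriv e₁ (dirDeriv e₁ f) x * (e₂ 0 * e₂ 0 * a + (e₂ 0 * e₂ 1 + e₂ 1 * e₂ 0) * b +
        e₂ 1 * e₂ 1 * c) = (e₁ 0 * e₂ 1 - e₁ 1 * e₂ 0) ^ 2 * cofForm f x a b c := by
  simp only [dirDeriv_dirDeriv_eq hΩ hf hx, cofForm]
  ring

/-- The cofactor quadratic form on the gradient of `logRho f`, in a frame. -/
noncomputable def gradForm (f : (Fin 2 → ℝ) → ℝ) (e₁ e₂ x : Fin 2 → ℝ) : ℝ :=
  dirDeriv e₂ (dirDeriv e₂ f) x * (dirDeriv e₁ (logRho f) x * dirDeriv e₁ (logRho f) x) -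
    2 * (dirDeriv e₁ (dirDeriv e₂ f) x *
      (dirDeriv e₁ (logRho f) x * dirDeriv e₂ (logRho f) x)) +
    dirDeriv e₁ (dirDeriv e₁ f) x * (dirDeriv e₂ (logRho f) x * dirDeriv e₂ (logRho f) x)

theorem gradForm_eq (hΩ : IsOpen Ω) (hf : ContDiffOn ℝ (⊤ : ℕ∞) f Ω)
    (e₁ e₂ : Fin 2 → ℝ) (hx : x ∈ Ω) :
    gradForm f e₁ e₂ x = (e₁ 0 * e₂ 1 - e₁ 1 * e₂ 0) ^ 2 * cofForm f x (pd 0 (logRho f) x ^ 2)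
      (pd 0 (logRho f) x * pd 1 (logRho f) x) (pd 1 (logRho f) x ^ 2) := by
  rw [← cofForm_frame hΩ hf e₁ e₂ hx, gradForm]
  simp only [dirDeriv_eq_pd _ (logRho f)]
  ring

theorem PDE2.frame_eq (hpde : PDE2 f β Ω) (hΩ : IsOpen Ω)
    (hf : ContDiffOn ℝ (⊤ : ℕ∞) f Ω) (hp : ∀ x ∈ Ω, (hess f x).PosDef)
    (e₁ e₂ : Fin 2 → ℝ) (hx : x ∈ Ω) :
    dirDeriv e₂ (dirDeriv e₂ f) x * dirDeriv e₁ (dirDeriv e₁ (logRho f)) x -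
      2 * (dirDeriv e₁ (dirDeriv e₂ f) x * dirDeriv e₁ (dirDeriv e₂ (logRho f)) x) +
      dirDeriv e₁ (dirDeriv e₁ f) x * dirDeriv e₂ (dirDeriv e₂ (logRho f)) x =
      -(β + 3) * gradForm f e₁ e₂ x := by
  have hl := contDiffOn_logRho hΩ hf hp
  rw [gradForm_eq hΩ hf e₁ e₂ hx, mul_left_comm (-(β + 3)), ← hpde.cofForm_eq hΩ hf hp hx,
    ← cofForm_frame hΩ hf e₁ e₂ hx]
  simp only [dirDeriv_dirDeriv_eq hΩ hl hx]
  ring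

theorem Phi_frame (hΩ : IsOpen Ω) (hf : ContDiffOn ℝ (⊤ : ℕ∞) f Ω)
    (hp : ∀ x ∈ Ω, (hess f x).PosDef) {e₁ e₂ : Fin 2 → ℝ}
    (hJ : (e₁ 0 * e₂ 1 - e₁ 1 * e₂ 0) ^ 2 ≠ 0) (hx : x ∈ Ω) :
    Phi f x = ((e₁ 0 * e₂ 1 - e₁ 1 * e₂ 0) ^ 2)⁻¹ * (gradForm f e₁ e₂ x *
      Real.exp (4 * logRho f x)) := by
  rw [Phi_eq hΩ hf hp hx, gradForm_eq hΩ hf e₁ e₂ hx, det_hess_eq_exp (hp x hx), ← Real.exp_neg]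
  generalize (e₁ 0 * e₂ 1 - e₁ 1 * e₂ 0) ^ 2 = J at hJ
  rw [mul_assoc J, inv_mul_cancel_left₀ hJ, mul_comm, neg_mul, neg_neg]

theorem trace_frame (hΩ : IsOpen Ω) (hf : ContDiffOn ℝ (⊤ : ℕ∞) f Ω) {z : Fin 2 → ℝ}
    (hF : IsFrame f z e₁ e₂ l₁ l₂) (hx : x ∈ Ω) :
    ∑ i, hess f x i i = l₁ * dirDeriv e₁ (dirDeriv e₁ f) x +
      l₂ * dirDeriv e₂ (dirDeriv e₂ f) x := by
  simp only [dirDeriv_dirDeriv_eq hΩ hf hx, Fin.sum_univ_two, hess, Matrix.of_apply]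
  linear_combination (-pd 0 (pd 0 f) x) * hF.res₀ - pd 1 (pd 1 f) x * hF.res₁ -
    2 * pd 0 (pd 1 f) x * hF.res₀₁

theorem gradSq_frame {z : Fin 2 → ℝ} (hF : IsFrame f z e₁ e₂ l₁ l₂) (x : Fin 2 → ℝ) :
    pd 0 f x ^ 2 + pd 1 f x ^ 2 = l₁ * dirDeriv e₁ f x ^ 2 + l₂ * dirDeriv e₂ f x ^ 2 := by
  simp only [dirDeriv_eq_pd]
  linear_combination (-pd 0 f x ^ 2) * hF.res₀ - pd 1 f x ^ 2 * hF.res₁ -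
    2 * pd 0 f x * pd 1 f x * hF.res₀₁

theorem radial_frame {z : Fin 2 → ℝ} (hF : IsFrame f z e₁ e₂ l₁ l₂) (x y : Fin 2 → ℝ) :
    y 0 * pd 0 f x + y 1 * pd 1 f x = l₁ * (e₁ 0 * y 0 + e₁ 1 * y 1) * dirDeriv e₁ f x +
      l₂ * (e₂ 0 * y 0 + e₂ 1 * y 1) * dirDeriv e₂ f x := by
  simp only [dirDeriv_eq_pd]
  linear_combination (-y 0 * pd 0 f x) * hF.res₀ - y 1 * pd 1 f x * hF.res₁ -
    (y 0 * pd 1 f x + y 1 * pd 0 f x) * hF.res₀₁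

theorem IsFrame.jacobian_ne (hF : IsFrame f x e₁ e₂ l₁ l₂) (hΩ : IsOpen Ω)
    (hf : ContDiffOn ℝ (⊤ : ℕ∞) f Ω) (hp : ∀ x ∈ Ω, (hess f x).PosDef) (hx : x ∈ Ω) :
    (e₁ 0 * e₂ 1 - e₁ 1 * e₂ 0) ^ 2 ≠ 0 := by
  have := det_frame hΩ hf hp e₁ e₂ hx
  rw [hF.unit₁, hF.unit₂, hF.orth'] at this
  intro h0
  rw [h0] at this
  norm_num at this

end Frame

theorem lap_Phi_algebra {β a b c e w₁ w₂ h₁₁ h₁₂ h₂₂ X₁ X₂ Y₁ Y₂ Z₁ Z₂ k₁ k₂ k₃ k₄ N₁ N₂ : ℝ}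
    (hac : a + c = -4 * w₁) (hbe : b + e = -4 * w₂)
    (hLh : h₁₁ + h₂₂ = -(β + 3) * (w₁ ^ 2 + w₂ ^ 2))
    (hX : X₁ + X₂ = -4 * h₁₁ + a ^ 2 + 2 * b ^ 2 + c ^ 2)
    (hZ : Z₁ + Z₂ = -4 * h₂₂ + b ^ 2 + 2 * c ^ 2 + e ^ 2)
    (hY : Y₁ + Y₂ = -4 * h₁₂ + a * b + 2 * b * c + c * e)
    (hN₁ : N₁ = c * w₁ ^ 2 + 2 * w₁ * h₁₁ - 2 * b * w₁ * w₂ + a * w₂ ^ 2 + 2 * w₂ * h₁₂)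
    (hN₂ : N₂ = e * w₁ ^ 2 + 2 * w₁ * h₁₂ - 2 * c * w₁ * w₂ + b * w₂ ^ 2 + 2 * w₂ * h₂₂)
    (hk₁ : c * h₁₁ + k₁ - 2 * b * h₁₂ + a * h₂₂ + k₂ = -(β + 3) * N₁)
    (hk₂ : e * h₁₁ + k₃ - 2 * c * h₁₂ + b * h₂₂ + k₄ = -(β + 3) * N₂) :
    (Z₁ * w₁ ^ 2 + 4 * c * w₁ * h₁₁ + 2 * h₁₁ ^ 2 + 2 * w₁ * k₁ - 2 * Y₁ * w₁ * w₂ -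
        4 * b * (h₁₁ * w₂ + w₁ * h₁₂) + X₁ * w₂ ^ 2 + 4 * a * w₂ * h₁₂ + 2 * h₁₂ ^ 2 +
        2 * w₂ * k₃) + 8 * w₁ * N₁ + (w₁ ^ 2 + w₂ ^ 2) * (4 * h₁₁ + 16 * w₁ ^ 2) +
      ((Z₂ * w₁ ^ 2 + 4 * e * w₁ * h₁₂ + 2 * h₁₂ ^ 2 + 2 * w₁ * k₂ - 2 * Y₂ * w₁ * w₂ -
        4 * c * (h₁₂ * w₂ + w₁ * h₂₂) + X₂ * w₂ ^ 2 + 4 * b * w₂ * h₂₂ + 2 * h₂₂ ^ 2 +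
        2 * w₂ * k₄) + 8 * w₂ * N₂ + (w₁ ^ 2 + w₂ ^ 2) * (4 * h₂₂ + 16 * w₂ ^ 2)) =
      2 * (h₁₁ ^ 2 + 2 * h₁₂ ^ 2 + h₂₂ ^ 2) -
        2 * ((a * w₁ + b * w₂) * h₁₁ + 2 * (b * w₁ + c * w₂) * h₁₂ +
        (c * w₁ + e * w₂) * h₂₂) + ((a * w₁ + b * w₂) ^ 2 + 2 * (b * w₁ + c * w₂) ^ 2 +
        (c * w₁ + e * w₂) ^ 2) -
        4 * (β + 2) * (h₁₁ * w₁ ^ 2 + 2 * h₁₂ * w₁ * w₂ + h₂₂ * w₂ ^ 2) +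
        2 * (β + 3) * (w₁ * (a * w₁ ^ 2 + 2 * b * w₁ * w₂ + c * w₂ ^ 2) +
          w₂ * (b * w₁ ^ 2 + 2 * c * w₁ * w₂ + e * w₂ ^ 2)) := by
  obtain rfl : X₁ = -4 * h₁₁ + a ^ 2 + 2 * b ^ 2 + c ^ 2 - X₂ := by linarith
  obtain rfl : Z₁ = -4 * h₂₂ + b ^ 2 + 2 * c ^ 2 + e ^ 2 - Z₂ := by linarith
  obtain rfl : Y₁ = -4 * h₁₂ + a * b + 2 * b * c + c * e - Y₂ := by linarith
  obtain rfl : k₁ = -(β + 3) * N₁ - (c * h₁₁ - 2 * b * h₁₂ + a * h₂₂ + k₂) := by linarith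
  obtain rfl : k₃ = -(β + 3) * N₂ - (e * h₁₁ - 2 * c * h₁₂ + b * h₂₂ + k₄) := by linarith
  subst hN₁ hN₂
  obtain rfl : a = -4 * w₁ - c := by linarith
  obtain rfl : e = -4 * w₂ - b := by linarith
  obtain rfl : h₁₁ = -(β + 3) * (w₁ ^ 2 + w₂ ^ 2) - h₂₂ := by linarith
  ring

section FrameJets

variable {Ω : Set (Fin 2 → ℝ)} {f : (Fin 2 → ℝ) → ℝ} {x : Fin 2 → ℝ} {e₁ e₂ : Fin 2 → ℝ}
  {l₁ l₂ β : ℝ}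

set_option maxHeartbeats 2000000 in
/-- Jets at `x`, along the vectors of a frame, of the second derivatives of `f`, of `logRho f` and
of `Phi f`, and the relations between them. -/
theorem frame_jets (hΩ : IsOpen Ω) (hf : ContDiffOn ℝ (⊤ : ℕ∞) f Ω)
    (hp : ∀ x ∈ Ω, (hess f x).PosDef) (hpde : PDE2 f β Ω) (hx : x ∈ Ω)
    (hF : IsFrame f x e₁ e₂ l₁ l₂) :
    ∃ a b c e w₁ w₂ h₁₁ h₁₂ h₂₂ X₁ X₂ Z₁ Z₂ Φ₁ Φ₂ Ψ₁ Ψ₂ : ℝ,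
      (a + c = -4 * w₁ ∧ b + e = -4 * w₂ ∧ h₁₁ + h₂₂ = -(β + 3) * (w₁ ^ 2 + w₂ ^ 2) ∧
        X₁ + X₂ = -4 * h₁₁ + a ^ 2 + 2 * b ^ 2 + c ^ 2 ∧
        Z₁ + Z₂ = -4 * h₂₂ + b ^ 2 + 2 * c ^ 2 + e ^ 2 ∧
        Phi f x = w₁ ^ 2 + w₂ ^ 2 ∧
        Φ₁ = 2 * (w₁ * h₁₁ + w₂ * h₁₂) - (a * w₁ ^ 2 + 2 * b * w₁ * w₂ + c * w₂ ^ 2) ∧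
        Φ₂ = 2 * (w₁ * h₁₂ + w₂ * h₂₂) - (b * w₁ ^ 2 + 2 * c * w₁ * w₂ + e * w₂ ^ 2) ∧
        Ψ₁ + Ψ₂ = 2 * (h₁₁ ^ 2 + 2 * h₁₂ ^ 2 + h₂₂ ^ 2) -
          2 * ((a * w₁ + b * w₂) * h₁₁ + 2 * (b * w₁ + c * w₂) * h₁₂ +
          (c * w₁ + e * w₂) * h₂₂) + ((a * w₁ + b * w₂) ^ 2 + 2 * (b * w₁ + c * w₂) ^ 2 +
          (c * w₁ + e * w₂) ^ 2) -
          4 * (β + 2) * (h₁₁ * w₁ ^ 2 + 2 * h₁₂ * w₁ * w₂ + h₂₂ * w₂ ^ 2) +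
          2 * (β + 3) * (w₁ * (a * w₁ ^ 2 + 2 * b * w₁ * w₂ + c * w₂ ^ 2) +
            w₂ * (b * w₁ ^ 2 + 2 * c * w₁ * w₂ + e * w₂ ^ 2))) ∧
      Jet2 (fun t => dirDeriv e₁ (dirDeriv e₁ f) (x + t • e₁)) a X₁ ∧
      Jet2 (fun t => dirDeriv e₁ (dirDeriv e₁ f) (x + t • e₂)) b X₂ ∧
      Jet2 (fun t => dirDeriv e₂ (dirDeriv e₂ f) (x + t • e₁)) c Z₁ ∧
      Jet2 (fun t => dirDeriv e₂ (dirDeriv e₂ f) (x + t • e₂)) e Z₂ ∧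
      Jet2 (fun t => dirDeriv e₁ f (x + t • e₁)) 1 a ∧
      Jet2 (fun t => dirDeriv e₁ f (x + t • e₂)) 0 c ∧
      Jet2 (fun t => dirDeriv e₂ f (x + t • e₁)) 0 b ∧
      Jet2 (fun t => dirDeriv e₂ f (x + t • e₂)) 1 e ∧
      Jet2 (fun t => logRho f (x + t • e₁)) w₁ h₁₁ ∧
      Jet2 (fun t => logRho f (x + t • e₂)) w₂ h₂₂ ∧
      Jet2 (fun t => Phi f (x + t • e₁)) Φ₁ Ψ₁ ∧
      Jet2 (fun t => Phi f (x + t • e₂)) Φ₂ Ψ₂ := by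
  have hl := contDiffOn_logRho hΩ hf hp
  have hJ := hF.jacobian_ne hΩ hf hp hx
  have f1 := hf.dirDeriv hΩ e₁
  have f2 := hf.dirDeriv hΩ e₂
  have f11 := f1.dirDeriv hΩ e₁
  have f12 := f2.dirDeriv hΩ e₁
  have f22 := f2.dirDeriv hΩ e₂
  have l1 := hl.dirDeriv hΩ e₁
  have l2 := hl.dirDeriv hΩ e₂
  have l11 := l1.dirDeriv hΩ e₁
  have l12 := l2.dirDeriv hΩ e₁
  have l22 := l2.dirDeriv hΩ e₂
  obtain ⟨a, ha⟩ : ∃ a, dirDeriv e₁ (dirDeriv e₁ (dirDeriv e₁ f)) x = a := ⟨_, rfl⟩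
  obtain ⟨b, hb⟩ : ∃ b, dirDeriv e₁ (dirDeriv e₁ (dirDeriv e₂ f)) x = b := ⟨_, rfl⟩
  obtain ⟨c, hc⟩ : ∃ c, dirDeriv e₁ (dirDeriv e₂ (dirDeriv e₂ f)) x = c := ⟨_, rfl⟩
  obtain ⟨e, he⟩ : ∃ e, dirDeriv e₂ (dirDeriv e₂ (dirDeriv e₂ f)) x = e := ⟨_, rfl⟩
  obtain ⟨w₁, hw₁⟩ : ∃ w, dirDeriv e₁ (logRho f) x = w := ⟨_, rfl⟩
  obtain ⟨w₂, hw₂⟩ : ∃ w, dirDeriv e₂ (logRho f) x = w := ⟨_, rfl⟩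
  obtain ⟨h₁₁, hh₁₁⟩ : ∃ w, dirDeriv e₁ (dirDeriv e₁ (logRho f)) x = w := ⟨_, rfl⟩
  obtain ⟨h₁₂, hh₁₂⟩ : ∃ w, dirDeriv e₁ (dirDeriv e₂ (logRho f)) x = w := ⟨_, rfl⟩
  obtain ⟨h₂₂, hh₂₂⟩ : ∃ w, dirDeriv e₂ (dirDeriv e₂ (logRho f)) x = w := ⟨_, rfl⟩
  have hh₂₁ : dirDeriv e₂ (dirDeriv e₁ (logRho f)) x = h₁₂ := by
    rw [dirDeriv_comm hΩ hl hx, hh₁₂]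
  have hb' : dirDeriv e₂ (dirDeriv e₁ (dirDeriv e₁ f)) x = b := by
    rw [dirDeriv_comm₃ hΩ hf hx, hb]
  have hc' : dirDeriv e₂ (dirDeriv e₂ (dirDeriv e₁ f)) x = c := by
    rw [← dirDeriv_comm₃ hΩ hf hx, hc]
  have hc'' : dirDeriv e₂ (dirDeriv e₁ (dirDeriv e₂ f)) x = c := by
    rw [dirDeriv_comm hΩ f2 hx, hc]
  have h0 : dirDeriv e₂ (dirDeriv e₁ f) x = 0 := by
    rw [dirDeriv_comm hΩ hf hx, hF.orth']
  obtain ⟨X₁, hX₁⟩ : ∃ w, dirDeriv e₁ (dirDeriv e₁ (dirDeriv e₁ (dirDeriv e₁ f))) x = w :=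
    ⟨_, rfl⟩
  obtain ⟨X₂, hX₂⟩ : ∃ w, dirDeriv e₂ (dirDeriv e₂ (dirDeriv e₁ (dirDeriv e₁ f))) x = w :=
    ⟨_, rfl⟩
  obtain ⟨Y₁, hY₁⟩ : ∃ w, dirDeriv e₁ (dirDeriv e₁ (dirDeriv e₁ (dirDeriv e₂ f))) x = w :=
    ⟨_, rfl⟩
  obtain ⟨Y₂, hY₂⟩ : ∃ w, dirDeriv e₂ (dirDeriv e₂ (dirDeriv e₁ (dirDeriv e₂ f))) x = w :=
    ⟨_, rfl⟩
  obtain ⟨Z₁, hZ₁⟩ : ∃ w, dirDeriv e₁ (dirDeriv e₁ (dirDeriv e₂ (dirDeriv e₂ f))) x = w :=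
    ⟨_, rfl⟩
  obtain ⟨Z₂, hZ₂⟩ : ∃ w, dirDeriv e₂ (dirDeriv e₂ (dirDeriv e₂ (dirDeriv e₂ f))) x = w :=
    ⟨_, rfl⟩
  have hXZ : X₂ = Z₁ := by
    rw [← hX₂, ← hZ₁, ← dirDeriv_comm₃ hΩ f2 hx e₂ e₁]
    exact dirDeriv_congr hΩ hx (fun y hy => dirDeriv_comm₃ hΩ hf hy _ _) _
  have hY₁' : dirDeriv e₁ (dirDeriv e₂ (dirDeriv e₁ (dirDeriv e₁ f))) x = Y₁ := by
    rw [← hY₁]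
    exact dirDeriv_congr hΩ hx (fun y hy => dirDeriv_comm₃ hΩ hf hy _ _) _
  have hY₂' : dirDeriv e₁ (dirDeriv e₂ (dirDeriv e₂ (dirDeriv e₂ f))) x = Y₂ := by
    rw [← hY₂, dirDeriv_comm₃ hΩ f2 hx]
  obtain ⟨k₁, hk₁⟩ : ∃ w, dirDeriv e₁ (dirDeriv e₁ (dirDeriv e₁ (logRho f))) x = w := ⟨_, rfl⟩
  obtain ⟨k₂, hk₂⟩ : ∃ w, dirDeriv e₂ (dirDeriv e₂ (dirDeriv e₁ (logRho f))) x = w := ⟨_, rfl⟩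
  obtain ⟨k₃, hk₃⟩ : ∃ w, dirDeriv e₁ (dirDeriv e₁ (dirDeriv e₂ (logRho f))) x = w := ⟨_, rfl⟩
  obtain ⟨k₄, hk₄⟩ : ∃ w, dirDeriv e₂ (dirDeriv e₂ (dirDeriv e₂ (logRho f))) x = w := ⟨_, rfl⟩
  have hk₂' : dirDeriv e₁ (dirDeriv e₂ (dirDeriv e₂ (logRho f))) x = k₂ := by
    rw [← hk₂, dirDeriv_comm₃ hΩ hl hx]
  have hk₃' : dirDeriv e₂ (dirDeriv e₁ (dirDeriv e₁ (logRho f))) x = k₃ := by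
    rw [← hk₃, dirDeriv_comm₃ hΩ hl hx]
  obtain ⟨J, hJeq⟩ : ∃ J, J = (e₁ 0 * e₂ 1 - e₁ 1 * e₂ 0) ^ 2 := ⟨_, rfl⟩
  rw [← hJeq] at hJ
  have u1 := hF.unit₁
  have u2 := hF.unit₂
  have u0 := hF.orth'
  have hdet : ∀ y ∈ Ω, dirDeriv e₁ (dirDeriv e₁ f) y * dirDeriv e₂ (dirDeriv e₂ f) y -
      dirDeriv e₁ (dirDeriv e₂ f) y * dirDeriv e₁ (dirDeriv e₂ f) y =
        J * Real.exp (-4 * logRho f y) := by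
    intro y hy
    rw [hJeq, ← det_frame hΩ hf hp e₁ e₂ hy, sq]
  have hJx : J * Real.exp (-4 * logRho f x) = 1 := by
    rw [← hdet x hx, u1, u2, u0]; norm_num
  -- jets along the frame
  have p11 := jet2_line hΩ f11 hx e₁
  have p12 := jet2_line hΩ f12 hx e₁
  have p22 := jet2_line hΩ f22 hx e₁
  have q11 := jet2_line hΩ f11 hx e₂
  have q12 := jet2_line hΩ f12 hx e₂
  have q22 := jet2_line hΩ f22 hx e₂
  have pl := jet2_line hΩ hl hx e₁
  have ql := jet2_line hΩ hl hx e₂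
  have pl1 := jet2_line hΩ l1 hx e₁
  have pl2 := jet2_line hΩ l2 hx e₁
  have ql1 := jet2_line hΩ l1 hx e₂
  have ql2 := jet2_line hΩ l2 hx e₂
  rw [ha, hX₁] at p11
  rw [hb, hY₁] at p12
  rw [hc, hZ₁] at p22
  rw [hb', hX₂] at q11
  rw [hc'', hY₂] at q12
  rw [he, hZ₂] at q22
  rw [hw₁, hh₁₁] at pl
  rw [hw₂, hh₂₂] at ql
  rw [hh₁₁, hk₁] at pl1
  rw [hh₁₂, hk₃] at pl2
  rw [hh₂₁, hk₂] at ql1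
  rw [hh₂₂, hk₄] at ql2
  have R1 := ((p11.mul p22).sub (p12.mul p12)).unique_of_eventuallyEq
    ((pl.const_mul (-4)).exp.const_mul J) (by
      filter_upwards [eventually_line_mem hΩ hx e₁] with t ht using hdet _ ht)
  have R2 := ((q11.mul q22).sub (q12.mul q12)).unique_of_eventuallyEq
    ((ql.const_mul (-4)).exp.const_mul J) (by
      filter_upwards [eventually_line_mem hΩ hx e₂] with t ht using hdet _ ht)
  simp only [zero_smul, add_zero, u1, u2, u0] at R1 R2
  have hac : a + c = -4 * w₁ := by linear_combination R1.1 + (-4 * w₁) * hJx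
  have hbe : b + e = -4 * w₂ := by linear_combination R2.1 + (-4 * w₂) * hJx
  have hXZ₁ : X₁ + Z₁ = -4 * h₁₁ + a ^ 2 + 2 * b ^ 2 + c ^ 2 := by
    linear_combination R1.2 + (16 * w₁ ^ 2 - 4 * h₁₁) * hJx - (a + c - 4 * w₁) * hac
  have hXZ₂ : X₂ + Z₂ = -4 * h₂₂ + b ^ 2 + 2 * c ^ 2 + e ^ 2 := by
    linear_combination R2.2 + (16 * w₂ ^ 2 - 4 * h₂₂) * hJx - (b + e - 4 * w₂) * hbe
  have hdet₂ : ∀ y ∈ Ω,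
      dirDeriv e₂ (dirDeriv e₁ (dirDeriv e₁ f)) y * dirDeriv e₂ (dirDeriv e₂ f) y +
      dirDeriv e₁ (dirDeriv e₁ f) y * dirDeriv e₂ (dirDeriv e₂ (dirDeriv e₂ f)) y -
      2 * (dirDeriv e₁ (dirDeriv e₂ f) y * dirDeriv e₂ (dirDeriv e₁ (dirDeriv e₂ f)) y) =
        J * (-4 * (dirDeriv e₂ (logRho f) y * Real.exp (-4 * logRho f y))) := by
    intro y hy
    have := (((jet2_line hΩ f11 hy e₂).mul (jet2_line hΩ f22 hy e₂)).sub
      ((jet2_line hΩ f12 hy e₂).mul (jet2_line hΩ f12 hy e₂))).unique_of_eventuallyEq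
      (((jet2_line hΩ hl hy e₂).const_mul (-4)).exp.const_mul J) (by
        filter_upwards [eventually_line_mem hΩ hy e₂] with t ht using hdet _ ht)
    simp only [zero_smul, add_zero] at this
    linear_combination this.1
  have R3 := ((((jet2_line hΩ (f11.dirDeriv hΩ e₂) hx e₁).mul p22).add
    (p11.mul (jet2_line hΩ (f22.dirDeriv hΩ e₂) hx e₁))).sub
    ((p12.mul (jet2_line hΩ (f12.dirDeriv hΩ e₂) hx e₁)).const_mul 2)).unique_of_eventuallyEq
    ((((jet2_line hΩ l2 hx e₁).mul (pl.const_mul (-4)).exp).const_mul (-4)).const_mul J) (by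
      filter_upwards [eventually_line_mem hΩ hx e₁] with t ht using hdet₂ _ ht)
  simp only [zero_smul, add_zero, u1, u2, u0, hY₁', hY₂', hb', he, hc'', hw₂, hh₁₂] at R3
  have hYY : Y₁ + Y₂ = -4 * h₁₂ + a * b + 2 * b * c + c * e := by
    linear_combination R3.1 + (16 * w₁ * w₂ - 4 * h₁₂) * hJx - 4 * w₂ * (-hac) - (a + c) * hbe
  -- the equation and its first derivatives
  have pN : Jet2 (fun t => gradForm f e₁ e₂ (x + t • e₁))
      (c * w₁ ^ 2 + 2 * w₁ * h₁₁ - 2 * b * w₁ * w₂ + a * w₂ ^ 2 + 2 * w₂ * h₁₂)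
      (Z₁ * w₁ ^ 2 + 4 * c * w₁ * h₁₁ + 2 * h₁₁ ^ 2 + 2 * w₁ * k₁ - 2 * Y₁ * w₁ * w₂ -
        4 * b * (h₁₁ * w₂ + w₁ * h₁₂) + X₁ * w₂ ^ 2 + 4 * a * w₂ * h₁₂ + 2 * h₁₂ ^ 2 +
        2 * w₂ * k₃) := by
    refine (((p22.mul (pl1.mul pl1)).sub ((p12.mul (pl1.mul pl2)).const_mul 2)).add
      (p11.mul (pl2.mul pl2))).congr_val ?_ ?_ <;>
    · simp only [zero_smul, add_zero, u1, u2, u0, hw₁, hw₂]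
      ring
  have qN : Jet2 (fun t => gradForm f e₁ e₂ (x + t • e₂))
      (e * w₁ ^ 2 + 2 * w₁ * h₁₂ - 2 * c * w₁ * w₂ + b * w₂ ^ 2 + 2 * w₂ * h₂₂)
      (Z₂ * w₁ ^ 2 + 4 * e * w₁ * h₁₂ + 2 * h₁₂ ^ 2 + 2 * w₁ * k₂ - 2 * Y₂ * w₁ * w₂ -
        4 * c * (h₁₂ * w₂ + w₁ * h₂₂) + X₂ * w₂ ^ 2 + 4 * b * w₂ * h₂₂ + 2 * h₂₂ ^ 2 +
        2 * w₂ * k₄) := by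
    refine (((q22.mul (ql1.mul ql1)).sub ((q12.mul (ql1.mul ql2)).const_mul 2)).add
      (q11.mul (ql2.mul ql2))).congr_val ?_ ?_ <;>
    · simp only [zero_smul, add_zero, u1, u2, u0, hw₁, hw₂]
      ring
  have N0 : gradForm f e₁ e₂ x = w₁ ^ 2 + w₂ ^ 2 := by
    simp only [gradForm, u1, u2, u0, hw₁, hw₂]
    ring
  have R4 := (((p22.mul (jet2_line hΩ l11 hx e₁)).sub
    ((p12.mul (jet2_line hΩ l12 hx e₁)).const_mul 2)).add
    (p11.mul (jet2_line hΩ l22 hx e₁))).unique_of_eventuallyEq (pN.const_mul (-(β + 3))) (by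
      filter_upwards [eventually_line_mem hΩ hx e₁] with t ht using
        hpde.frame_eq hΩ hf hp e₁ e₂ ht)
  have R5 := (((q22.mul (jet2_line hΩ l11 hx e₂)).sub
    ((q12.mul (jet2_line hΩ l12 hx e₂)).const_mul 2)).add
    (q11.mul (jet2_line hΩ l22 hx e₂))).unique_of_eventuallyEq (qN.const_mul (-(β + 3))) (by
      filter_upwards [eventually_line_mem hΩ hx e₂] with t ht using
        hpde.frame_eq hΩ hf hp e₁ e₂ ht)
  have R4 := R4.1
  have R5 := R5.1
  simp only [zero_smul, add_zero, u1, u2, u0, hh₁₁, hh₁₂, hh₂₂, hk₁, hk₂', hk₃', hk₄]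
    at R4 R5
  have R0 := hpde.frame_eq hΩ hf hp e₁ e₂ hx
  rw [gradForm] at R0
  simp only [u1, u2, u0, hw₁, hw₂, hh₁₁, hh₁₂, hh₂₂] at R0
  have hLh : h₁₁ + h₂₂ = -(β + 3) * (w₁ ^ 2 + w₂ ^ 2) := by linear_combination R0
  have pΦ := ((pN.mul (pl.const_mul 4).exp).const_mul J⁻¹).congr'
    (k := fun t => Phi f (x + t • e₁)) (by
      filter_upwards [eventually_line_mem hΩ hx e₁] with t ht
      rw [Phi_frame hΩ hf hp (by rwa [← hJeq]) ht, hJeq])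
  have qΦ := ((qN.mul (ql.const_mul 4).exp).const_mul J⁻¹).congr'
    (k := fun t => Phi f (x + t • e₂)) (by
      filter_upwards [eventually_line_mem hΩ hx e₂] with t ht
      rw [Phi_frame hΩ hf hp (by rwa [← hJeq]) ht, hJeq])
  have hJinv : J⁻¹ * Real.exp (4 * logRho f x) = 1 := by
    rw [neg_mul, Real.exp_neg] at hJx
    rw [← inv_inv (Real.exp (4 * logRho f x)), ← mul_inv, hJx, inv_one]
  simp only [zero_smul, add_zero, N0] at pΦ qΦ
  refine ⟨a, b, c, e, w₁, w₂, h₁₁, h₁₂, h₂₂, X₁, X₂, Z₁, Z₂, _, _, _, _,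
    ⟨hac, hbe, hLh, ?_, ?_, ?_, rfl, rfl, ?_⟩, p11, q11, p22, q22, ?_, ?_, ?_, ?_, pl, ql,
    pΦ.congr_val ?_ rfl, qΦ.congr_val ?_ rfl⟩
  · linear_combination hXZ₁ + hXZ
  · linear_combination hXZ₂ - hXZ
  · rw [Phi_frame hΩ hf hp (by rwa [← hJeq]) hx, ← hJeq, N0]
    linear_combination (w₁ ^ 2 + w₂ ^ 2) * hJinv
  · have key := lap_Phi_algebra (X₁ := X₁) (X₂ := X₂) (Y₁ := Y₁) (Y₂ := Y₂) (Z₁ := Z₁) (Z₂ := Z₂)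
      (k₁ := k₁) (k₂ := k₂) (k₃ := k₃) (k₄ := k₄) hac hbe hLh (by linear_combination hXZ₁ + hXZ)
      (by linear_combination hXZ₂ - hXZ) hYY rfl rfl (by linear_combination R4)
      (by linear_combination R5)
    rw [← key]
    linear_combination ((Z₁ * w₁ ^ 2 + 4 * c * w₁ * h₁₁ + 2 * h₁₁ ^ 2 + 2 * w₁ * k₁ -
      2 * Y₁ * w₁ * w₂ - 4 * b * (h₁₁ * w₂ + w₁ * h₁₂) + X₁ * w₂ ^ 2 + 4 * a * w₂ * h₁₂ +
      2 * h₁₂ ^ 2 + 2 * w₂ * k₃) + 8 * w₁ * (c * w₁ ^ 2 + 2 * w₁ * h₁₁ - 2 * b * w₁ * w₂ +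
      a * w₂ ^ 2 + 2 * w₂ * h₁₂) + (w₁ ^ 2 + w₂ ^ 2) * (4 * h₁₁ + 16 * w₁ ^ 2) +
      ((Z₂ * w₁ ^ 2 + 4 * e * w₁ * h₁₂ + 2 * h₁₂ ^ 2 + 2 * w₁ * k₂ - 2 * Y₂ * w₁ * w₂ -
      4 * c * (h₁₂ * w₂ + w₁ * h₂₂) + X₂ * w₂ ^ 2 + 4 * b * w₂ * h₂₂ + 2 * h₂₂ ^ 2 +
      2 * w₂ * k₄) + 8 * w₂ * (e * w₁ ^ 2 + 2 * w₁ * h₁₂ - 2 * c * w₁ * w₂ + b * w₂ ^ 2 +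
      2 * w₂ * h₂₂) + (w₁ ^ 2 + w₂ ^ 2) * (4 * h₂₂ + 16 * w₂ ^ 2))) * hJinv
  · exact (jet2_line hΩ f1 hx e₁).congr_val u1 ha
  · exact (jet2_line hΩ f1 hx e₂).congr_val h0 hc'
  · exact (jet2_line hΩ f2 hx e₁).congr_val u0 hb
  · exact (jet2_line hΩ f2 hx e₂).congr_val u2 he
  · linear_combination (c * w₁ ^ 2 + 2 * w₁ * h₁₁ - 2 * b * w₁ * w₂ + a * w₂ ^ 2 +
      2 * w₂ * h₁₂ + 4 * w₁ * (w₁ ^ 2 + w₂ ^ 2)) * hJinv + (w₁ ^ 2 + w₂ ^ 2) * hac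
  · linear_combination (e * w₁ ^ 2 + 2 * w₁ * h₁₂ - 2 * c * w₁ * w₂ + b * w₂ ^ 2 +
      2 * w₂ * h₂₂ + 4 * w₂ * (w₁ ^ 2 + w₂ ^ 2)) * hJinv + (w₁ ^ 2 + w₂ ^ 2) * hbe

end FrameJets

section FrameExistence

variable {Ω : Set (Fin 2 → ℝ)} {f : (Fin 2 → ℝ) → ℝ} {x : Fin 2 → ℝ}

/-- A symmetric binary quadratic form is diagonalised by a rotation. -/
theorem exists_rotation_diag (p q r : ℝ) :
    ∃ c s : ℝ, c ^ 2 + s ^ 2 = 1 ∧ (r - p) * (c * s) + q * (c ^ 2 - s ^ 2) = 0 := by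
  let F : ℝ → ℝ := fun t =>
    (r - p) * (Real.cos t * Real.sin t) + q * (Real.cos t ^ 2 - Real.sin t ^ 2)
  have hF : ContinuousOn F (Set.uIcc 0 (π / 2)) := by fun_prop
  have h0 : F 0 = q := by simp [F]
  have h1 : F (π / 2) = -q := by simp [F]
  obtain ⟨t, -, ht⟩ : (0 : ℝ) ∈ F '' Set.uIcc 0 (π / 2) := by
    refine intermediate_value_uIcc hF ?_
    rw [h0, h1, Set.mem_uIcc]
    rcases le_total q 0 with h | h
    · exact Or.inl ⟨h, by linarith⟩
    · exact Or.inr ⟨by linarith, h⟩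
  exact ⟨Real.cos t, Real.sin t, Real.cos_sq_add_sin_sq t, ht⟩

theorem hess_quadratic_pos (hΩ : IsOpen Ω) (hf : ContDiffOn ℝ (⊤ : ℕ∞) f Ω)
    (hp : (hess f x).PosDef) (hx : x ∈ Ω) {v : Fin 2 → ℝ} (hv : v ≠ 0) :
    0 < dirDeriv v (dirDeriv v f) x := by
  have := hp.dotProduct_mulVec_pos hv
  rw [dirDeriv_dirDeriv_eq hΩ hf hx]
  simp [dotProduct, Matrix.mulVec, Fin.sum_univ_two, hess] at this
  rw [pd_comm hΩ hf hx 1 0] at this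
  linarith

theorem exists_isFrame (hΩ : IsOpen Ω) (hf : ContDiffOn ℝ (⊤ : ℕ∞) f Ω)
    (hp : ∀ x ∈ Ω, (hess f x).PosDef) (hx : x ∈ Ω) :
    ∃ e₁ e₂ l₁ l₂, IsFrame f x e₁ e₂ l₁ l₂ := by
  obtain ⟨c, s, hcs, hd⟩ :=
    exists_rotation_diag (pd 0 (pd 0 f) x) (pd 0 (pd 1 f) x) (pd 1 (pd 1 f) x)
  have hne : ∀ v : Fin 2 → ℝ, v 0 ^ 2 + v 1 ^ 2 = 1 → v ≠ 0 := by
    rintro v hv rfl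
    simp at hv
  have h1 := hess_quadratic_pos hΩ hf (hp x hx) hx (hne ![c, s] (by simpa using hcs))
  have h2 := hess_quadratic_pos hΩ hf (hp x hx) hx
    (hne ![-s, c] (by simp only [cons_val_zero, cons_val_one]; linarith))
  obtain ⟨l₁, hl₁⟩ : ∃ l, l = dirDeriv ![c, s] (dirDeriv ![c, s] f) x := ⟨_, rfl⟩
  obtain ⟨l₂, hl₂⟩ : ∃ l, l = dirDeriv ![-s, c] (dirDeriv ![-s, c] f) x := ⟨_, rfl⟩
  rw [← hl₁] at h1
  rw [← hl₂] at h2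
  rw [dirDeriv_dirDeriv_eq hΩ hf hx] at hl₁ hl₂
  have r1 : (√l₁)⁻¹ ^ 2 = l₁⁻¹ := by rw [inv_pow, Real.sq_sqrt h1.le]
  have r2 : (√l₂)⁻¹ ^ 2 = l₂⁻¹ := by rw [inv_pow, Real.sq_sqrt h2.le]
  have i1 : l₁ * l₁⁻¹ = 1 := mul_inv_cancel₀ h1.ne'
  have i2 : l₂ * l₂⁻¹ = 1 := mul_inv_cancel₀ h2.ne'
  refine ⟨![(√l₁)⁻¹ * c, (√l₁)⁻¹ * s], ![(√l₂)⁻¹ * -s, (√l₂)⁻¹ * c], l₁, l₂, h1, h2, ?_, ?_, ?_,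
    ?_, ?_, ?_, ?_, ?_, ?_⟩
  all_goals try rw [dirDeriv_dirDeriv_eq hΩ hf hx]
  all_goals simp only [cons_val_zero, cons_val_one] at hl₁ hl₂ ⊢
  all_goals generalize (√l₁)⁻¹ = a at *
  all_goals generalize (√l₂)⁻¹ = b at *
  all_goals generalize l₁⁻¹ = m₁ at *
  all_goals generalize l₂⁻¹ = m₂ at *
  · ring
  · linear_combination l₁ * (c ^ 2 + s ^ 2) * r1 + (c ^ 2 + s ^ 2) * i1 + hcs
  · linear_combination l₂ * (c ^ 2 + s ^ 2) * r2 + (c ^ 2 + s ^ 2) * i2 + hcs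
  · linear_combination l₁ * c ^ 2 * r1 + c ^ 2 * i1 + l₂ * s ^ 2 * r2 + s ^ 2 * i2 + hcs
  · linear_combination l₁ * s ^ 2 * r1 + s ^ 2 * i1 + l₂ * c ^ 2 * r2 + c ^ 2 * i2 + hcs
  · linear_combination l₁ * c * s * r1 + c * s * i1 - l₂ * c * s * r2 - s * c * i2
  · linear_combination (-a ^ 2) * hl₁ + l₁ * r1 + i1
  · linear_combination (-b ^ 2) * hl₂ + l₂ * r2 + i2
  · linear_combination a * b * hd

end FrameExistence

section TestFunction

/-- The function maximised in the proof, as a function of the values of `f`, `log ρ`, `Φ`, `d + u`,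
the squared Euclidean gradient of `f` and the Euclidean trace of its Hessian. -/
noncomputable def testValue (α c m K M F φ P V N S : ℝ) : ℝ :=
  -m * (c - F)⁻¹ + K * (P * Real.exp (-α * (φ + Real.log V))) + M * (N * V⁻¹ ^ 2) + Real.log S -
    α * φ - (α + 2) * Real.log V

variable {α c m K M : ℝ} {F φ P V N S : ℝ → ℝ} {F₁ F₂ w h P₁ P₂ V₁ V₂ N₁ N₂ S₁ S₂ : ℝ}

theorem jet2_testValue (hF : Jet2 F F₁ F₂) (hφ : Jet2 φ w h) (hP : Jet2 P P₁ P₂)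
    (hV : Jet2 V V₁ V₂) (hN : Jet2 N N₁ N₂) (hS : Jet2 S S₁ S₂) (hc : c - F 0 ≠ 0)
    (hV0 : V 0 ≠ 0) (hS0 : S 0 ≠ 0) {i z g σ : ℝ} (hi : i = (V 0)⁻¹) (hz : z = i * V₁)
    (hg : g = (c - F 0)⁻¹) (hσ : σ = Real.exp (-α * (φ 0 + Real.log (V 0)))) :
    Jet2 (fun t => testValue α c m K M (F t) (φ t) (P t) (V t) (N t) (S t))
      (-(m * g ^ 2 * F₁) + K * (P₁ * σ + P 0 * (-(α * σ * (w + z)))) +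
        M * (N₁ * i ^ 2 + N 0 * (-2 * i ^ 2 * z)) + S₁ / S 0 - α * w - (α + 2) * z)
      (-(m * (g ^ 2 * F₂ + 2 * g ^ 3 * F₁ ^ 2)) +
        K * (P₂ * σ + 2 * (P₁ * (-(α * σ * (w + z)))) +
          P 0 * (σ * (α ^ 2 * (w + z) ^ 2 - α * (h + i * V₂ - z ^ 2)))) +
        M * (N₂ * i ^ 2 + 2 * (N₁ * (-2 * i ^ 2 * z)) +
          N 0 * (6 * i ^ 2 * z ^ 2 - 2 * i ^ 2 * (i * V₂))) +
        (S₂ / S 0 - (S₁ / S 0) ^ 2) - α * h - (α + 2) * (i * V₂ - z ^ 2)) := by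
  have j1 : Jet2 (fun t => (c - F t)⁻¹) (g ^ 2 * F₁) (g ^ 2 * F₂ + 2 * g ^ 3 * F₁ ^ 2) := by
    refine (((Jet2.const c).sub hF).inv hc).congr_val ?_ ?_ <;>
    · rw [hg]; field_simp; ring
  have j2 : Jet2 (fun t => Real.log (V t)) z (i * V₂ - z ^ 2) := by
    refine (hV.log hV0).congr_val ?_ ?_ <;>
    · rw [hz, hi]; field_simp
  have j3 : Jet2 (fun t => (V t)⁻¹ ^ 2) (-2 * i ^ 2 * z)
      (6 * i ^ 2 * z ^ 2 - 2 * i ^ 2 * (i * V₂)) := by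
    refine (hV.inv hV0).sq.congr_val ?_ ?_ <;>
    · rw [hz, hi]; field_simp; try ring
  have j4 : Jet2 (fun t => Real.exp (-α * (φ t + Real.log (V t)))) (-(α * σ * (w + z)))
      (σ * (α ^ 2 * (w + z) ^ 2 - α * (h + i * V₂ - z ^ 2))) := by
    refine ((hφ.add j2).const_mul (-α)).exp.congr_val ?_ ?_ <;>
    · rw [hσ]; ring
  refine ((((((j1.const_mul (-m)).add ((hP.mul j4).const_mul K)).add
    ((hN.mul j3).const_mul M)).add (hS.log hS0)).sub (hφ.const_mul α)).sub
    (j2.const_mul (α + 2))).congr_val ?_ ?_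
  · rw [← hσ, ← hi]; ring
  · rw [← hσ, ← hi]; ring

end TestFunction

theorem Jet2.affine (p q : ℝ) : Jet2 (fun t => p + t * q) q 0 :=
  ⟨fun _ => q, Eventually.of_forall fun t => by simpa using ((hasDerivAt_id t).mul_const q).const_add p,
    rfl, hasDerivAt_const 0 q⟩

section TestFunction

variable {Ω : Set (Fin 2 → ℝ)} {f : (Fin 2 → ℝ) → ℝ} {x : Fin 2 → ℝ}

/-- The function `d + u ∘ ∇f`. -/
noncomputable def legendreShift (d : ℝ) (f : (Fin 2 → ℝ) → ℝ) (x : Fin 2 → ℝ) : ℝ :=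
  d + (x 0 * pd 0 f x + x 1 * pd 1 f x) - f x

noncomputable def testFun (α d c m K M : ℝ) (f : (Fin 2 → ℝ) → ℝ) (x : Fin 2 → ℝ) : ℝ :=
  testValue α c m K M (f x) (logRho f x) (Phi f x) (legendreShift d f x)
    (pd 0 f x ^ 2 + pd 1 f x ^ 2) (∑ i, hess f x i i)

set_option maxHeartbeats 1000000 in
theorem trace_le_of_isLocalMax {α β s d i k c m g₀ K M B δ σ T : ℝ} (hΩ : IsOpen Ω)
    (hf : ContDiffOn ℝ (⊤ : ℕ∞) f Ω) (hp : ∀ x ∈ Ω, (hess f x).PosDef) (hpde : PDE2 f β Ω)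
    (hx : x ∈ Ω) (hmax : IsLocalMax (testFun α d c m K M f) x)
    (hβ : 0 < β) (hα : 1 < α) (hs : s = α + β + 3) (hδ : 0 < δ)
    (hB : 0 < B) (hK : K = 1 / (1000 * δ * s ^ 2)) (hM : M = 1 / (100 * B))
    (hfx : 0 ≤ f x) (hfc : f x < c) (hg₀ : g₀ = (c - f x)⁻¹) (hk : k = m * g₀ ^ 2) (hm : 0 < m)
    (hmg : 32 ≤ m * g₀) (hv : 0 < legendreShift d f x) (hi : i = (legendreShift d f x)⁻¹)
    (hσ : σ = Real.exp (-α * (logRho f x + Real.log (legendreShift d f x))))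
    (hT : T = ∑ i, hess f x i i) (hΦσ : Phi f x * σ ≤ δ)
    (hN : (pd 0 f x ^ 2 + pd 1 f x ^ 2) * i ^ 2 ≤ B) :
    M / 2 * (T * i ^ 2) ≤ 2 * k + k * ((α + 2) * (d * i)) / 2 + 32 / (K * σ) +
      600 * s ^ 2 * Phi f x + 2 * s * i := by
  obtain ⟨e₁, e₂, l₁, l₂, hF⟩ := exists_isFrame hΩ hf hp hx
  obtain ⟨a, b, cc, e, w₁, w₂, h₁₁, h₁₂, h₂₂, X₁, X₂, Z₁, Z₂, Φ₁, Φ₂, Ψ₁, Ψ₂,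
    ⟨hac, hbe, hLh, hX, hZ, hΦ, hΦ₁, hΦ₂, hΨ⟩, p11, q11, p22, q22, p1, q1, p2, q2, pl, ql, pΦ, qΦ⟩ :=
    frame_jets hΩ hf hp hpde hx hF
  have hl₁ := hF.pos₁
  have hl₂ := hF.pos₂
  obtain ⟨g₁, hg₁⟩ : ∃ g, g = dirDeriv e₁ f x := ⟨_, rfl⟩
  obtain ⟨g₂, hg₂⟩ : ∃ g, g = dirDeriv e₂ f x := ⟨_, rfl⟩
  obtain ⟨y₁, hy₁⟩ : ∃ y, y = l₁ * (e₁ 0 * x 0 + e₁ 1 * x 1) := ⟨_, rfl⟩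
  obtain ⟨y₂, hy₂⟩ : ∃ y, y = l₂ * (e₂ 0 * x 0 + e₂ 1 * x 1) := ⟨_, rfl⟩
  have pf : Jet2 (fun t => f (x + t • e₁)) g₁ 1 :=
    (jet2_line hΩ hf hx e₁).congr_val hg₁.symm hF.unit₁
  have qf : Jet2 (fun t => f (x + t • e₂)) g₂ 1 :=
    (jet2_line hΩ hf hx e₂).congr_val hg₂.symm hF.unit₂
  have pη₁ : Jet2 (fun t => l₁ * (e₁ 0 * (x + t • e₁) 0 + e₁ 1 * (x + t • e₁) 1)) 1 0 :=
    (Jet2.affine y₁ 1).congr' (Eventually.of_forall fun t => by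
      simp only [Pi.add_apply, Pi.smul_apply, smul_eq_mul]
      linear_combination (-1 : ℝ) * hy₁ + t * hF.norm₁)
  have pη₂ : Jet2 (fun t => l₂ * (e₂ 0 * (x + t • e₁) 0 + e₂ 1 * (x + t • e₁) 1)) 0 0 :=
    (Jet2.affine y₂ 0).congr' (Eventually.of_forall fun t => by
      simp only [Pi.add_apply, Pi.smul_apply, smul_eq_mul]
      linear_combination (-1 : ℝ) * hy₂ + l₂ * t * hF.orth)
  have qη₁ : Jet2 (fun t => l₁ * (e₁ 0 * (x + t • e₂) 0 + e₁ 1 * (x + t • e₂) 1)) 0 0 :=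
    (Jet2.affine y₁ 0).congr' (Eventually.of_forall fun t => by
      simp only [Pi.add_apply, Pi.smul_apply, smul_eq_mul]
      linear_combination (-1 : ℝ) * hy₁ + l₁ * t * hF.orth)
  have qη₂ : Jet2 (fun t => l₂ * (e₂ 0 * (x + t • e₂) 0 + e₂ 1 * (x + t • e₂) 1)) 1 0 :=
    (Jet2.affine y₂ 1).congr' (Eventually.of_forall fun t => by
      simp only [Pi.add_apply, Pi.smul_apply, smul_eq_mul]
      linear_combination (-1 : ℝ) * hy₂ + t * hF.norm₂)
  have pV : Jet2 (fun t => legendreShift d f (x + t • e₁)) y₁ (1 + y₁ * a + y₂ * b) := by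
    refine (((((Jet2.const d).add (pη₁.mul p1)).add (pη₂.mul p2)).sub pf).congr_val ?_ ?_).congr'
      (Eventually.of_forall fun t => ?_)
    · simp only [zero_smul, add_zero, ← hg₁, ← hg₂, ← hy₁, ← hy₂]; ring
    · simp only [zero_smul, add_zero, ← hg₁, ← hg₂, ← hy₁, ← hy₂]; ring
    · simp only [legendreShift]; rw [radial_frame hF]; ring
  have qV : Jet2 (fun t => legendreShift d f (x + t • e₂)) y₂ (1 + y₁ * cc + y₂ * e) := by
    refine (((((Jet2.const d).add (qη₁.mul q1)).add (qη₂.mul q2)).sub qf).congr_val ?_ ?_).congr'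
      (Eventually.of_forall fun t => ?_)
    · simp only [zero_smul, add_zero, ← hg₁, ← hg₂, ← hy₁, ← hy₂]; ring
    · simp only [zero_smul, add_zero, ← hg₁, ← hg₂, ← hy₁, ← hy₂]; ring
    · simp only [legendreShift]; rw [radial_frame hF]; ring
  have pN : Jet2 (fun t => pd 0 f (x + t • e₁) ^ 2 + pd 1 f (x + t • e₁) ^ 2) (2 * l₁ * g₁)
      (2 * l₁ * (1 + g₁ * a) + 2 * l₂ * (g₂ * b)) := by
    refine (((p1.sq.const_mul l₁).add (p2.sq.const_mul l₂)).congr_val ?_ ?_).congr'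
      (Eventually.of_forall fun t => gradSq_frame hF _) <;>
    · simp only [zero_smul, add_zero, ← hg₁, ← hg₂]; ring
  have qN : Jet2 (fun t => pd 0 f (x + t • e₂) ^ 2 + pd 1 f (x + t • e₂) ^ 2) (2 * l₂ * g₂)
      (2 * l₁ * (g₁ * cc) + 2 * l₂ * (1 + g₂ * e)) := by
    refine (((q1.sq.const_mul l₁).add (q2.sq.const_mul l₂)).congr_val ?_ ?_).congr'
      (Eventually.of_forall fun t => gradSq_frame hF _) <;>
    · simp only [zero_smul, add_zero, ← hg₁, ← hg₂]; ring
  have pS : Jet2 (fun t => ∑ i, hess f (x + t • e₁) i i) (l₁ * a + l₂ * cc)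
      (l₁ * X₁ + l₂ * Z₁) := by
    refine ((p11.const_mul l₁).add (p22.const_mul l₂)).congr' ?_
    filter_upwards [eventually_line_mem hΩ hx e₁] with t ht using trace_frame hΩ hf hF ht
  have qS : Jet2 (fun t => ∑ i, hess f (x + t • e₂) i i) (l₁ * b + l₂ * e)
      (l₁ * X₂ + l₂ * Z₂) := by
    refine ((q11.const_mul l₁).add (q22.const_mul l₂)).congr' ?_
    filter_upwards [eventually_line_mem hΩ hx e₂] with t ht using trace_frame hΩ hf hF ht
  have hTl : T = l₁ + l₂ := by
    rw [hT, trace_frame hΩ hf hF hx, hF.unit₁, hF.unit₂]; ring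
  have T0 : 0 < T := by rw [hTl]; positivity
  obtain ⟨N, hNdef⟩ : ∃ N, N = pd 0 f x ^ 2 + pd 1 f x ^ 2 := ⟨_, rfl⟩
  have hNl : N = l₁ * g₁ ^ 2 + l₂ * g₂ ^ 2 := by rw [hNdef, gradSq_frame hF, hg₁, hg₂]
  obtain ⟨z₁, hz₁⟩ : ∃ z, z = i * y₁ := ⟨_, rfl⟩
  obtain ⟨z₂, hz₂⟩ : ∃ z, z = i * y₂ := ⟨_, rfl⟩
  have hline : ∀ v : Fin 2 → ℝ, IsLocalMax (fun t : ℝ => testFun α d c m K M f (x + t • v)) 0 := by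
    intro v
    have hc : ContinuousAt (fun t : ℝ => x + t • v) 0 := by fun_prop
    have : IsLocalMax (testFun α d c m K M f) (x + (0 : ℝ) • v) := by simpa using hmax
    exact IsMaxFilter.comp_tendsto (g := fun t : ℝ => x + t • v) (b := (0 : ℝ)) this hc
  have i0 : 0 < i := by rw [hi]; positivity
  have σ0 : 0 < σ := by rw [hσ]; positivity
  have g0 : 0 < g₀ := by rw [hg₀]; exact inv_pos.2 (sub_pos.2 hfc)
  have P1 := (jet2_testValue (α := α) (c := c) (m := m) (K := K) (M := M) (i := i) (g := g₀)
    (σ := σ) pf pl pΦ pV pN pS (by simp only [zero_smul, add_zero]; linarith)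
    (by simp only [zero_smul, add_zero]; exact hv.ne')
    (by simp only [zero_smul, add_zero]; rw [← hT]; exact T0.ne') (by simpa using hi) hz₁
    (by simpa using hg₀) (by simpa using hσ)).of_isLocalMax (hline e₁)
  have P2 := (jet2_testValue (α := α) (c := c) (m := m) (K := K) (M := M) (i := i) (g := g₀)
    (σ := σ) qf ql qΦ qV qN qS (by simp only [zero_smul, add_zero]; linarith)
    (by simp only [zero_smul, add_zero]; exact hv.ne')
    (by simp only [zero_smul, add_zero]; rw [← hT]; exact T0.ne') (by simpa using hi) hz₂
    (by simpa using hg₀) (by simpa using hσ)).of_isLocalMax (hline e₂)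
  simp only [zero_smul, add_zero, ← hT, ← hNdef] at P1 P2
  rw [← hNdef] at hN
  obtain ⟨Φ, hΦdef⟩ : ∃ Φ, Φ = Phi f x := ⟨_, rfl⟩
  rw [← hΦdef] at P1 P2 hΦ hΦσ ⊢
  obtain ⟨Q, hQ⟩ : ∃ Q, Q = h₁₁ ^ 2 + 2 * h₁₂ ^ 2 + h₂₂ ^ 2 := ⟨_, rfl⟩
  obtain ⟨A, hA⟩ : ∃ A, A = a ^ 2 + 3 * b ^ 2 + 3 * cc ^ 2 + e ^ 2 := ⟨_, rfl⟩
  obtain ⟨Z, hZZ⟩ : ∃ Z, Z = z₁ ^ 2 + z₂ ^ 2 := ⟨_, rfl⟩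
  obtain ⟨G, hG⟩ : ∃ G, G = g₁ ^ 2 + g₂ ^ 2 := ⟨_, rfl⟩
  obtain ⟨Lv, hLv⟩ : ∃ L, L = 2 * i - 4 * (z₁ * w₁ + z₂ * w₂) := ⟨_, rfl⟩
  have hLv' : i * (1 + y₁ * a + y₂ * b) + i * (1 + y₁ * cc + y₂ * e) = Lv := by
    rw [hLv, hz₁, hz₂]
    linear_combination i * y₁ * hac + i * y₂ * hbe
  have hs0 : 0 < s := by rw [hs]; linarith
  have K0 : 0 < K := by rw [hK]; positivity
  have M0 : 0 < M := by rw [hM]; positivity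
  have hR₁ := tau_one_estimate (α := α) hβ (by linarith) K0.le σ0 i0.le hΦ hQ hA hZZ hΦσ hΦ₁ hΦ₂
    (LΦ := Ψ₁ + Ψ₂) (by rw [hΨ, hQ]) hLv
  have hp' := tau_one_grad (K := K) (α := α) σ0 hΦ hQ hA hZZ hΦσ hΦ₁ hΦ₂
  have hR₂ := tau_two_estimate M0.le i0.le hl₁ hl₂ hTl hNl hΦ hZZ hN hLv
  have hq' := tau_two_grad (M := M) hl₁ hl₂ hTl hNl hZZ hN
  have hS := lap_log_trace_lower (κ := K * σ) (by positivity) hl₁ hl₂ hTl hac hbe hΦ hQ hA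
  have hzg : -(d * i) ≤ z₁ * g₁ + z₂ * g₂ := by
    have h1 : y₁ * g₁ + y₂ * g₂ = legendreShift d f x - d + f x := by
      have := radial_frame hF x x
      rw [← hg₁, ← hg₂, ← hy₁, ← hy₂] at this
      rw [legendreShift, this]; ring
    have h2 : z₁ * g₁ + z₂ * g₂ = i * (legendreShift d f x - d + f x) := by
      rw [← h1, hz₁, hz₂]; ring
    have h3 : 0 ≤ i * (legendreShift d f x + f x) := by positivity
    rw [h2]; linarith
  have k0 : 0 ≤ k := by rw [hk]; positivity
  have hH := grad_log_trace_lower (α := α) (t₁ := (l₁ * a + l₂ * cc) / T)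
    (t₂ := (l₁ * b + l₂ * e) / T) (by linarith) k0 hΦ hG hp' hq' hzg
    (by rw [hk]; linear_combination P1.1) (by rw [hk]; linear_combination P2.1)
  refine combine_estimates (Z := Z) (G := G) (Q := Q) (A := A) (Lv := Lv) hβ hα hs hδ σ0 i0 hB hK
    hM g0 hk hm hmg T0.le (by rw [hA]; positivity) (by rw [hQ]; positivity)
    (by rw [hZZ]; positivity) (by rw [hΦ]; positivity) (by rw [hG]; positivity) hR₁ hR₂ hS hH rfl
    rfl ?_ ?_
  · rw [hLv, hZZ, hΦ]
    linear_combination (1 / 2 : ℝ) * sq_nonneg (z₁ + 4 * w₁) + (1 / 2 : ℝ) * sq_nonneg (z₂ + 4 * w₂)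
  · have e1 : (l₁ * X₁ + l₂ * Z₁) / T + (l₁ * X₂ + l₂ * Z₂) / T =
        (l₁ * (-4 * h₁₁ + a ^ 2 + 2 * b ^ 2 + cc ^ 2) +
          l₂ * (-4 * h₂₂ + b ^ 2 + 2 * cc ^ 2 + e ^ 2)) / T := by
      rw [← hX, ← hZ]; ring
    have e2 : 2 * l₁ * (1 + g₁ * a) + 2 * l₂ * (g₂ * b) +
        (2 * l₁ * (g₁ * cc) + 2 * l₂ * (1 + g₂ * e)) =
        2 * T - 8 * (l₁ * g₁ * w₁ + l₂ * g₂ * w₂) := by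
      rw [hTl]; linear_combination 2 * l₁ * g₁ * hac + 2 * l₂ * g₂ * hbe
    have e3 : h₁₁ + h₂₂ = -(β + 3) * Φ := by rw [hLh, hΦ]
    have P1' := P1.2
    have P2' := P2.2
    generalize (l₁ * (-4 * h₁₁ + a ^ 2 + 2 * b ^ 2 + cc ^ 2) +
      l₂ * (-4 * h₂₂ + b ^ 2 + 2 * cc ^ 2 + e ^ 2)) / T = r₀ at e1 ⊢
    generalize (l₁ * X₁ + l₂ * Z₁) / T = r₁ at *
    generalize (l₁ * X₂ + l₂ * Z₂) / T = r₂ at *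
    generalize (l₁ * a + l₂ * cc) / T = t₁ at *
    generalize (l₁ * b + l₂ * e) / T = t₂ at *
    linear_combination P1' + P2' - 2 * m * g₀ ^ 3 * hG - e1 - M * i ^ 2 * e2 +
      (K * Φ * σ * α + 6 * M * N * i ^ 2 + (α + 2)) * hZZ +
      (K * Φ * σ * α + 2 * M * N * i ^ 2 + (α + 2)) * hLv' + (K * Φ * σ * α + α) * e3

end TestFunction

section NormalizedDomain

variable {Ω : Set (Fin 2 → ℝ)} {f : (Fin 2 → ℝ) → ℝ} {x y e : Fin 2 → ℝ} {C d : ℝ}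

theorem NormalizedDomain.isCompact_closure (hN : NormalizedDomain Ω) : IsCompact (closure Ω) := by
  refine (isCompact_closedBall (0 : Fin 2 → ℝ) 1).of_isClosed_subset isClosed_closure
    (closure_minimal (fun x hx => ?_) Metric.isClosed_closedBall)
  have h := hN.2.2.2 hx
  simp only [ebal, Set.mem_ofPred_eq] at h
  rw [mem_closedBall_zero_iff, pi_norm_le_iff_of_nonneg zero_le_one]
  intro i
  rw [Real.norm_eq_abs, abs_le_one_iff_mul_self_le_one]
  fin_cases i <;> simp <;> nlinarith [sq_nonneg (x 0), sq_nonneg (x 1)]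

theorem NormalizedDomain.sq_lt_one (hN : NormalizedDomain Ω) (hx : x ∈ Ω) :
    x 0 ^ 2 + x 1 ^ 2 < 1 := by
  simpa [ebal] using hN.2.2.2 hx

theorem NormalizedDomain.mem_of_sq_le (hN : NormalizedDomain Ω)
    (hy : y 0 ^ 2 + y 1 ^ 2 ≤ 1 / 16) : y ∈ Ω := by
  refine hN.2.2.1 (lt_of_le_of_lt hy ?_)
  have h1 : (1 / 4 : ℝ) < (2 : ℝ) ^ (-(3 : ℝ) / 2) := by
    rw [show (1 / 4 : ℝ) = (2 : ℝ) ^ (-2 : ℝ) by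
      rw [Real.rpow_neg zero_le_two, show (2 : ℝ) = ((2 : ℕ) : ℝ) by norm_num, Real.rpow_natCast]
      norm_num]
    exact Real.rpow_lt_rpow_of_exponent_lt one_lt_two (by norm_num)
  nlinarith

theorem NormalizedDomain.zero_mem (hN : NormalizedDomain Ω) : (0 : Fin 2 → ℝ) ∈ Ω :=
  hN.mem_of_sq_le (by simp)

theorem mem_frontier_of_mem_closure (hΩ : IsOpen Ω) (hx : x ∈ closure Ω) (hx' : x ∉ Ω) :
    x ∈ frontier Ω := by
  rw [hΩ.frontier_eq]; exact ⟨hx, hx'⟩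

theorem hasDerivAt_line {h : (Fin 2 → ℝ) → ℝ} (hΩ : IsOpen Ω) (hh : ContDiffOn ℝ (⊤ : ℕ∞) h Ω)
    {t : ℝ} (hx : x + t • e ∈ Ω) :
    HasDerivAt (fun t : ℝ => h (x + t • e)) (dirDeriv e h (x + t • e)) t := by
  have h1 : HasFDerivAt h (fderiv ℝ h (x + t • e)) (x + t • e) :=
    ((hh.contDiffAt (hΩ.mem_nhds hx)).differentiableAt (by simp)).hasFDerivAt
  have h2 : HasDerivAt (fun t : ℝ => x + t • e) e t := by
    simpa using ((hasDerivAt_id t).smul_const e).const_add x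
  exact h1.comp_hasDerivAt t h2

theorem first_order_convexity (hΩ : IsOpen Ω) (hc : Convex ℝ Ω) (hf : ContDiffOn ℝ (⊤ : ℕ∞) f Ω)
    (hp : ∀ x ∈ Ω, (hess f x).PosDef) (hx : x ∈ Ω) (hy : y ∈ Ω) :
    f x + (pd 0 f x * (y 0 - x 0) + pd 1 f x * (y 1 - x 1)) ≤ f y := by
  have hmem : ∀ t ∈ Set.Icc (0 : ℝ) 1, x + t • (y - x) ∈ Ω := by
    intro t ht
    exact hc.add_smul_sub_mem hx hy ht
  have hcont : ∀ {h : (Fin 2 → ℝ) → ℝ}, ContDiffOn ℝ (⊤ : ℕ∞) h Ω → ∀ s ≤ (1 : ℝ),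
      ContinuousOn (fun t : ℝ => h (x + t • (y - x))) (Set.Icc 0 s) := by
    intro h hh s hs t ht
    exact (hasDerivAt_line hΩ hh (hmem t ⟨ht.1, ht.2.trans hs⟩)).continuousAt.continuousWithinAt
  obtain ⟨s, hs, h1⟩ := exists_hasDerivAt_eq_slope (fun t : ℝ => f (x + t • (y - x)))
    (fun t => dirDeriv (y - x) f (x + t • (y - x))) zero_lt_one (hcont hf 1 le_rfl)
    (fun t ht => hasDerivAt_line hΩ hf (hmem t (Set.Ioo_subset_Icc_self ht)))
  have hf' := hf.dirDeriv hΩ (y - x)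
  obtain ⟨r, hr, h2⟩ := exists_hasDerivAt_eq_slope (fun t : ℝ => dirDeriv (y - x) f (x + t • (y - x)))
    (fun t => dirDeriv (y - x) (dirDeriv (y - x) f) (x + t • (y - x))) hs.1 (hcont hf' s hs.2.le)
    (fun t ht => hasDerivAt_line hΩ hf' (hmem t ⟨ht.1.le, (ht.2.trans hs.2).le⟩))
  have h3 : 0 ≤ dirDeriv (y - x) (dirDeriv (y - x) f) (x + r • (y - x)) := by
    have hm := hmem r ⟨hr.1.le, (hr.2.trans hs.2).le⟩
    by_cases hv : y - x = 0
    · simp [hv, dirDeriv]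
    · exact (hess_quadratic_pos hΩ hf (hp _ hm) hm hv).le
  rw [h2, le_div_iff₀ (by linarith [hs.1])] at h3
  simp only [zero_smul, add_zero, one_smul, add_sub_cancel, sub_zero, div_one] at h1 h3
  rw [dirDeriv_eq_pd _ _ x] at h3
  simp only [Pi.sub_apply] at h3
  linarith

theorem not_isLocalMax_of_posDef (hΩ : IsOpen Ω) (hf : ContDiffOn ℝ (⊤ : ℕ∞) f Ω)
    (hp : (hess f x).PosDef) (hx : x ∈ Ω) : ¬ IsLocalMax f x := by
  intro hm
  have hv : (Pi.single 0 1 : Fin 2 → ℝ) ≠ 0 := by simp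
  have hc : ContinuousAt (fun t : ℝ => x + t • (Pi.single 0 1 : Fin 2 → ℝ)) 0 := by fun_prop
  have hm' : IsLocalMax f (x + (0 : ℝ) • (Pi.single 0 1 : Fin 2 → ℝ)) := by simpa using hm
  have := (jet2_line hΩ hf hx (Pi.single 0 1)).of_isLocalMax
    (IsMaxFilter.comp_tendsto (g := fun t : ℝ => x + t • (Pi.single 0 1 : Fin 2 → ℝ))
      (b := (0 : ℝ)) hm' hc)
  exact absurd this.2 (not_le.2 (hess_quadratic_pos hΩ hf hp hx hv))

theorem SClass.nonneg (hS : SClass Ω C f) (hN : NormalizedDomain Ω) (hx : x ∈ Ω) : 0 ≤ f x := by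
  have hb : BddBelow (f '' Ω) :=
    (hN.isCompact_closure.bddBelow_image hS.2.2.2.1).mono (Set.image_mono subset_closure)
  rw [← hS.2.2.1]
  exact csInf_le hb ⟨x, hx, rfl⟩

theorem SClass.lt (hS : SClass Ω C f) (hN : NormalizedDomain Ω) (hx : x ∈ Ω) : f x < C := by
  by_contra! hle
  obtain ⟨z, hz, hmax⟩ := hN.isCompact_closure.exists_isMaxOn ⟨x, subset_closure hx⟩ hS.2.2.2.1
  obtain ⟨y, hy, hmax'⟩ : ∃ y ∈ Ω, IsMaxOn f (closure Ω) y := by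
    by_cases hzΩ : z ∈ Ω
    · exact ⟨z, hzΩ, hmax⟩
    · refine ⟨x, hx, fun w hw => le_trans (b := f z) (hmax hw) ?_⟩
      show f z ≤ f x
      rw [hS.2.2.2.2 z (mem_frontier_of_mem_closure hN.1 hz hzΩ)]
      exact hle
  exact not_isLocalMax_of_posDef hN.1 hS.1 (hS.2.1 y hy) hy
    (hmax'.isLocalMax (mem_of_superset (hN.1.mem_nhds hy) subset_closure))

theorem SClass.mem_of_lt (hS : SClass Ω C f) (hN : NormalizedDomain Ω) (hx : x ∈ closure Ω)
    (h : f x < C) : x ∈ Ω := by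
  by_contra hx'
  exact h.ne (hS.2.2.2.2 x (mem_frontier_of_mem_closure hN.1 hx hx'))

theorem SClass.isCompact_sublevel (hS : SClass Ω C f) (hN : NormalizedDomain Ω) {c : ℝ}
    (hc : c < C) : IsCompact {x | x ∈ Ω ∧ f x ≤ c} := by
  have : {x | x ∈ Ω ∧ f x ≤ c} = closure Ω ∩ f ⁻¹' Set.Iic c := by
    ext x
    exact ⟨fun h => ⟨subset_closure h.1, h.2⟩,
      fun h => ⟨hS.mem_of_lt hN h.1 (lt_of_le_of_lt h.2 hc), h.2⟩⟩
  rw [this]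
  exact hN.isCompact_closure.of_isClosed_subset
    (hS.2.2.2.1.preimage_isClosed_of_isClosed isClosed_closure isClosed_Iic) Set.inter_subset_left

theorem SClass.support_le (hS : SClass Ω C f) (hN : NormalizedDomain Ω) (hx : x ∈ Ω)
    (hy : y ∈ Ω) : pd 0 f x * y 0 + pd 1 f x * y 1 ≤ C + (legendreShift d f x - d) := by
  have := first_order_convexity hN.1 hN.2.1 hS.1 hS.2.1 hx hy
  have := hS.lt hN hy
  rw [legendreShift]
  linarith

theorem SClass.gradient_le (hS : SClass Ω C f) (hN : NormalizedDomain Ω) (hx : x ∈ Ω) :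
    0 ≤ C + (legendreShift d f x - d) ∧
      pd 0 f x ^ 2 + pd 1 f x ^ 2 ≤ (4 * (C + (legendreShift d f x - d))) ^ 2 := by
  have h0 := hS.support_le (d := d) hN hx hN.zero_mem
  simp only [Pi.zero_apply, mul_zero, add_zero] at h0
  refine ⟨h0, ?_⟩
  obtain ⟨n, hn⟩ : ∃ n, n = √(pd 0 f x ^ 2 + pd 1 f x ^ 2) := ⟨_, rfl⟩
  have hn2 : n ^ 2 = pd 0 f x ^ 2 + pd 1 f x ^ 2 := by rw [hn]; exact Real.sq_sqrt (by positivity)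
  rw [← hn2]
  have hn0 : 0 ≤ n := hn ▸ Real.sqrt_nonneg _
  refine pow_le_pow_left₀ hn0 ?_ 2
  rcases hn0.eq_or_lt with h | h
  · rw [← h]; linarith
  · have h1 := hS.support_le (d := d) hN hx (y := ![pd 0 f x / (4 * n), pd 1 f x / (4 * n)])
      (hN.mem_of_sq_le (by
        simp only [cons_val_zero, cons_val_one, div_pow, ← add_div]
        rw [← hn2, div_le_div_iff₀ (by positivity) (by norm_num)]
        linarith))
    simp only [cons_val_zero, cons_val_one] at h1
    have h2 : pd 0 f x * (pd 0 f x / (4 * n)) + pd 1 f x * (pd 1 f x / (4 * n)) = n / 4 := by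
      field_simp; linarith
    linarith

theorem SClass.map_zero_le (hS : SClass Ω C f) (hN : NormalizedDomain Ω) (hC : 0 < C) :
    f 0 ≤ 9 / 10 * C := by
  obtain ⟨_, ⟨p, hp, rfl⟩, hlt⟩ := exists_lt_of_csInf_lt
    (Set.Nonempty.image f ⟨0, hN.zero_mem⟩) (by rw [hS.2.2.1]; linarith : sInf (f '' Ω) < C / 2)
  have hq : (-(1 / 4 : ℝ)) • p ∈ Ω := hN.mem_of_sq_le (by
    have := hN.sq_lt_one hp
    simp only [Pi.smul_apply, smul_eq_mul]
    linarith)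
  have h1 := first_order_convexity hN.1 hN.2.1 hS.1 hS.2.1 hN.zero_mem hp
  have h2 := first_order_convexity hN.1 hN.2.1 hS.1 hS.2.1 hN.zero_mem hq
  have h3 := hS.lt hN hq
  simp only [Pi.smul_apply, smul_eq_mul, Pi.zero_apply] at h1 h2
  linarith

theorem legendreShift_zero : legendreShift d f 0 = d - f 0 := by
  simp [legendreShift]

theorem SClass.legendreShift_zero_le (hS : SClass Ω C f) (hN : NormalizedDomain Ω) (hx : x ∈ Ω) :
    legendreShift d f 0 ≤ legendreShift d f x := by
  have := first_order_convexity hN.1 hN.2.1 hS.1 hS.2.1 hx hN.zero_mem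
  rw [legendreShift_zero, legendreShift]
  simp only [Pi.zero_apply] at this
  linarith

end NormalizedDomain

section LegendreLowerBound

variable {Ω : Set (Fin 2 → ℝ)} {f : (Fin 2 → ℝ) → ℝ} {x y : Fin 2 → ℝ} {C d : ℝ}

theorem IsLocalMax.comp_smul_line {h : (Fin 2 → ℝ) → ℝ} (hm : IsLocalMax h x) (e : Fin 2 → ℝ) :
    IsLocalMax (fun t : ℝ => h (x + t • e)) 0 := by
  have hc : ContinuousAt (fun t : ℝ => x + t • e) 0 := by fun_prop
  have hm' : IsLocalMax h (x + (0 : ℝ) • e) := by simpa using hm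
  exact IsMaxFilter.comp_tendsto (g := fun t : ℝ => x + t • e) (b := (0 : ℝ)) hm' hc

theorem pd_eq_of_isLocalMax {c₀ c₁ : ℝ} (hΩ : IsOpen Ω) (hf : ContDiffOn ℝ (⊤ : ℕ∞) f Ω)
    (hx : x ∈ Ω) (hm : IsLocalMax (fun y => -(f y - (c₀ * y 0 + c₁ * y 1))) x) :
    pd 0 f x = c₀ ∧ pd 1 f x = c₁ := by
  have key : ∀ e : Fin 2 → ℝ, dirDeriv e f x = c₀ * e 0 + c₁ * e 1 := by
    intro e
    have h1 := ((jet2_line hΩ hf hx e).sub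
      (Jet2.affine (c₀ * x 0 + c₁ * x 1) (c₀ * e 0 + c₁ * e 1))).neg
    have h2 := (h1.congr' (k := fun t : ℝ => -(f (x + t • e) - (c₀ * (x + t • e) 0 + c₁ * (x + t • e) 1)))
      (Eventually.of_forall fun t => by
        simp only [Pi.add_apply, Pi.smul_apply, smul_eq_mul]; ring)).of_isLocalMax (hm.comp_smul_line e)
    linarith [h2.1]
  constructor
  · simpa [dirDeriv, pd] using key (Pi.single 0 1)
  · simpa [dirDeriv, pd] using key (Pi.single 1 1)

theorem one_le_det_of_isLocalMax {a c₀ c₁ : ℝ} (hΩ : IsOpen Ω) (hf : ContDiffOn ℝ (⊤ : ℕ∞) f Ω)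
    (hp : ∀ x ∈ Ω, (hess f x).PosDef) (hx : x ∈ Ω) (ha : 0 < a)
    (hm : IsLocalMax (fun y => legendreShift d f y -
      a * ((pd 0 f y - c₀) ^ 2 + (pd 1 f y - c₁) ^ 2)) x) :
    1 ≤ 4 * a ^ 2 * (hess f x).det := by
  have hf0 := hf.pd hΩ 0
  have hf1 := hf.pd hΩ 1
  obtain ⟨A, hA⟩ : ∃ A, A = pd 0 (pd 0 f) x := ⟨_, rfl⟩
  obtain ⟨B, hB⟩ : ∃ B, B = pd 0 (pd 1 f) x := ⟨_, rfl⟩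
  obtain ⟨D, hD⟩ : ∃ D, D = pd 1 (pd 1 f) x := ⟨_, rfl⟩
  have hdet : (hess f x).det = A * D - B ^ 2 := by rw [det_hess hΩ hf hx, hA, hB, hD]
  have hpos := det_hess_pos (hp x hx)
  rw [hdet] at hpos ⊢
  have hA0 : 0 < A := by
    rw [hA]
    exact hess_quadratic_pos hΩ hf (hp x hx) hx (v := Pi.single 0 1) (by simp)
  have key : ∀ e : Fin 2 → ℝ, ∃ p₂ q₂ : ℝ,
      (x 0 - 2 * a * (pd 0 f x - c₀)) * (A * e 0 + B * e 1) +
        (x 1 - 2 * a * (pd 1 f x - c₁)) * (B * e 0 + D * e 1) = 0 ∧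
      (x 0 - 2 * a * (pd 0 f x - c₀)) * p₂ + (x 1 - 2 * a * (pd 1 f x - c₁)) * q₂ +
        (e 0 * (A * e 0 + B * e 1) + e 1 * (B * e 0 + D * e 1)) -
        2 * a * ((A * e 0 + B * e 1) ^ 2 + (B * e 0 + D * e 1) ^ 2) ≤ 0 := by
    intro e
    have j0 := jet2_line hΩ hf0 hx e
    have j1 := jet2_line hΩ hf1 hx e
    have jf := jet2_line hΩ hf hx e
    have e0 : dirDeriv e (pd 0 f) x = A * e 0 + B * e 1 := by
      rw [dirDeriv_eq_pd, pd_comm hΩ hf hx 1 0, hA, hB]; ring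
    have e1 : dirDeriv e (pd 1 f) x = B * e 0 + D * e 1 := by
      rw [dirDeriv_eq_pd, hB, hD]; ring
    have ef : dirDeriv e f x = pd 0 f x * e 0 + pd 1 f x * e 1 := by
      rw [dirDeriv_eq_pd]; ring
    have eff : dirDeriv e (dirDeriv e f) x =
        e 0 * (A * e 0 + B * e 1) + e 1 * (B * e 0 + D * e 1) := by
      rw [dirDeriv_dirDeriv_eq hΩ hf hx, hA, hB, hD]; ring
    have jx0 := Jet2.affine (x 0) (e 0)
    have jx1 := Jet2.affine (x 1) (e 1)
    have J := ((((jx0.mul j0).add (jx1.mul j1)).sub jf).add (Jet2.const d)).sub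
      ((((j0.sub (Jet2.const c₀)).sq).add ((j1.sub (Jet2.const c₁)).sq)).const_mul a)
    have hJ := (J.congr' (k := fun t : ℝ => legendreShift d f (x + t • e) -
        a * ((pd 0 f (x + t • e) - c₀) ^ 2 + (pd 1 f (x + t • e) - c₁) ^ 2))
      (Eventually.of_forall fun t => by
        simp only [legendreShift, Pi.add_apply, Pi.smul_apply, smul_eq_mul]; ring)).of_isLocalMax
        (hm.comp_smul_line e)
    simp only [zero_smul, add_zero, zero_mul, e0, e1, ef, eff] at hJ
    exact ⟨dirDeriv e (dirDeriv e (pd 0 f)) x, dirDeriv e (dirDeriv e (pd 1 f)) x,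
      by linear_combination hJ.1, by linear_combination hJ.2⟩
  obtain ⟨_, _, k0, -⟩ := key ![D, -B]
  obtain ⟨_, _, k1, -⟩ := key ![-B, A]
  obtain ⟨_, _, -, l0⟩ := key ![D, -B]
  obtain ⟨_, _, -, l1⟩ := key ![-B, A]
  simp only [cons_val_zero, cons_val_one] at k0 k1 l0 l1
  have w0 : x 0 - 2 * a * (pd 0 f x - c₀) = 0 := by
    have : (x 0 - 2 * a * (pd 0 f x - c₀)) * (A * D - B ^ 2) = 0 := by linear_combination k0
    exact (mul_eq_zero.1 this).resolve_right hpos.ne'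
  have w1 : x 1 - 2 * a * (pd 1 f x - c₁) = 0 := by
    have : (x 1 - 2 * a * (pd 1 f x - c₁)) * (A * D - B ^ 2) = 0 := by linear_combination k1
    exact (mul_eq_zero.1 this).resolve_right hpos.ne'
  rw [w0, w1] at l0 l1
  have l0' : D ≤ 2 * a * (A * D - B ^ 2) := by
    refine le_of_mul_le_mul_left ?_ hpos
    linear_combination l0
  have l1' : A ≤ 2 * a * (A * D - B ^ 2) := by
    refine le_of_mul_le_mul_left ?_ hpos
    linear_combination l1
  refine le_of_mul_le_mul_left ?_ hpos
  have := mul_le_mul l1' l0' (by nlinarith) (by positivity)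
  nlinarith [sq_nonneg B]

theorem contDiffOn_legendreShift (hΩ : IsOpen Ω) (hf : ContDiffOn ℝ (⊤ : ℕ∞) f Ω) :
    ContDiffOn ℝ (⊤ : ℕ∞) (legendreShift d f) Ω := by
  have h0 := hf.pd hΩ 0
  have h1 := hf.pd hΩ 1
  unfold legendreShift
  fun_prop

theorem mul_add_mul_le_of_sq_le {p q r : ℝ} (hr : 0 ≤ r) (hpq : p ^ 2 + q ^ 2 ≤ r ^ 2)
    (hx : x 0 ^ 2 + x 1 ^ 2 < 1) : p * x 0 + q * x 1 ≤ r := by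
  refine le_of_sq_le_sq ?_ hr
  nlinarith [sq_nonneg (p * x 1 - q * x 0), sq_nonneg p, sq_nonneg q]

theorem SClass.exists_pd_eq (hS : SClass Ω C f) (hN : NormalizedDomain Ω) {θ : ℝ}
    (hθ : 0 < θ) (hθ' : θ < 1) :
    ∃ z ∈ Ω, pd 0 f z = (1 - θ) * pd 0 f 0 ∧ pd 1 f z = (1 - θ) * pd 1 f 0 := by
  have hcont : ContinuousOn (fun y : Fin 2 → ℝ =>
      f y - ((1 - θ) * pd 0 f 0 * y 0 + (1 - θ) * pd 1 f 0 * y 1)) (closure Ω) :=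
    hS.2.2.2.1.sub (by fun_prop)
  obtain ⟨z, hz, hmin⟩ := hN.isCompact_closure.exists_isMinOn
    ⟨0, subset_closure hN.zero_mem⟩ hcont
  have hzΩ : z ∈ Ω := by
    by_contra hz'
    have hfz := hS.2.2.2.2 z (mem_frontier_of_mem_closure hN.1 hz hz')
    have h0 := hmin (subset_closure hN.zero_mem)
    simp only [Set.mem_ofPred_eq, hfz, Pi.zero_apply, mul_zero, add_zero, sub_zero] at h0
    have h1 : pd 0 f 0 * z 0 + pd 1 f 0 * z 1 ≤ C - f 0 := by
      have hcl : IsClosed {y : Fin 2 → ℝ | pd 0 f 0 * y 0 + pd 1 f 0 * y 1 ≤ C - f 0} :=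
        isClosed_le (by fun_prop) continuous_const
      refine closure_minimal (fun y hy => ?_) hcl hz
      have := hS.support_le (d := 0) hN hN.zero_mem hy
      rw [legendreShift_zero] at this
      simp only [Set.mem_ofPred_eq]
      linarith
    have h2 := hS.lt hN hN.zero_mem
    nlinarith
  refine ⟨z, hzΩ, pd_eq_of_isLocalMax hN.1 hS.1 hzΩ ?_⟩
  have hmin' := hmin.isLocalMin (mem_of_superset (hN.1.mem_nhds hzΩ) subset_closure)
  exact hmin'.neg

theorem SClass.legendreShift_zero_ge {d₃ : ℝ} (hS : SClass Ω C f) (hN : NormalizedDomain Ω)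
    (hC : 0 < C) (hd₃ : 0 < d₃) (hv : ∀ x ∈ Ω, 0 < legendreShift d f x)
    (hρ : ∀ x ∈ Ω, 1 ≤ d₃ * (Real.exp (logRho f x) * legendreShift d f x)) :
    min C (1 / (172800 * d₃ ^ 2)) ≤ legendreShift d f 0 := by
  obtain ⟨ε, hε⟩ : ∃ ε, ε = legendreShift d f 0 := ⟨_, rfl⟩
  rw [← hε]
  have hε0 : 0 < ε := hε ▸ hv 0 hN.zero_mem
  rcases le_or_gt C ε with hCε | hCε
  · exact (min_le_left _ _).trans hCε
  refine (min_le_right _ _).trans ?_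
  obtain ⟨θ, hθ⟩ : ∃ θ, θ = ε / C := ⟨_, rfl⟩
  have hθ0 : 0 < θ := hθ ▸ by positivity
  have hθ1 : θ < 1 := by rw [hθ, div_lt_one hC]; exact hCε
  have hθC : θ * C = ε := by rw [hθ]; field_simp
  obtain ⟨z, hz, hz0, hz1⟩ := hS.exists_pd_eq hN hθ0 hθ1
  obtain ⟨p, hp⟩ : ∃ p, p = pd 0 f 0 := ⟨_, rfl⟩
  obtain ⟨q, hq⟩ : ∃ q, q = pd 1 f 0 := ⟨_, rfl⟩
  rw [← hp] at hz0
  rw [← hq] at hz1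
  have hd : d = ε + f 0 := by rw [hε, legendreShift_zero]; ring
  have hf0 := hS.nonneg hN hN.zero_mem
  have hf0' := hS.map_zero_le hN hC
  have hpq : p ^ 2 + q ^ 2 ≤ (4 * C) ^ 2 := by
    obtain ⟨h1, h2⟩ := hS.gradient_le (d := d) hN hN.zero_mem
    rw [← hp, ← hq] at h2
    refine h2.trans (pow_le_pow_left₀ (by linarith) ?_ 2)
    rw [legendreShift_zero]; linarith
  -- the two bounds on the set where the gradient is close to the one at `z`
  have hbound : ∀ x ∈ Ω, (pd 0 f x - (1 - θ) * p) ^ 2 + (pd 1 f x - (1 - θ) * q) ^ 2 ≤ (ε / 20) ^ 2 →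
      f x ≤ C - ε / 20 ∧ legendreShift d f x ≤ 6 * ε := by
    intro x hx hr
    have hx1 := hN.sq_lt_one hx
    have h1 := mul_add_mul_le_of_sq_le (by positivity) hr hx1
    have h2 := hS.support_le (d := d) hN hN.zero_mem hx
    have h3 := first_order_convexity hN.1 hN.2.1 hS.1 hS.2.1 hx hN.zero_mem
    have h4 := first_order_convexity hN.1 hN.2.1 hS.1 hS.2.1 hN.zero_mem hx
    have h5 := mul_add_mul_le_of_sq_le (x := x) (p := -p) (q := -q) (by positivity)
      (by linarith : (-p) ^ 2 + (-q) ^ 2 ≤ (4 * C) ^ 2) hx1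
    rw [legendreShift_zero, ← hp, ← hq] at h2
    rw [← hp, ← hq] at h4
    simp only [Pi.zero_apply, zero_sub, sub_zero] at h3 h4
    constructor
    · nlinarith [mul_le_mul_of_nonneg_left h2 (sub_nonneg.2 hθ1.le),
        mul_le_mul_of_nonneg_left hf0' hθ0.le]
    · rw [legendreShift]
      nlinarith [mul_le_mul_of_nonneg_left h5 hθ0.le]
  obtain ⟨a, ha⟩ : ∃ a, a = 2400 / ε := ⟨_, rfl⟩
  have ha0 : 0 < a := ha ▸ by positivity
  have haε : a * ε = 2400 := by rw [ha]; field_simp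
  obtain ⟨g, hg⟩ : ∃ g : (Fin 2 → ℝ) → ℝ,
    g = fun x => (pd 0 f x - (1 - θ) * p) ^ 2 + (pd 1 f x - (1 - θ) * q) ^ 2 := ⟨_, rfl⟩
  have hgc : ContinuousOn g Ω := by
    have h0 := (hS.1.pd hN.1 0).continuousOn
    have h1 := (hS.1.pd hN.1 1).continuousOn
    rw [hg]
    fun_prop
  have hvc : ContinuousOn (legendreShift d f) Ω := (contDiffOn_legendreShift hN.1 hS.1).continuousOn
  have hsub : {x | x ∈ Ω ∧ f x ≤ C - ε / 20} ⊆ Ω := fun _ h => h.1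
  have hKc := hS.isCompact_sublevel hN (show C - ε / 20 < C by linarith)
  have hK : IsCompact ({x | x ∈ Ω ∧ f x ≤ C - ε / 20} ∩ g ⁻¹' Set.Iic ((ε / 20) ^ 2)) :=
    hKc.of_isClosed_subset ((hgc.mono hsub).preimage_isClosed_of_isClosed hKc.isClosed isClosed_Iic)
      Set.inter_subset_left
  have hmem : ∀ x ∈ Ω, g x ≤ (ε / 20) ^ 2 →
      x ∈ {x | x ∈ Ω ∧ f x ≤ C - ε / 20} ∩ g ⁻¹' Set.Iic ((ε / 20) ^ 2) := fun x hx h =>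
    ⟨⟨hx, (hbound x hx (by simpa only [hg] using h)).1⟩, h⟩
  have hgz : g z = 0 := by simp [hg, hz0, hz1]
  obtain ⟨y, ⟨⟨hy, -⟩, hyg⟩, hmax⟩ := hK.exists_isMaxOn (f := fun x => legendreShift d f x - a * g x)
    ⟨z, hmem z hz (hgz.trans_le (by positivity))⟩
    ((hvc.sub (hgc.const_mul a)).mono (Set.inter_subset_left.trans hsub))
  have hyz : legendreShift d f z - a * g z ≤ legendreShift d f y - a * g y :=
    hmax (hmem z hz (hgz.trans_le (by positivity)))
  rw [hgz] at hyz
  replace hyg : g y ≤ (ε / 20) ^ 2 := hyg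
  have hyv := (hbound y hy (by simpa only [hg] using hyg)).2
  have hyg' : g y < (ε / 20) ^ 2 := by
    refine lt_of_le_of_ne hyg fun h => ?_
    rw [h] at hyz
    have := hv z hz
    nlinarith
  have hloc : IsLocalMax (fun x => legendreShift d f x - a * g x) y := by
    have hgy : ContinuousAt g y := hgc.continuousAt (hN.1.mem_nhds hy)
    filter_upwards [hN.1.mem_nhds hy, hgy.eventually_lt continuousAt_const hyg'] with x hx hxg
    exact hmax (hmem x hx hxg.le)
  simp only [hg] at hloc
  have h1 := one_le_det_of_isLocalMax hN.1 hS.1 hS.2.1 hy ha0 hloc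
  have h2 := hρ y hy
  obtain ⟨r, hr⟩ : ∃ r, r = Real.exp (logRho f y) := ⟨_, rfl⟩
  have hr0 : 0 < r := hr ▸ Real.exp_pos _
  have hdet : (hess f y).det * r ^ 4 = 1 := by
    rw [det_hess_eq_exp (hS.2.1 y hy), hr, ← Real.exp_nat_mul, ← Real.exp_add]
    norm_num
  rw [← hr] at h2
  have h3 : 1 ≤ d₃ * (r * (6 * ε)) := h2.trans (by gcongr)
  have h4 : r ^ 4 ≤ 4 * a ^ 2 := by nlinarith [pow_pos hr0 4]
  have h5 : r ^ 2 ≤ 2 * a := by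
    refine le_of_sq_le_sq ?_ (by positivity)
    linarith
  have h6 : (1 : ℝ) ≤ (d₃ * (r * (6 * ε))) ^ 2 := one_le_pow₀ h3
  rw [div_le_iff₀ (by positivity)]
  have h7 : (d₃ * (r * (6 * ε))) ^ 2 ≤ d₃ ^ 2 * (2 * a * (36 * ε ^ 2)) := by
    calc (d₃ * (r * (6 * ε))) ^ 2 = d₃ ^ 2 * (r ^ 2 * (36 * ε ^ 2)) := by ring
      _ ≤ _ := by gcongr
  have h8 : d₃ ^ 2 * (2 * a * (36 * ε ^ 2)) = ε * (172800 * d₃ ^ 2) := by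
    linear_combination (72 * d₃ ^ 2 * ε) * haε
  linarith

end LegendreLowerBound

section MaximumPrinciple

variable {Ω : Set (Fin 2 → ℝ)} {f : (Fin 2 → ℝ) → ℝ} {x y : Fin 2 → ℝ} {C d α c m K M : ℝ}

theorem exists_isLocalMax_neg_inv_add {R : (Fin 2 → ℝ) → ℝ} (hΩ : IsOpen Ω)
    (hf : ContinuousOn f Ω) (hR : ContinuousOn R Ω)
    (hcomp : ∀ b ≤ c, IsCompact {x | x ∈ Ω ∧ f x ≤ b}) (hm : 0 < m) (hx : x ∈ Ω) (hxc : f x < c) :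
    ∃ y ∈ Ω, f y < c ∧ IsLocalMax (fun z => -m * (c - f z)⁻¹ + R z) y ∧
      -m * (c - f x)⁻¹ + R x ≤ -m * (c - f y)⁻¹ + R y := by
  obtain ⟨b, hb⟩ := (hcomp c le_rfl).bddAbove_image (hR.mono fun _ h => h.1)
  replace hb : ∀ y ∈ Ω, f y ≤ c → R y ≤ b := fun y hy hyc => hb ⟨y, ⟨hy, hyc⟩, rfl⟩
  obtain ⟨A, hA⟩ : ∃ A, A = -m * (c - f x)⁻¹ + R x := ⟨_, rfl⟩
  obtain ⟨η, hη⟩ : ∃ η, η = min (c - f x) (m / (|b - A| + 1)) := ⟨_, rfl⟩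
  have hη0 : 0 < η := by rw [hη]; exact lt_min (by linarith) (by positivity)
  have hη1 : η ≤ c - f x := hη ▸ min_le_left _ _
  have hη2 : η * (|b - A| + 1) ≤ m := by
    rw [← le_div_iff₀ (by positivity)]
    exact hη ▸ min_le_right _ _
  have hfar : ∀ y ∈ Ω, f y < c → c - η < f y → -m * (c - f y)⁻¹ + R y ≤ A := by
    intro y hy hyc hyη
    have h1 := hb y hy hyc.le
    have h2 : b - A ≤ m * (c - f y)⁻¹ := by
      rw [← div_eq_mul_inv, le_div_iff₀ (by linarith)]
      nlinarith [le_abs_self (b - A), abs_nonneg (b - A)]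
    linarith
  obtain ⟨y, ⟨hy, hyc⟩, hmax⟩ := (hcomp (c - η) (by linarith)).exists_isMaxOn
    (f := fun z => -m * (c - f z)⁻¹ + R z) ⟨x, hx, by linarith⟩
    ((continuousOn_const.mul ((continuousOn_const.sub (hf.mono fun _ h => h.1)).inv₀ fun z hz => by
      have : f z ≤ c - η := hz.2
      exact (by linarith : 0 < c - f z).ne')).add (hR.mono fun _ h => h.1))
  have hAy : A ≤ -m * (c - f y)⁻¹ + R y := by
    rw [hA]
    exact hmax ⟨hx, by linarith⟩
  refine ⟨y, hy, by linarith, ?_, hA ▸ hAy⟩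
  filter_upwards [hΩ.mem_nhds hy, (hf.continuousAt (hΩ.mem_nhds hy)).eventually_lt
    continuousAt_const (show f y < c by linarith)] with z hz hzc
  rcases le_or_gt (f z) (c - η) with h | h
  · exact hmax ⟨hz, h⟩
  · exact (hfar z hz hzc h).trans hAy

theorem trace_hess_pos (hp : (hess f x).PosDef) : 0 < ∑ i, hess f x i i :=
  Finset.sum_pos (fun _ _ => hp.diag_pos) Finset.univ_nonempty

theorem Phi_nonneg (hΩ : IsOpen Ω) (hf : ContDiffOn ℝ (⊤ : ℕ∞) f Ω)
    (hp : ∀ x ∈ Ω, (hess f x).PosDef) (hx : x ∈ Ω) : 0 ≤ Phi f x := by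
  rw [Phi_eq hΩ hf hp hx]
  refine mul_nonneg (inv_nonneg.2 (det_hess_pos (hp x hx)).le) ?_
  obtain ⟨w, hw⟩ : ∃ w : Fin 2 → ℝ, w = ![pd 1 (logRho f) x, -pd 0 (logRho f) x] := ⟨_, rfl⟩
  have h1 : 0 ≤ dirDeriv w (dirDeriv w f) x := by
    by_cases h : w = 0
    · simp [h, dirDeriv]
    · exact (hess_quadratic_pos hΩ hf (hp x hx) hx h).le
  rw [dirDeriv_dirDeriv_eq hΩ hf hx, hw] at h1
  simp only [cons_val_zero, cons_val_one] at h1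
  rw [cofForm]
  linarith

theorem continuousOn_Phi (hΩ : IsOpen Ω) (hf : ContDiffOn ℝ (⊤ : ℕ∞) f Ω)
    (hp : ∀ x ∈ Ω, (hess f x).PosDef) : ContinuousOn (Phi f) Ω := by
  refine ContinuousOn.congr ?_ fun x hx => Phi_eq hΩ hf hp hx
  have hd := (contDiffOn_det_hess hΩ hf).continuousOn
  have hl := contDiffOn_logRho hΩ hf hp
  have l0 := (hl.pd hΩ 0).continuousOn
  have l1 := (hl.pd hΩ 1).continuousOn
  have a := ((hf.pd hΩ 0).pd hΩ 0).continuousOn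
  have b := ((hf.pd hΩ 1).pd hΩ 0).continuousOn
  have e := ((hf.pd hΩ 1).pd hΩ 1).continuousOn
  simp only [cofForm]
  exact (hd.inv₀ fun x hx => (det_hess_pos (hp x hx)).ne').mul (by fun_prop)

theorem continuousOn_testFun_zero (hΩ : IsOpen Ω) (hf : ContDiffOn ℝ (⊤ : ℕ∞) f Ω)
    (hp : ∀ x ∈ Ω, (hess f x).PosDef) (hv : ∀ x ∈ Ω, 0 < legendreShift d f x) :
    ContinuousOn (testFun α d c 0 K M f) Ω := by
  have hl := (contDiffOn_logRho hΩ hf hp).continuousOn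
  have hP := continuousOn_Phi hΩ hf hp
  have hV := (contDiffOn_legendreShift (d := d) hΩ hf).continuousOn
  have h0 := (hf.pd hΩ 0).continuousOn
  have h1 := (hf.pd hΩ 1).continuousOn
  have hT : ContinuousOn (fun x => ∑ i, hess f x i i) Ω :=
    continuousOn_finsetSum _ fun i _ => ((hf.pd hΩ i).pd hΩ i).continuousOn
  have hlT := hT.log fun x hx => (trace_hess_pos (hp x hx)).ne'
  have hlV := hV.log fun x hx => (hv x hx).ne'
  have hVi := hV.inv₀ fun x hx => (hv x hx).ne'
  have hE : ContinuousOn (fun x => Real.exp (-α * (logRho f x + Real.log (legendreShift d f x)))) Ω :=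
    (continuousOn_const.mul (hl.add hlV)).rexp
  unfold testFun testValue
  simp only [neg_zero, zero_mul, zero_add]
  exact ((((continuousOn_const.mul (hP.mul hE)).add (continuousOn_const.mul
    (((h0.pow 2).add (h1.pow 2)).mul (hVi.pow 2)))).add hlT).sub (continuousOn_const.mul hl)).sub
    (continuousOn_const.mul hlV)

theorem testFun_eq_add : testFun α d c m K M f x =
    -m * (c - f x)⁻¹ + testFun α d c 0 K M f x := by
  simp only [testFun, testValue]
  ring

theorem exp_testFun (hT : 0 < ∑ i, hess f x i i) (hv : 0 < legendreShift d f x) :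
    Real.exp (testFun α d c m K M f x) =
      Real.exp (-(m * (c - f x)⁻¹) + K * (Phi f x *
        Real.exp (-α * (logRho f x + Real.log (legendreShift d f x)))) +
        M * ((pd 0 f x ^ 2 + pd 1 f x ^ 2) * (legendreShift d f x)⁻¹ ^ 2)) *
      ((∑ i, hess f x i i) * (legendreShift d f x)⁻¹ ^ 2 *
        Real.exp (-α * (logRho f x + Real.log (legendreShift d f x)))) := by
  have h1 : (legendreShift d f x)⁻¹ = Real.exp (-Real.log (legendreShift d f x)) := by
    rw [Real.exp_neg, Real.exp_log hv]
  have h2 : ∑ i, hess f x i i = Real.exp (Real.log (∑ i, hess f x i i)) := (Real.exp_log hT).symm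
  have h3 : (∑ i, hess f x i i) * (legendreShift d f x)⁻¹ ^ 2 *
        Real.exp (-α * (logRho f x + Real.log (legendreShift d f x))) =
      Real.exp (Real.log (∑ i, hess f x i i) - α * logRho f x -
        (α + 2) * Real.log (legendreShift d f x)) := by
    rw [h2, h1, Real.log_exp, ← Real.exp_nat_mul, ← Real.exp_add, ← Real.exp_add]
    congr 1
    push_cast
    ring
  rw [h3, ← Real.exp_add]
  congr 1
  simp only [testFun, testValue]
  ring

theorem exp_neg_mul_one_add_sq_le {g : ℝ} (hm : 0 < m) (hg : 0 < g) :
    Real.exp (-(m * g)) * (1 + g ^ 2) ≤ 1 + 2 / m ^ 2 := by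
  have h1 := Real.quadratic_le_exp_of_nonneg (mul_pos hm hg).le
  have h2 : 0 < m * g := mul_pos hm hg
  rw [Real.exp_neg, inv_mul_le_iff₀ (Real.exp_pos _)]
  have h3 : (1 + m * g + (m * g) ^ 2 / 2) * (1 + 2 / m ^ 2) ≤
      Real.exp (m * g) * (1 + 2 / m ^ 2) := by gcongr
  refine le_trans ?_ h3
  have h4 : (1 + m * g + (m * g) ^ 2 / 2) * (1 + 2 / m ^ 2) =
      1 + g ^ 2 + (m * g + (m * g) ^ 2 / 2 + 2 / m ^ 2 + m * g * (2 / m ^ 2)) := by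
    field_simp
    ring
  rw [h4]
  have : 0 ≤ m * g + (m * g) ^ 2 / 2 + 2 / m ^ 2 + m * g * (2 / m ^ 2) := by positivity
  linarith

end MaximumPrinciple

section Main

variable {Ω : Set (Fin 2 → ℝ)} {f : (Fin 2 → ℝ) → ℝ} {x y : Fin 2 → ℝ}
  {C d α β d₃ c m K M B I E s : ℝ}

theorem exp_testFun_le_of_isLocalMax (hS : SClass Ω C f) (hN : NormalizedDomain Ω)
    (hpde : PDE2 f β Ω) (hx : x ∈ Ω) (hmax : IsLocalMax (testFun α d c m K M f) x)
    (hβ : 0 < β) (hα : 1 < α) (hd : 0 < d) (hs : s = α + β + 3) (hd₃ : 0 < d₃)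
    (hB : 0 < B) (hK : K = 1 / (1000 * d₃ * s ^ 2)) (hM : M = 1 / (100 * B))
    (hfc : f x < c) (hm : 0 < m) (hmg : 32 ≤ m * (c - f x)⁻¹) (hv : 0 < legendreShift d f x)
    (hI : (legendreShift d f x)⁻¹ ≤ I)
    (hE : Real.exp (-α * (logRho f x + Real.log (legendreShift d f x))) ≤ E)
    (hΦ : Phi f x * Real.exp (-α * (logRho f x + Real.log (legendreShift d f x))) ≤ d₃)
    (hgrad : (pd 0 f x ^ 2 + pd 1 f x ^ 2) * (legendreShift d f x)⁻¹ ^ 2 ≤ B) :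
    Real.exp (testFun α d c m K M f x) ≤ Real.exp (K * d₃ + M * B) *
      (2 / M * (m * (2 * E + (α + 2) * (d * I) / 2 * E) + 32 / K + 600 * s ^ 2 * d₃ + 2 * s * I * E) *
        (1 + 2 / m ^ 2)) := by
  have hT := trace_hess_pos (hS.2.1 x hx)
  rw [exp_testFun hT hv]
  have key := trace_le_of_isLocalMax hN.1 hS.1 hS.2.1 hpde hx hmax hβ hα hs hd₃ hB hK hM
    (hS.nonneg hN hx) hfc rfl rfl hm hmg hv rfl rfl rfl hΦ hgrad
  obtain ⟨i, hi⟩ : ∃ i, i = (legendreShift d f x)⁻¹ := ⟨_, rfl⟩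
  obtain ⟨g, hg⟩ : ∃ g, g = (c - f x)⁻¹ := ⟨_, rfl⟩
  obtain ⟨σ, hσ⟩ : ∃ σ, σ = Real.exp (-α * (logRho f x + Real.log (legendreShift d f x))) := ⟨_, rfl⟩
  obtain ⟨T, hT'⟩ : ∃ T, T = ∑ i, hess f x i i := ⟨_, rfl⟩
  rw [← hi] at hI
  rw [← hσ] at hE hΦ
  rw [← hi, ← hg, ← hσ, ← hT'] at key ⊢
  rw [← hi] at hgrad
  have hi0 : 0 < i := hi ▸ inv_pos.2 hv
  have hg0 : 0 < g := hg ▸ inv_pos.2 (by linarith)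
  have hσ0 : 0 < σ := hσ ▸ Real.exp_pos _
  have hs0 : 0 < s := by linarith
  have hK0 : 0 < K := by rw [hK]; positivity
  have hM0 : 0 < M := by rw [hM]; positivity
  have hα2 : 0 < α + 2 := by linarith
  have hE0 : 0 < E := hσ0.trans_le hE
  have hI0 : 0 < I := hi0.trans_le hI
  rw [← hT'] at hT
  obtain ⟨D, hD⟩ : ∃ D, D = m * (2 * E + (α + 2) * (d * I) / 2 * E) + 32 / K + 600 * s ^ 2 * d₃ +
    2 * s * I * E := ⟨_, rfl⟩
  rw [← hD]
  have h1 : T * i ^ 2 * σ ≤ 2 / M * (D * (1 + g ^ 2)) := by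
    have h2 := mul_le_mul_of_nonneg_right key hσ0.le
    have h3 : (2 * (m * g ^ 2) + m * g ^ 2 * ((α + 2) * (d * i)) / 2 + 32 / (K * σ) +
        600 * s ^ 2 * Phi f x + 2 * s * i) * σ =
        m * g ^ 2 * (2 * σ + (α + 2) * (d * i) / 2 * σ) + 32 / K + 600 * s ^ 2 * (Phi f x * σ) +
          2 * s * i * σ := by
      field_simp
    have h4 : m * g ^ 2 * (2 * σ + (α + 2) * (d * i) / 2 * σ) + 32 / K + 600 * s ^ 2 * (Phi f x * σ) +
          2 * s * i * σ ≤ m * g ^ 2 * (2 * E + (α + 2) * (d * I) / 2 * E) + 32 / K +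
          600 * s ^ 2 * d₃ + 2 * s * I * E := by gcongr
    have h5 : m * g ^ 2 * (2 * E + (α + 2) * (d * I) / 2 * E) + 32 / K +
          600 * s ^ 2 * d₃ + 2 * s * I * E ≤ D * (1 + g ^ 2) := by
      have h6 : D * (1 + g ^ 2) - (m * g ^ 2 * (2 * E + (α + 2) * (d * I) / 2 * E) + 32 / K +
          600 * s ^ 2 * d₃ + 2 * s * I * E) = m * (2 * E + (α + 2) * (d * I) / 2 * E) +
          g ^ 2 * (32 / K + 600 * s ^ 2 * d₃ + 2 * s * I * E) := by
        rw [hD]; ring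
      have h7 : 0 ≤ m * (2 * E + (α + 2) * (d * I) / 2 * E) +
          g ^ 2 * (32 / K + 600 * s ^ 2 * d₃ + 2 * s * I * E) := by positivity
      linarith
    have h8 : T * i ^ 2 * σ = 2 / M * (M / 2 * (T * i ^ 2) * σ) := by field_simp
    rw [h8]
    refine mul_le_mul_of_nonneg_left ?_ (by positivity)
    linarith
  have hD0 : 0 < D := by rw [hD]; positivity
  calc _ ≤ Real.exp (-(m * g) + K * d₃ + M * B) * (2 / M * (D * (1 + g ^ 2))) := by gcongr
    _ = Real.exp (K * d₃ + M * B) * (2 / M * D * (Real.exp (-(m * g)) * (1 + g ^ 2))) := by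
      rw [add_assoc, Real.exp_add]; ring
    _ ≤ _ := by
      have := exp_neg_mul_one_add_sq_le hm hg0
      gcongr

theorem gradient_mul_inv_sq_le {v₀ : ℝ} (hS : SClass Ω C f) (hN : NormalizedDomain Ω)
    (hC : 0 < C) (hd : 0 < d) (hx : x ∈ Ω) (hv₀ : 0 < v₀) (hv : v₀ ≤ legendreShift d f x) :
    (pd 0 f x ^ 2 + pd 1 f x ^ 2) * (legendreShift d f x)⁻¹ ^ 2 ≤ 16 * (1 + C / v₀) ^ 2 := by
  obtain ⟨h0, h1⟩ := hS.gradient_le (d := d) hN hx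
  obtain ⟨v, hv'⟩ : ∃ v, v = legendreShift d f x := ⟨_, rfl⟩
  rw [← hv'] at h0 h1 hv ⊢
  have hv0 : 0 < v := hv₀.trans_le hv
  have h2 : pd 0 f x ^ 2 + pd 1 f x ^ 2 ≤ (4 * (C + v)) ^ 2 :=
    h1.trans (pow_le_pow_left₀ (by linarith) (by linarith) 2)
  calc _ ≤ (4 * (C + v)) ^ 2 * v⁻¹ ^ 2 := by gcongr
    _ = 16 * (1 + C / v) ^ 2 := by field_simp; ring
    _ ≤ _ := by gcongr

theorem exp_mul_trace_le {v₀ : ℝ} (hS : SClass Ω C f) (hN : NormalizedDomain Ω)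
    (hpde : PDE2 f β Ω) (hC : 0 < C) (hβ : 0 < β) (hα : 1 < α) (hd : 0 < d) (hd₃ : 0 < d₃)
    (hs : s = α + β + 3) (hv₀ : 0 < v₀) (hB : B = 16 * (1 + C / v₀) ^ 2)
    (hK : K = 1 / (1000 * d₃ * s ^ 2)) (hM : M = 1 / (100 * B)) (hm : m = 32 * C)
    (hv : ∀ x ∈ Ω, v₀ ≤ legendreShift d f x)
    (hE : ∀ x ∈ Ω, Real.exp (-α * (logRho f x + Real.log (legendreShift d f x))) ≤ E)
    (hΦ : ∀ x ∈ Ω, Phi f x *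
      Real.exp (-α * (logRho f x + Real.log (legendreShift d f x))) ≤ d₃) (hx : x ∈ Ω) :
    Real.exp (-(32 * (2 + d₃) * C) / (C - f x)) *
      ((∑ i, hess f x i i) * (legendreShift d f x)⁻¹ ^ 2 *
        Real.exp (-α * (logRho f x + Real.log (legendreShift d f x)))) ≤
    Real.exp (K * d₃ + M * B) *
      (2 / M * (m * (2 * E + (α + 2) * (d * v₀⁻¹) / 2 * E) + 32 / K + 600 * s ^ 2 * d₃ +
        2 * s * v₀⁻¹ * E) * (1 + 2 / m ^ 2)) := by
  have hpos : ∀ x ∈ Ω, 0 < legendreShift d f x := fun x hx => hv₀.trans_le (hv x hx)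
  have hm0 : 0 < m := by rw [hm]; positivity
  have hB0 : 0 < B := by rw [hB]; positivity
  have hs0 : 0 < s := by linarith
  have hK0 : 0 < K := by rw [hK]; positivity
  have hM0 : 0 < M := by rw [hM]; positivity
  have hfx := hS.lt hN hx
  obtain ⟨c, hc⟩ : ∃ c, c = (C + f x) / 2 := ⟨_, rfl⟩
  have hcC : c < C := by linarith
  have htest : (fun z => -m * (c - f z)⁻¹ + testFun α d c 0 K M f z) = testFun α d c m K M f := by
    funext z; rw [testFun_eq_add (m := m)]
  obtain ⟨y, hy, hyc, hmax, hxy⟩ := exists_isLocalMax_neg_inv_add hN.1 hS.1.continuousOn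
    (continuousOn_testFun_zero (α := α) (c := c) (K := K) (M := M) hN.1 hS.1 hS.2.1 hpos)
    (fun b hb => hS.isCompact_sublevel hN (hb.trans_lt hcC)) hm0 hx (by linarith : f x < c)
  rw [htest] at hmax
  rw [← testFun_eq_add, ← testFun_eq_add] at hxy
  have hfy := hS.nonneg hN hy
  have h32 : 32 ≤ m * (c - f y)⁻¹ := by
    rw [← div_eq_mul_inv, le_div_iff₀ (by linarith), hm]
    linarith
  refine le_trans ?_ ((Real.exp_le_exp.2 hxy).trans (exp_testFun_le_of_isLocalMax hS hN hpde hy hmax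
    hβ hα hd hs hd₃ hB0 hK hM hyc hm0 h32 (hpos y hy) (inv_anti₀ hv₀ (hv y hy)) (hE y hy) (hΦ y hy)
    (hB ▸ gradient_mul_inv_sq_le hS hN hC hd hy hv₀ (hv y hy))))
  have hT := trace_hess_pos (hS.2.1 x hx)
  have hvx := hpos x hx
  have hΦ0 := Phi_nonneg hN.1 hS.1 hS.2.1 hx
  rw [exp_testFun hT hvx]
  refine mul_le_mul_of_nonneg_right (Real.exp_le_exp.2 ?_) (by positivity)
  have h1 : -(32 * (2 + d₃) * C) / (C - f x) ≤ -(m * (c - f x)⁻¹) := by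
    have h2 : c - f x = (C - f x) / 2 := by rw [hc]; ring
    have h3 : 0 < C - f x := by linarith
    rw [h2, hm, inv_div, ← sub_nonneg]
    have h4 : -(32 * C * (2 / (C - f x))) - -(32 * (2 + d₃) * C) / (C - f x) =
      32 * d₃ * C / (C - f x) := by field_simp; ring
    rw [h4]
    positivity
  have h5 : 0 ≤ K * (Phi f x * Real.exp (-α * (logRho f x + Real.log (legendreShift d f x)))) := by
    positivity
  have h6 : 0 ≤ M * ((pd 0 f x ^ 2 + pd 1 f x ^ 2) * (legendreShift d f x)⁻¹ ^ 2) := by positivity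
  linarith

theorem rho_rpow_mul_rpow {γ v : ℝ} (hp : (hess f x).PosDef) (hv : 0 < v) :
    rho f x ^ α * v ^ (α + γ) =
      Real.exp (γ * Real.log v) * Real.exp (α * (logRho f x + Real.log v)) := by
  rw [rho_eq_exp hp, ← Real.exp_mul, Real.rpow_def_of_pos hv, ← Real.exp_add, ← Real.exp_add]
  congr 1
  ring

end Main
/-- Proposition 3.7: for `f ∈ 𝒮(Ω,C)` solving PDE (1.2) with `β > 0`,
if `Φ/(ρ^α(d+u)^α) < d₃` and `1/(ρ(d+u)) < d₃` on `Ω` with `α > 1`, then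
`exp{-32(2+d₃)C/(C-f)} (∑ f_ii)/(ρ^α(d+u)^{α+2}) ≤ d₅` on `Ω`, with `d₅` depending only
on `α, β, d₃, C` (and `d`). -/
theorem statement13 (C β d α d₃ : ℝ) (hC : 0 < C) (hβ : 0 < β) (hd : 0 < d)
    (hα : 1 < α) (hd₃ : 0 < d₃) :
    ∃ d₅ : ℝ, 0 < d₅ ∧
      ∀ (Ω : Set (Fin 2 → ℝ)) (f u : (Fin 2 → ℝ) → ℝ),
        NormalizedDomain Ω → SClass Ω C f → PDE2 f β Ω → LegendreOf Ω f u →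
        (∀ x ∈ Ω, 0 < d + u (gradv f x)) →
        (∀ x ∈ Ω, Phi f x / ((rho f x) ^ α * (d + u (gradv f x)) ^ α) < d₃) →
        (∀ x ∈ Ω, 1 / (rho f x * (d + u (gradv f x))) < d₃) →
        ∀ x ∈ Ω,
          Real.exp (-(32 * (2 + d₃) * C) / (C - f x)) *
            (∑ i, hess f x i i) /
            ((rho f x) ^ α * (d + u (gradv f x)) ^ (α + 2)) ≤ d₅ := by
  obtain ⟨v₀, hv₀⟩ : ∃ v₀, v₀ = min C (1 / (172800 * d₃ ^ 2)) := ⟨_, rfl⟩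
  have hv₀0 : 0 < v₀ := by rw [hv₀]; exact lt_min hC (by positivity)
  obtain ⟨s, hs⟩ : ∃ s, s = α + β + 3 := ⟨_, rfl⟩
  obtain ⟨B, hB⟩ : ∃ B, B = 16 * (1 + C / v₀) ^ 2 := ⟨_, rfl⟩
  obtain ⟨K, hK⟩ : ∃ K, K = 1 / (1000 * d₃ * s ^ 2) := ⟨_, rfl⟩
  obtain ⟨M, hM⟩ : ∃ M, M = 1 / (100 * B) := ⟨_, rfl⟩
  obtain ⟨m, hm⟩ : ∃ m, m = 32 * C := ⟨_, rfl⟩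
  obtain ⟨E, hE⟩ : ∃ E, E = Real.exp (α * Real.log d₃) := ⟨_, rfl⟩
  have hs0 : 0 < s := by linarith
  have hα2 : 0 < α + 2 := by linarith
  have hm0 : 0 < m := by rw [hm]; positivity
  have hB0 : 0 < B := by rw [hB]; positivity
  have hK0 : 0 < K := by rw [hK]; positivity
  have hM0 : 0 < M := by rw [hM]; positivity
  have hE0 : 0 < E := by rw [hE]; positivity
  refine ⟨Real.exp (K * d₃ + M * B) *
      (2 / M * (m * (2 * E + (α + 2) * (d * v₀⁻¹) / 2 * E) + 32 / K + 600 * s ^ 2 * d₃ +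
        2 * s * v₀⁻¹ * E) * (1 + 2 / m ^ 2)), by positivity, ?_⟩
  intro Ω f u hN hS hpde hu hpos hΦ hρ x hx
  have huv : ∀ x ∈ Ω, d + u (gradv f x) = legendreShift d f x := by
    intro x hx
    rw [hu x hx, Fin.sum_univ_two, legendreShift]
    simp only [gradv]
    ring
  have hv : ∀ x ∈ Ω, 0 < legendreShift d f x := fun x hx => huv x hx ▸ hpos x hx
  have hρv : ∀ x ∈ Ω, 1 ≤ d₃ * (Real.exp (logRho f x) * legendreShift d f x) := by
    intro x hx
    have h := hρ x hx
    rw [huv x hx, rho_eq_exp (hS.2.1 x hx), div_lt_iff₀ (mul_pos (Real.exp_pos _) (hv x hx))] at h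
    exact h.le
  have hlow : ∀ x ∈ Ω, v₀ ≤ legendreShift d f x := fun x hx =>
    hv₀ ▸ (hS.legendreShift_zero_ge hN hC hd₃ hv hρv).trans (hS.legendreShift_zero_le hN hx)
  have hEσ : ∀ x ∈ Ω,
      Real.exp (-α * (logRho f x + Real.log (legendreShift d f x))) ≤ E := by
    intro x hx
    have h := Real.log_le_log one_pos (hρv x hx)
    rw [Real.log_one, Real.log_mul hd₃.ne' (mul_pos (Real.exp_pos _) (hv x hx)).ne',
      Real.log_mul (Real.exp_pos _).ne' (hv x hx).ne', Real.log_exp] at h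
    rw [hE]
    refine Real.exp_le_exp.2 ?_
    nlinarith
  have hΦσ : ∀ x ∈ Ω, Phi f x *
      Real.exp (-α * (logRho f x + Real.log (legendreShift d f x))) ≤ d₃ := by
    intro x hx
    have h := hΦ x hx
    have h1 := rho_rpow_mul_rpow (α := α) (γ := 0) (hS.2.1 x hx) (hv x hx)
    rw [add_zero, zero_mul, Real.exp_zero, one_mul] at h1
    rw [huv x hx, h1, div_eq_mul_inv, ← Real.exp_neg, ← neg_mul] at h
    exact h.le
  refine le_of_eq_of_le ?_ (exp_mul_trace_le hS hN hpde hC hβ hα hd hd₃ hs hv₀0 hB hK hM hm hlow hEσ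
    hΦσ hx)
  have h2 : Real.exp (2 * Real.log (legendreShift d f x)) = legendreShift d f x ^ 2 := by
    rw [← Real.exp_log (pow_pos (hv x hx) 2), Real.log_pow]
    norm_num
  rw [huv x hx, rho_rpow_mul_rpow (hS.2.1 x hx) (hv x hx), h2, neg_mul, Real.exp_neg]
  have := (hv x hx).ne'
  field_simp
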